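/- For any basepoint x₁ ∈ ℙ² ∖ C⁽¹⁾ and any basepoint x₂ ∈ ℙ² ∖ C⁽²⁾, the fundamental groups π₁(ℙ² ∖ C⁽¹⁾, x₁) and π₁(ℙ² ∖ C⁽²⁾, x₂) are not isomorphic. -/

import Mathlib

noncomputable section

open MvPolynomial

/-- the complex projective plane -/
abbrev P2 := Projectivization ℂ (Fin 3 → ℂ)

instance : TopologicalSpace P2 :=
  inferInstanceAs (TopologicalSpace (Quotient (projectivizationSetoid ℂ (Fin 3 → ℂ))))

/-- the zero locus in ℙ² of a homogeneous polynomial F: the set of points all of whose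
representative vectors are zeros of F -/
def VV (F : MvPolynomial (Fin 3) ℂ) : Set P2 :=
  {P | ∀ (v : Fin 3 → ℂ) (h : v ≠ 0), Projectivization.mk ℂ v h = P → eval v F = 0}

/-- the singular locus of the curve {F = 0}: points at which all three partial
derivatives of F vanish (at every representative vector) -/
def SingLoc (F : MvPolynomial (Fin 3) ℂ) : Set P2 :=
  {P | ∀ (v : Fin 3 → ℂ) (h : v ≠ 0), Projectivization.mk ℂ v h = P →
    ∀ i : Fin 3, eval v (pderiv i F) = 0}

/-- the conic F₁ = 8z²−20yz+36xz+17y²−18xy -/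
def F₁ : MvPolynomial (Fin 3) ℂ :=
  8 * X 2 ^ 2 - 20 * X 1 * X 2 + 36 * X 0 * X 2 + 17 * X 1 ^ 2 - 18 * X 0 * X 1

/-- the quartic Q₁ = 8x²z²−16xy²z+52x²yz−36x³z−37x²y²+18x³y−y⁴+20xy³ -/
def Q₁ : MvPolynomial (Fin 3) ℂ :=
  8 * X 0 ^ 2 * X 2 ^ 2 - 16 * X 0 * X 1 ^ 2 * X 2 + 52 * X 0 ^ 2 * X 1 * X 2
    - 36 * X 0 ^ 3 * X 2 - 37 * X 0 ^ 2 * X 1 ^ 2 + 18 * X 0 ^ 3 * X 1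
    - X 1 ^ 4 + 20 * X 0 * X 1 ^ 3

/-- the conic F₂ = 3x²+2xy+108z² -/
def F₂ : MvPolynomial (Fin 3) ℂ :=
  3 * X 0 ^ 2 + 2 * X 0 * X 1 + 108 * X 2 ^ 2

/-- the quartic Q₂ = 2xy³+3x²y²+108y²z²−x⁴ -/
def Q₂ : MvPolynomial (Fin 3) ℂ :=
  2 * X 0 * X 1 ^ 3 + 3 * X 0 ^ 2 * X 1 ^ 2 + 108 * X 1 ^ 2 * X 2 ^ 2 - X 0 ^ 4

namespace Holonomy

open Topology unitInterval Set

variable {X Z W K : Type*} [TopologicalSpace X] [TopologicalSpace Z] [TopologicalSpace W] [Group K]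

section Transport

variable {S : Set X} [PathConnectedSpace S] {x₁ : S} (ρ : FundamentalGroup S x₁ →* K)

/-- Parallel transport along a homotopy class of paths in the local system attached to a
representation of the fundamental group. -/
def transport {a b : S} (c : Path.Homotopic.Quotient a b) : K :=
  (ρ (FundamentalGroup.fromPath
    ((Path.Homotopic.Quotient.mk (PathConnectedSpace.somePath x₁ a)).trans
      (c.trans (Path.Homotopic.Quotient.mk (PathConnectedSpace.somePath x₁ b)).symm))))⁻¹

lemma transport_trans {a b c : S} (p : Path.Homotopic.Quotient a b)
    (q : Path.Homotopic.Quotient b c) :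
    transport ρ (p.trans q) = transport ρ p * transport ρ q := by
  unfold transport
  rw [← mul_inv_rev, ← map_mul, FundamentalGroup.mul_def]
  congr 2
  simp only [FundamentalGroup.fromPath]
  grind

lemma transport_refl (a : S) : transport ρ (Path.Homotopic.Quotient.refl a) = 1 := by
  have h := transport_trans ρ (Path.Homotopic.Quotient.refl a) (Path.Homotopic.Quotient.refl a)
  simpa using h

lemma transport_symm {a b : S} (p : Path.Homotopic.Quotient a b) :
    transport ρ p.symm = (transport ρ p)⁻¹ := by
  rw [eq_inv_iff_mul_eq_one, ← transport_trans]
  simp [transport_refl]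

open Classical in
/-- The holonomy of a path in the ambient space; it is trivial unless the path stays in `S`. -/
def hol (γ : C(I, X)) : K :=
  if h : ∀ t, γ t ∈ S then
    transport ρ (Path.Homotopic.Quotient.mk
      (⟨⟨fun t => ⟨γ t, h t⟩, by fun_prop⟩, rfl, rfl⟩ :
        Path (⟨γ 0, h 0⟩ : S) (⟨γ 1, h 1⟩ : S)))
  else 1

/-- A gauge over `T`, along a map `f`: a function trivialising the holonomy. -/
def IsGauge (R : C(I, X) → K) (f : C(Z, X)) (T : Set Z) (g : Z → K) : Prop :=
  ∀ γ : C(I, Z), (∀ t, γ t ∈ T) → R (f.comp γ) = (g (γ 0))⁻¹ * g (γ 1)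

lemma exists_isGauge (f : C(Z, X)) (T : Set Z) (hT : T.Nonempty → SimplyConnectedSpace T)
    (hf : ∀ z ∈ T, f z ∈ S) : ∃ g : Z → K, IsGauge (hol ρ) f T g := by
  classical
  by_cases hne : T.Nonempty
  swap
  · refine ⟨fun _ => 1, fun γ hγ => ?_⟩
    exact (hne ⟨_, hγ 0⟩).elim
  have := hT hne
  obtain ⟨z0, hz0⟩ := hne
  let F : C(T, S) := ⟨fun z => ⟨f z, hf z z.2⟩, by fun_prop⟩
  refine ⟨fun z => if h : z ∈ T then transport ρ
    (Path.Homotopic.Quotient.map (Path.Homotopic.Quotient.mk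
      (PathConnectedSpace.somePath (⟨z0, hz0⟩ : T) ⟨z, h⟩)) F) else 1, fun γ hγ => ?_⟩
  have hS : ∀ t, (f.comp γ) t ∈ S := fun t => hf _ (hγ t)
  simp only [hol, dif_pos hS, dif_pos (hγ 0), dif_pos (hγ 1)]
  rw [← transport_symm, ← transport_trans]
  let γ' : Path (⟨γ 0, hγ 0⟩ : T) ⟨γ 1, hγ 1⟩ := ⟨⟨fun t => ⟨γ t, hγ t⟩, by fun_prop⟩, rfl, rfl⟩
  let p (z : T) := PathConnectedSpace.somePath (⟨z0, hz0⟩ : T) z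
  have key : Path.Homotopic.Quotient.mk γ' =
      Path.Homotopic.Quotient.mk ((p ⟨γ 0, hγ 0⟩).symm.trans (p ⟨γ 1, hγ 1⟩)) :=
    Subsingleton.elim _ _
  have := congrArg (fun c => transport ρ (Path.Homotopic.Quotient.map c F)) key
  refine Eq.trans ?_ (this.trans ?_)
  · rfl
  · rw [← Path.Homotopic.Quotient.mk_map, Path.map_trans, ← Path.map_symm,
      Path.Homotopic.Quotient.mk_trans, Path.Homotopic.Quotient.mk_symm]
    rfl

lemma exists_loop_hol_eq_conj : ∃ k : K, ∀ c : FundamentalGroup S x₁, ∃ γ : C(I, X),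
    (∀ t, γ t ∈ S) ∧ γ 0 = x₁ ∧ γ 1 = x₁ ∧ hol ρ γ = k⁻¹ * (ρ c)⁻¹ * k := by
  refine ⟨ρ (FundamentalGroup.fromPath
      (Path.Homotopic.Quotient.mk (PathConnectedSpace.somePath x₁ x₁))), fun c => ?_⟩
  obtain ⟨p, rfl⟩ := Path.Homotopic.Quotient.mk_surjective c
  refine ⟨⟨fun t => p t, by fun_prop⟩, fun t => (p t).2, by simp, by simp, ?_⟩
  have hS : ∀ t, (⟨fun t => p t, by fun_prop⟩ : C(I, X)) t ∈ S := fun t => (p t).2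
  rw [hol, dif_pos hS]
  have h0 : (⟨(p 0 : X), hS 0⟩ : S) = x₁ := by simp
  have h1 : (⟨(p 1 : X), hS 1⟩ : S) = x₁ := by simp
  have hcast : ∀ (a b : S) (ha : a = x₁) (hb : b = x₁) (q : Path a b) (q' : Path x₁ x₁)
      (_ : ∀ t, q t = q' t), transport ρ (Path.Homotopic.Quotient.mk q) =
        transport ρ (Path.Homotopic.Quotient.mk q') := by
    rintro a b rfl hb q q' h
    subst hb
    congr 2
    ext t
    rw [h t]
  rw [hcast _ _ h0 h1 _ p (fun t => by rfl)]
  unfold transport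
  rw [← map_inv, ← map_inv, ← map_inv, ← map_mul, ← map_mul]
  congr 1
  simp only [FundamentalGroup.fromPath, FundamentalGroup.mul_def, FundamentalGroup.inv_def]
  generalize Path.Homotopic.Quotient.mk (PathConnectedSpace.somePath x₁ x₁) = a
  generalize Path.Homotopic.Quotient.mk p = b
  change (a.trans (b.trans a.symm)).symm = a.trans (b.symm.trans a.symm)
  clear * -
  obtain ⟨a, rfl⟩ := Path.Homotopic.Quotient.mk_surjective a
  obtain ⟨b, rfl⟩ := Path.Homotopic.Quotient.mk_surjective b
  rw [← Path.Homotopic.Quotient.trans_assoc]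
  simp only [← Path.Homotopic.Quotient.mk_trans, ← Path.Homotopic.Quotient.mk_symm,
    Path.trans_symm, Path.symm_symm]

/-- The holonomies along the four sides of a square. -/
lemma hol_square {f : C(Z, X)} (q : C(I × I, Z)) (hq : ∀ s, f (q s) ∈ S) {a b c d : C(I, Z)}
    (ha : ∀ t, a t = q (t, 0)) (hb : ∀ t, b t = q (t, 1)) (hc : ∀ t, c t = q (0, t))
    (hd : ∀ t, d t = q (1, t)) :
    hol ρ (f.comp c) * hol ρ (f.comp b) = hol ρ (f.comp a) * hol ρ (f.comp d) := by
  have hI : ContractibleSpace I := (convex_Icc (0 : ℝ) 1).contractibleSpace ⟨0, by simp⟩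
  obtain ⟨g, hg⟩ := exists_isGauge ρ (f.comp q) (univ : Set (I × I))
    (fun _ => by
      have : ContractibleSpace (univ : Set (I × I)) :=
        (Homeomorph.Set.univ (I × I)).contractibleSpace
      infer_instance) (fun t _ => hq t)
  have key : ∀ (u : C(I, I × I)) (v : C(I, Z)), (∀ t, v t = q (u t)) →
      hol ρ (f.comp v) = (g (u 0))⁻¹ * g (u 1) := by
    intro u v h
    rw [← hg u (fun _ => mem_univ _)]
    congr 1
    ext t
    simp [h t]
  rw [key ⟨fun t => (t, 0), by fun_prop⟩ a ha, key ⟨fun t => (t, 1), by fun_prop⟩ b hb,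
    key ⟨fun t => (0, t), by fun_prop⟩ c hc, key ⟨fun t => (1, t), by fun_prop⟩ d hd]
  simp

end Transport

lemma IsGauge.const_mul {R : C(I, X) → K} {f : C(Z, X)} {T : Set Z} {g : Z → K}
    (h : IsGauge R f T g) (k : K) : IsGauge R f T (fun z => k * g z) := fun γ hγ => by
  rw [h γ hγ]; group

lemma IsGauge.comp {R : C(I, X) → K} {f : C(Z, X)} {T : Set Z} {g : Z → K}
    (h : IsGauge R f T g) (u : C(W, Z)) : IsGauge R (f.comp u) (u ⁻¹' T) (g ∘ u) := fun γ hγ =>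
  h (u.comp γ) hγ

/-- A gauge along a chart descends to a gauge on the image, through a continuous section. -/
lemma IsGauge.of_section {R : C(I, X) → K} {f : C(Z, X)} {T : Set Z} {g : Z → K}
    (h : IsGauge R f T g) {U : Set X} {l : X → Z} (hl : ContinuousOn l U)
    (hlT : ∀ x ∈ U, l x ∈ T) (hfl : ∀ x ∈ U, f (l x) = x) :
    IsGauge R (ContinuousMap.id X) U (g ∘ l) := fun γ hγ => by
  have hc : Continuous (l ∘ γ) := hl.comp_continuous γ.continuous hγ
  have := h ⟨l ∘ γ, hc⟩ fun t => hlT _ (hγ t)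
  have e : f.comp ⟨l ∘ γ, hc⟩ = (ContinuousMap.id X).comp γ := by
    ext t; simp [hfl _ (hγ t)]
  rw [e] at this
  exact this

/-- Two gauges along the same map differ by a constant on a path. -/
lemma IsGauge.eq_of_path {R : C(I, X) → K} {f : C(Z, X)} {T T' : Set Z} {g g' : Z → K}
    (h : IsGauge R f T g) (h' : IsGauge R f T' g') (γ : C(I, Z)) (hγ : ∀ t, γ t ∈ T)
    (hγ' : ∀ t, γ t ∈ T') : g (γ 1) * (g' (γ 1))⁻¹ = g (γ 0) * (g' (γ 0))⁻¹ := by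
  have e := (h γ hγ).symm.trans (h' γ hγ')
  have e2 : g (γ 1) = g (γ 0) * ((g' (γ 0))⁻¹ * g' (γ 1)) := by rw [← e]; group
  rw [e2]; group

lemma IsGauge.eq_of_isPathConnected {R : C(I, X) → K} {f : C(Z, X)} {T T' : Set Z} {g g' : Z → K}
    (h : IsGauge R f T g) (h' : IsGauge R f T' g') {C : Set Z} (hC : IsPathConnected C)
    (hCT : C ⊆ T) (hCT' : C ⊆ T') {z w : Z} (hz : z ∈ C) (hw : w ∈ C) :
    g z * (g' z)⁻¹ = g w * (g' w)⁻¹ := by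
  obtain ⟨p, hp⟩ := hC.joinedIn w hw z hz
  have := h.eq_of_path h' p.toContinuousMap (fun t => hCT (hp t)) (fun t => hCT' (hp t))
  simpa using this

section Flat

/-- A section of the bundle of right cosets of `A` which is flat over `O`. -/
def FlatOn (R : C(I, X) → K) (A : Subgroup K) (O : Set X) (G : X → K) : Prop :=
  ∀ γ : C(I, X), (∀ t, γ t ∈ O) → G (γ 0) * R γ * (G (γ 1))⁻¹ ∈ A

variable {S : Set X} [PathConnectedSpace S] {x₁ : S} (ρ : FundamentalGroup S x₁ →* K)
  {A : Subgroup K} {O : Set X} {G : X → K}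

lemma flatOn_of_local (f : C(Z, X)) {O : Set Z} {G : Z → K} (hOS : ∀ z ∈ O, f z ∈ S)
    (h : ∀ x ∈ O, ∃ U ∈ 𝓝 x, ∀ γ : C(I, Z), (∀ t, γ t ∈ O) → (∀ t, γ t ∈ U) →
      G (γ 0) * hol ρ (f.comp γ) * (G (γ 1))⁻¹ ∈ A) :
    FlatOn (fun γ : C(I, Z) => hol ρ (f.comp γ)) A O G := by
  intro γ hγ
  obtain ⟨g, hg⟩ := exists_isGauge ρ (f.comp γ) (univ : Set I)
    (fun _ => by
      have : ContractibleSpace (univ : Set I) :=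
        have : ContractibleSpace I := (convex_Icc (0 : ℝ) 1).contractibleSpace ⟨0, by simp⟩
        (Homeomorph.Set.univ I).contractibleSpace
      infer_instance) (fun z _ => hOS _ (hγ z))
  have : LocallyPathConnectedSpace I := (convex_Icc (0 : ℝ) 1).locallyPathConnectedSpace
  have key : ∀ s t : I, G (γ s) * ((g s)⁻¹ * g t) * (G (γ t))⁻¹ ∈ A := by
    intro s t
    refine IsPreconnected.induction₂ (isPreconnected_univ (α := I))
      (fun s t => G (γ s) * ((g s)⁻¹ * g t) * (G (γ t))⁻¹ ∈ A) ?_ ?_ ?_ (mem_univ s) (mem_univ t)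
    · intro s _
      obtain ⟨U, hU, hUγ⟩ := h (γ s) (hγ s)
      have hV : γ ⁻¹' U ∈ 𝓝 s := γ.continuous.continuousAt.preimage_mem_nhds hU
      obtain ⟨V, ⟨hV1, hV2⟩, hV3⟩ := (LocallyPathConnectedSpace.path_connected_basis s).mem_iff.1 hV
      rw [nhdsWithin_univ]
      filter_upwards [hV1] with t ht
      obtain ⟨p, hp⟩ := hV2.joinedIn s (mem_of_mem_nhds hV1) t ht
      have e := hg p.toContinuousMap (fun _ => mem_univ _)
      have := hUγ (γ.comp p.toContinuousMap) (fun t => hγ _) (fun t => hV3 (hp t))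
      rw [← ContinuousMap.comp_assoc, e] at this
      simpa using this
    · intro a b c _ _ _ h1 h2
      have := A.mul_mem h1 h2
      convert this using 1
      group
    · intro a b _ _ h1
      have := A.inv_mem h1
      convert this using 1
      group
  beta_reduce
  have e := hg (ContinuousMap.id I) (fun _ => mem_univ _)
  have := key 0 1
  rw [← show (f.comp γ).comp (ContinuousMap.id I) = f.comp γ from rfl, e]
  simpa using this

/-- Extension of a flat section across a thin closed subset. -/
lemma exists_flatOn_of_dense [LocallyPathConnectedSpace X]
    {S' : Set X} (hSS' : S' ⊆ S) (hO : ∀ x ∈ S', x ∈ closure O)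
    (h : ∀ x ∈ S', ∃ U : Set X, IsOpen U ∧ x ∈ U ∧ U ⊆ S' ∧
      ∃ k : X → K, IsGauge (hol ρ) (ContinuousMap.id X) U k ∧
      ∀ y ∈ U ∩ O, ∀ y' ∈ U ∩ O, G y * (k y)⁻¹ * k y' * (G y')⁻¹ ∈ A) :
    ∃ G' : X → K, FlatOn (hol ρ) A S' G' := by
  classical
  choose! U hUo hxU hUS k hk hA using h
  have hne : ∀ x ∈ S', (U x ∩ O).Nonempty := fun x hx =>
    mem_closure_iff.1 (hO x hx) _ (hUo x hx) (hxU x hx)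
  choose! y hy using hne
  let G' : X → K := fun x => G (y x) * (k x (y x))⁻¹ * k x x
  have claim : ∀ x ∈ S', ∀ z ∈ U x, G' z * (k x z)⁻¹ * k x (y x) * (G (y x))⁻¹ ∈ A := by
    intro x hx z hz
    have hzS := hUS x hx hz
    obtain ⟨V, ⟨hV1, hV2⟩, hV3⟩ := (LocallyPathConnectedSpace.path_connected_basis z).mem_iff.1
      (((hUo x hx).inter (hUo z hzS)).mem_nhds ⟨hz, hxU z hzS⟩)
    obtain ⟨w, hwV, hwO⟩ := mem_closure_iff_nhds.1 (hO z hzS) V hV1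
    have e := (hk x hx).eq_of_isPathConnected (hk z hzS) hV2 (fun a ha => (hV3 ha).1)
      (fun a ha => (hV3 ha).2) hwV (mem_of_mem_nhds hV1)
    have h1 := hA z hzS (y z) (hy z hzS) w ⟨(hV3 hwV).2, hwO⟩
    have h2 := hA x hx w ⟨(hV3 hwV).1, hwO⟩ (y x) (hy x hx)
    have h3 := A.mul_mem h1 h2
    have e2 : k z w = k z z * (k x z)⁻¹ * k x w := by
      have : k z w = (k x w * (k z w)⁻¹)⁻¹ * k x w := by group
      rw [this, e]; group
    convert h3 using 1
    rw [e2]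
    simp only [G']
    group
  refine ⟨G', flatOn_of_local ρ (ContinuousMap.id X) hSS' fun x hx =>
    ⟨U x, (hUo x hx).mem_nhds (hxU x hx), ?_⟩⟩
  intro γ hγS hγU
  have e := hk x hx γ hγU
  rw [e]
  have h3 := A.mul_mem (claim x hx _ (hγU 0)) (A.inv_mem (claim x hx _ (hγU 1)))
  convert h3 using 1
  group

/-- A flat section for an abelian subgroup forces the representation to have abelian image. -/
lemma FlatOn.commute (hG : FlatOn (hol ρ) A S G) (hA : ∀ a ∈ A, ∀ b ∈ A, a * b = b * a)
    (c d : FundamentalGroup S x₁) : ρ c * ρ d = ρ d * ρ c := by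
  obtain ⟨k, hk⟩ := exists_loop_hol_eq_conj ρ
  have key : ∀ c : FundamentalGroup S x₁, G x₁ * (k⁻¹ * (ρ c)⁻¹ * k) * (G x₁)⁻¹ ∈ A := by
    intro c
    obtain ⟨γ, h1, h2, h3, h4⟩ := hk c
    have := hG γ h1
    rwa [h2, h3, h4] at this
  have e := hA _ (A.inv_mem (key c)) _ (A.inv_mem (key d))
  have e2 : (G x₁ * k⁻¹) * (ρ c * ρ d) * (G x₁ * k⁻¹)⁻¹ =
      (G x₁ * k⁻¹) * (ρ d * ρ c) * (G x₁ * k⁻¹)⁻¹ := by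
    calc _ = (G ↑x₁ * (k⁻¹ * (ρ c)⁻¹ * k) * (G ↑x₁)⁻¹)⁻¹ *
          (G ↑x₁ * (k⁻¹ * (ρ d)⁻¹ * k) * (G ↑x₁)⁻¹)⁻¹ := by group
      _ = _ := by rw [e]; group
  exact mul_left_cancel (mul_right_cancel e2)

end Flat

end Holonomy

namespace ProjPlane

open Topology unitInterval Set

/-- The projection of the punctured vector space onto the projective plane. -/
def proj : {v : Fin 3 → ℂ // v ≠ 0} → P2 := fun v => Projectivization.mk ℂ v.1 v.2

lemma isQuotientMap_proj : IsQuotientMap proj :=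
  isQuotientMap_quotient_mk' (s := projectivizationSetoid ℂ (Fin 3 → ℂ))

lemma continuous_proj : Continuous proj := isQuotientMap_proj.continuous

instance : LocallyPathConnectedSpace {v : Fin 3 → ℂ // v ≠ 0} :=
  (isOpen_compl_singleton (x := (0 : Fin 3 → ℂ))).locallyPathConnectedSpace

instance : LocallyPathConnectedSpace P2 := isQuotientMap_proj.locallyPathConnectedSpace

lemma apply_rep_mk {α : Type*} {g : (Fin 3 → ℂ) → α}
    (hg : ∀ (c : ℂ) v, c ≠ 0 → g (c • v) = g v) (v : Fin 3 → ℂ) (hv : v ≠ 0) :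
    g (Projectivization.mk ℂ v hv).rep = g v := by
  obtain ⟨a, ha⟩ := Projectivization.exists_smul_eq_mk_rep ℂ v hv
  rw [← ha]
  exact hg a v a.ne_zero

/-- A scale invariant function which is continuous on vectors descends continuously. -/
lemma continuousOn_rep {α : Type*} [TopologicalSpace α] {g : (Fin 3 → ℂ) → α}
    (hg : ∀ (c : ℂ) v, c ≠ 0 → g (c • v) = g v) {U : Set P2} (hU : IsOpen U)
    (hc : ∀ v (hv : v ≠ 0), Projectivization.mk ℂ v hv ∈ U → ContinuousAt g v) :
    ContinuousOn (fun P : P2 => g P.rep) U := by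
  rw [isQuotientMap_proj.continuousOn_isOpen_iff hU]
  intro v hv
  have h1 : ContinuousAt (fun w : {v : Fin 3 → ℂ // v ≠ 0} => g w) v :=
    ContinuousAt.comp (f := Subtype.val) (hc v v.2 hv) continuous_subtype_val.continuousAt
  refine (h1.congr (Filter.Eventually.of_forall fun w => ?_)).continuousWithinAt
  exact (apply_rep_mk hg w w.2).symm

lemma isOpen_rep {p : (Fin 3 → ℂ) → Prop} (hp : ∀ (c : ℂ) v, c ≠ 0 → (p (c • v) ↔ p v))
    (ho : IsOpen {v | p v}) : IsOpen {P : P2 | p P.rep} := by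
  rw [← isQuotientMap_proj.isOpen_preimage]
  have : proj ⁻¹' {P : P2 | p P.rep} = Subtype.val ⁻¹' {v | p v} := by
    ext v
    exact iff_of_eq (apply_rep_mk (g := p) (fun c v hc => propext (hp c v hc)) v v.2)
  rw [this]
  exact ho.preimage continuous_subtype_val

section Complement

variable {F : MvPolynomial (Fin 3) ℂ}

open MvPolynomial in
lemma isPathConnected_compl_VV (h0 : eval 0 F = 0)
    (hF : ∀ v (hv : v ≠ 0), Projectivization.mk ℂ v hv ∈ VV F ↔ eval v F = 0)
    (hne : ((VV F)ᶜ).Nonempty) : IsPathConnected (VV F)ᶜ := by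
  refine isPathConnected_iff.2 ⟨hne, fun P hP Q hQ => ?_⟩
  induction P using Projectivization.ind with | h v hv =>
  induction Q using Projectivization.ind with | h w hw =>
  have hv' : eval v F ≠ 0 := fun h => hP ((hF v hv).2 h)
  have hw' : eval w F ≠ 0 := fun h => hQ ((hF w hw).2 h)
  let q : Polynomial ℂ := MvPolynomial.aeval
    (fun i => Polynomial.C (v i) + Polynomial.X * Polynomial.C (w i - v i)) F
  have hq : ∀ s : ℂ, q.eval s = eval (fun i => v i + s * (w i - v i)) F := by
    intro s
    have := MvPolynomial.map_aeval
      (fun i => Polynomial.C (v i) + Polynomial.X * Polynomial.C (w i - v i))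
      (Polynomial.evalRingHom s) F
    change (Polynomial.evalRingHom s) q = _
    rw [this, show (Polynomial.evalRingHom s).comp (algebraMap ℂ (Polynomial ℂ)) = RingHom.id ℂ by
      ext; simp]
    simp only [Polynomial.coe_evalRingHom, Polynomial.eval_add, Polynomial.eval_mul,
      Polynomial.eval_C, Polynomial.eval_X]
    rfl
  have hq0 : q ≠ 0 := by
    intro h
    have := hq 0
    rw [h] at this
    simp at this
    exact hv' this.symm
  have hfin : ({s : ℂ | q.eval s = 0} : Set ℂ).Countable := by
    refine Set.Finite.countable ((q.roots.toFinset.finite_toSet).subset fun s hs => ?_)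
    simpa [hq0] using hs
  have hpc := hfin.isPathConnected_compl_of_one_lt_rank (by
    rw [Complex.rank_real_complex]; norm_num)
  have e0 : (0 : ℂ) ∈ {s : ℂ | q.eval s = 0}ᶜ := by
    rw [mem_compl_iff, mem_ofPred_eq, hq]; simpa using hv'
  have e1 : (1 : ℂ) ∈ {s : ℂ | q.eval s = 0}ᶜ := by
    rw [mem_compl_iff, mem_ofPred_eq, hq]; simpa using hw'
  obtain ⟨p, hp⟩ := hpc.joinedIn 0 e0 1 e1
  let u : I → Fin 3 → ℂ := fun t i => v i + p t * (w i - v i)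
  have hu : ∀ t, eval (u t) F ≠ 0 := fun t => by
    have := hp t
    rw [mem_compl_iff, mem_ofPred_eq, hq] at this
    exact this
  have hu0 : ∀ t, u t ≠ 0 := fun t h => hu t (by rw [h, h0])
  refine ⟨⟨⟨fun t => proj ⟨u t, hu0 t⟩, ?_⟩, ?_, ?_⟩, fun t h => hu t ((hF _ (hu0 t)).1 h)⟩
  · exact continuous_proj.comp (by fun_prop)
  · simp [u, proj]
  · simp [u, proj]

end Complement

end ProjPlane

namespace ProjPlane

open Topology unitInterval Set

lemma isOpenMap_proj : IsOpenMap proj := by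
  intro U hU
  rw [← isQuotientMap_proj.isOpen_preimage]
  have : proj ⁻¹' (proj '' U) = ⋃ c : ℂˣ,
      {v | (⟨c • v.1, (smul_ne_zero_iff_ne c).2 v.2⟩ : {v : Fin 3 → ℂ // v ≠ 0}) ∈ U} := by
    ext v
    simp only [mem_preimage, mem_image, mem_iUnion, mem_ofPred_eq]
    constructor
    · rintro ⟨w, hw, h⟩
      obtain ⟨c, hc⟩ := (Projectivization.mk_eq_mk_iff ℂ _ _ w.2 v.2).1 h
      exact ⟨c, by convert hw⟩
    · rintro ⟨c, hc⟩
      exact ⟨_, hc, (Projectivization.mk_eq_mk_iff ℂ _ _ _ v.2).2 ⟨c, rfl⟩⟩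
  rw [this]
  refine isOpen_iUnion fun c => hU.preimage ?_
  exact Continuous.subtype_mk (continuous_subtype_val.const_smul c) _

open MvPolynomial in
lemma mk_mem_VV_iff {F : MvPolynomial (Fin 3) ℂ} {n : ℕ}
    (hF : ∀ (c : ℂ) v, eval (c • v) F = c ^ n * eval v F) (v : Fin 3 → ℂ) (hv : v ≠ 0) :
    Projectivization.mk ℂ v hv ∈ VV F ↔ eval v F = 0 := by
  refine ⟨fun h => h v hv rfl, fun h w hw e => ?_⟩
  obtain ⟨c, rfl⟩ := (Projectivization.mk_eq_mk_iff ℂ _ _ hw hv).1 e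
  rw [Units.smul_def, hF, h, mul_zero]

end ProjPlane

namespace SecondSextic

open ProjPlane Topology unitInterval Set

/-- The values of the conic, as a function on vectors. -/
def conic (v : Fin 3 → ℂ) : ℂ := 3 * v 0 ^ 2 + 2 * v 0 * v 1 + 108 * v 2 ^ 2

lemma conic_smul (c : ℂ) (v : Fin 3 → ℂ) : conic (c • v) = c ^ 2 * conic v := by
  simp only [conic, Pi.smul_apply, smul_eq_mul]; ring

lemma continuous_conic : Continuous conic := by unfold conic; fun_prop

lemma eval_mul (v : Fin 3 → ℂ) : MvPolynomial.eval v (F₂ * Q₂) =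
    conic v * (v 1 ^ 2 * conic v - v 0 ^ 4) := by
  simp only [F₂, Q₂, conic, map_mul, map_add, map_sub, map_pow, MvPolynomial.eval_X, map_ofNat]
  ring

lemma eval_smul (c : ℂ) (v : Fin 3 → ℂ) : MvPolynomial.eval (c • v) (F₂ * Q₂) =
    c ^ 6 * MvPolynomial.eval v (F₂ * Q₂) := by
  simp only [eval_mul, conic_smul, Pi.smul_apply, smul_eq_mul]; ring

/-- The complement of the second sextic. -/
abbrev Compl : Set P2 := (VV (F₂ * Q₂))ᶜ

lemma mk_mem {v : Fin 3 → ℂ} (hv : v ≠ 0) :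
    Projectivization.mk ℂ v hv ∈ Compl ↔ conic v ≠ 0 ∧ v 1 ^ 2 * conic v ≠ v 0 ^ 4 := by
  rw [mem_compl_iff, mk_mem_VV_iff eval_smul, eval_mul, mul_eq_zero, sub_eq_zero, not_or]

/-- The total space of the dihedral covering. -/
abbrev Cover : Set ((Fin 3 → ℂ) × ℂ) :=
  {e | conic e.1 = 1 ∧ e.1 1 ^ 2 ≠ e.1 0 ^ 4 ∧
    e.2 ^ 3 * (e.1 1 + e.1 0 ^ 2) = e.1 1 - e.1 0 ^ 2}

lemma ne_zero (e : Cover) : e.1.1 ≠ 0 := by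
  intro h
  have := e.2.1
  rw [h] at this
  simp [conic] at this

lemma add_ne_zero (e : Cover) : e.1.1 1 + e.1.1 0 ^ 2 ≠ 0 := by
  intro h
  exact e.2.2.1 (by linear_combination (e.1.1 1 - e.1.1 0 ^ 2) * h)

lemma sub_ne_zero' (e : Cover) : e.1.1 1 - e.1.1 0 ^ 2 ≠ 0 := by
  intro h
  exact e.2.2.1 (by linear_combination (e.1.1 1 + e.1.1 0 ^ 2) * h)

lemma snd_ne_zero (e : Cover) : e.1.2 ≠ 0 := by
  intro h
  have := e.2.2.2
  rw [h] at this
  exact sub_ne_zero' e (by rw [← this]; ring)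

local notation "χ" => (ZMod.stdAddChar (N := 3))

lemma char_pow (i : ZMod 3) : χ i ^ 3 = 1 := by
  rw [← AddChar.map_nsmul_eq_pow]
  have : 3 • i = 0 := by revert i; decide
  rw [this, AddChar.map_zero_eq_one]

lemma char_ne_zero (i : ZMod 3) : χ i ≠ 0 := by
  intro h
  have := char_pow i
  rw [h] at this
  norm_num at this

lemma exists_char {u : ℂ} (hu : u ^ 3 = 1) : ∃ i, χ i = u := by
  by_contra! h
  have h0 := h 0
  have h1 := h 1
  have h2 := h 2
  rw [AddChar.map_zero_eq_one] at h0
  have e2 : χ 2 = χ 1 ^ 2 := by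
    rw [← AddChar.map_nsmul_eq_pow]; rfl
  have hne : χ 1 ≠ 1 := by
    rw [← AddChar.map_zero_eq_one (ψ := χ)]
    exact fun h => absurd (ZMod.injective_stdAddChar h) (by decide)
  have e3 : χ 1 ^ 2 + χ 1 + 1 = 0 := by
    have : (χ 1 - 1) * (χ 1 ^ 2 + χ 1 + 1) = 0 := by linear_combination char_pow 1
    exact (mul_eq_zero.1 this).resolve_left (sub_ne_zero.2 hne)
  rw [e2] at h2
  have : (1 - u) * ((χ 1 - u) * (χ 1 ^ 2 - u)) = 0 := by
    linear_combination (1 - u) * char_pow 1 - hu + (u ^ 2 - u) * e3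
  rcases mul_eq_zero.1 this with h | h
  · exact h0 (sub_eq_zero.1 h)
  rcases mul_eq_zero.1 h with h | h
  · exact h1 (sub_eq_zero.1 h)
  · exact h2 (sub_eq_zero.1 h)

/-- The action of the dihedral group on the covering. -/
def act : DihedralGroup 3 → Cover → Cover
  | .r i, e => ⟨(e.1.1, χ i * e.1.2), e.2.1, e.2.2.1, by
      rw [← e.2.2.2]
      show (χ i * e.1.2) ^ 3 * _ = _
      rw [mul_pow, char_pow, one_mul]⟩
  | .sr i, e => ⟨(-e.1.1, (χ i * e.1.2)⁻¹), by
      have := e.2.1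
      simp only [conic, Pi.neg_apply] at this ⊢
      rw [← this]; ring, by
      have := e.2.2.1
      simp only [Pi.neg_apply]
      intro h; apply this
      linear_combination h, by
      have := e.2.2.2
      have h2 := snd_ne_zero e
      show (χ i * e.1.2)⁻¹ ^ 3 * (-e.1.1 1 + (-e.1.1 0) ^ 2) = -e.1.1 1 - (-e.1.1 0) ^ 2
      rw [inv_pow, mul_pow, char_pow, one_mul]
      field_simp
      linear_combination this⟩

instance : MulAction (DihedralGroup 3) Cover where
  smul := act
  one_smul e := by
    change act 1 e = e
    rw [← DihedralGroup.r_zero]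
    refine Subtype.ext (Prod.ext rfl ?_)
    show χ 0 * e.1.2 = e.1.2
    rw [AddChar.map_zero_eq_one, one_mul]
  mul_smul g h e := by
    change act (g * h) e = act g (act h e)
    have h2 := snd_ne_zero e
    have hc := char_ne_zero
    rcases g with i | i <;> rcases h with j | j <;> refine Subtype.ext (Prod.ext ?_ ?_)
    · rfl
    · show χ (i + j) * e.1.2 = χ i * (χ j * e.1.2)
      rw [AddChar.map_add_eq_mul, mul_assoc]
    · rfl
    · show (χ (j - i) * e.1.2)⁻¹ = χ i * (χ j * e.1.2)⁻¹
      have := AddChar.map_add_eq_mul χ i (j - i)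
      rw [add_sub_cancel] at this
      rw [this]
      have := hc i
      have := hc (j - i)
      field_simp
    · rfl
    · show (χ (i + j) * e.1.2)⁻¹ = (χ i * (χ j * e.1.2))⁻¹
      rw [AddChar.map_add_eq_mul, mul_assoc]
    · show e.1.1 = - -e.1.1
      rw [neg_neg]
    · show χ (j - i) * e.1.2 = (χ i * (χ j * e.1.2)⁻¹)⁻¹
      have := AddChar.map_add_eq_mul χ i (j - i)
      rw [add_sub_cancel] at this
      rw [this]
      have := hc i
      have := hc (j - i)
      field_simp

lemma r_smul (i : ZMod 3) (e : Cover) : (DihedralGroup.r i • e).1 = (e.1.1, χ i * e.1.2) := rfl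

lemma sr_smul (i : ZMod 3) (e : Cover) :
    (DihedralGroup.sr i • e).1 = (-e.1.1, (χ i * e.1.2)⁻¹) := rfl

/-- The dihedral covering of the complement. -/
def cov (e : Cover) : Compl :=
  ⟨Projectivization.mk ℂ e.1.1 (ne_zero e), (mk_mem _).2 (by
    rw [e.2.1, mul_one]; exact ⟨one_ne_zero, e.2.2.1⟩)⟩

lemma continuous_cov : Continuous cov := by
  refine Continuous.subtype_mk ?_ _
  exact continuous_proj.comp (Continuous.subtype_mk (f := fun e : Cover => e.1.1)
    (by fun_prop) ne_zero)

lemma cov_eq_iff (e e' : Cover) : cov e = cov e' ↔ e ∈ MulAction.orbit (DihedralGroup 3) e' := by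
  rw [MulAction.mem_orbit_iff]
  constructor
  · intro h
    obtain ⟨c, hc⟩ := (Projectivization.mk_eq_mk_iff' ℂ _ _ (ne_zero e) (ne_zero e')).1
      (Subtype.ext_iff.1 h)
    have h1 := e.2.1
    rw [← hc, conic_smul, e'.2.1, mul_one] at h1
    have h2 := e.2.2.2
    have h3 := e'.2.2.2
    have h4 := snd_ne_zero e'
    rw [← hc] at h2
    simp only [Pi.smul_apply, smul_eq_mul] at h2
    have hx := add_ne_zero e'
    rcases sq_eq_one_iff.1 h1 with rfl | rfl
    · obtain ⟨i, hi⟩ := exists_char (u := e.1.2 / e'.1.2) (by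
        field_simp
        apply mul_right_cancel₀ hx
        linear_combination h2 - h3)
      refine ⟨.r i, Subtype.ext (Prod.ext ?_ ?_)⟩
      · rw [r_smul, ← hc, one_smul]
      · rw [r_smul, hi]
        field_simp
    · have h5 := snd_ne_zero e
      obtain ⟨i, hi⟩ := exists_char (u := (e.1.2 * e'.1.2)⁻¹) (by
        rw [inv_pow, inv_eq_one]
        apply mul_right_cancel₀ hx
        linear_combination e.1.2 ^ 3 * h3 - h2)
      refine ⟨.sr i, Subtype.ext (Prod.ext ?_ ?_)⟩
      · rw [sr_smul, ← hc, neg_one_smul]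
      · rw [sr_smul, hi]
        field_simp
  · rintro ⟨g, rfl⟩
    rcases g with i | i
    · rfl
    · refine Subtype.ext ((Projectivization.mk_eq_mk_iff' ℂ _ _ _ _).2 ⟨-1, ?_⟩)
      rw [sr_smul]; simp

lemma eq_one_of_smul_eq (g : DihedralGroup 3) (e : Cover) (h : g • e = e) : g = 1 := by
  have h' := Subtype.ext_iff.1 h
  rcases g with i | i
  · rw [r_smul] at h'
    have h2 : χ i * e.1.2 = e.1.2 := congrArg Prod.snd h'
    have h3 : χ i = 1 := by
      have := snd_ne_zero e
      field_simp at h2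
      exact h2
    rw [← AddChar.map_zero_eq_one (ψ := χ)] at h3
    rw [ZMod.injective_stdAddChar h3, DihedralGroup.r_zero]
  · rw [sr_smul] at h'
    have h2 : -e.1.1 = e.1.1 := congrArg Prod.fst h'
    exact absurd (self_eq_neg.1 h2.symm) (ne_zero e)

end SecondSextic

namespace SecondSextic

open ProjPlane Topology unitInterval Set

instance : ContinuousConstSMul (DihedralGroup 3) Cover where
  continuous_const_smul g := by
    rcases g with i | i
    · exact Continuous.subtype_mk (f := fun e : Cover => (e.1.1, ZMod.stdAddChar i * e.1.2))
        (by fun_prop) fun e => (DihedralGroup.r i • e).2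
    · refine Continuous.subtype_mk (f := fun e : Cover => (-e.1.1, (ZMod.stdAddChar i * e.1.2)⁻¹))
        ?_ fun e => (DihedralGroup.sr i • e).2
      refine Continuous.prodMk (by fun_prop) (Continuous.inv₀ (by fun_prop) fun e => ?_)
      exact mul_ne_zero (char_ne_zero i) (snd_ne_zero e)

lemma surjective_cov : Function.Surjective cov := by
  rintro ⟨P, hP⟩
  induction P using Projectivization.ind with | h v hv =>
  obtain ⟨h1, h2⟩ := (mk_mem hv).1 hP
  obtain ⟨s, hs⟩ := IsAlgClosed.exists_pow_nat_eq (conic v) (n := 2) (by norm_num)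
  have hs0 : s ≠ 0 := by rintro rfl; apply h1; rw [← hs]; ring
  have hw : s⁻¹ • v ≠ 0 := smul_ne_zero (inv_ne_zero hs0) hv
  have e1 : conic (s⁻¹ • v) = 1 := by rw [conic_smul, ← hs]; field_simp
  have e2 : (s⁻¹ • v) 1 ^ 2 ≠ (s⁻¹ • v) 0 ^ 4 := by
    intro h
    apply h2
    simp only [Pi.smul_apply, smul_eq_mul] at h
    field_simp at h
    rw [← hs]; linear_combination h
  obtain ⟨k, hk⟩ := IsAlgClosed.exists_pow_nat_eq
    (((s⁻¹ • v) 1 - (s⁻¹ • v) 0 ^ 2) / ((s⁻¹ • v) 1 + (s⁻¹ • v) 0 ^ 2)) (n := 3) (by norm_num)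
  refine ⟨⟨(s⁻¹ • v, k), e1, e2, ?_⟩, ?_⟩
  · have : (s⁻¹ • v) 1 + (s⁻¹ • v) 0 ^ 2 ≠ 0 := fun h => e2 (by
      linear_combination ((s⁻¹ • v) 1 - (s⁻¹ • v) 0 ^ 2) * h)
    show k ^ 3 * _ = _
    rw [hk, div_mul_cancel₀ _ this]
  · exact Subtype.ext ((Projectivization.mk_eq_mk_iff' ℂ _ _ _ _).2 ⟨s⁻¹, rfl⟩)

/-- A local lift of the projection near a point of the covering. -/
def localLift (e : Cover) (w : Fin 3 → ℂ) : (Fin 3 → ℂ) × ℂ :=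
  let v := (conic w ^ (1 / 2 : ℂ))⁻¹ • w
  (v, e.1.2 * ((v 1 - v 0 ^ 2) / (v 1 + v 0 ^ 2) / e.1.2 ^ 3) ^ (1 / 3 : ℂ))

lemma cube_eq (e : Cover) : (e.1.1 1 - e.1.1 0 ^ 2) / (e.1.1 1 + e.1.1 0 ^ 2) = e.1.2 ^ 3 :=
  (eq_div_of_mul_eq (add_ne_zero e) e.2.2.2).symm

lemma localLift_self (e : Cover) : localLift e e.1.1 = e.1 := by
  have h : (conic e.1.1 ^ (1 / 2 : ℂ))⁻¹ • e.1.1 = e.1.1 := by simp [e.2.1]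
  refine Prod.ext h ?_
  unfold localLift
  simp only [h]
  rw [cube_eq, div_self (pow_ne_zero 3 (snd_ne_zero e))]
  simp

lemma continuousAt_localLift (e : Cover) : ContinuousAt (localLift e) e.1.1 := by
  have h1 : ContinuousAt (fun w : Fin 3 → ℂ => (conic w ^ (1 / 2 : ℂ))⁻¹ • w) e.1.1 := by
    refine ContinuousAt.smul (f := fun w : Fin 3 → ℂ => (conic w ^ (1 / 2 : ℂ))⁻¹)
      (g := fun w => w) (ContinuousAt.inv₀ ?_ ?_) continuousAt_id
    · refine ContinuousAt.cpow continuous_conic.continuousAt continuousAt_const ?_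
      · rw [e.2.1]; simp
    · rw [e.2.1]; simp
  have h : (conic e.1.1 ^ (1 / 2 : ℂ))⁻¹ • e.1.1 = e.1.1 := by simp [e.2.1]
  have h2 (i : Fin 3) : ContinuousAt (fun w => ((conic w ^ (1 / 2 : ℂ))⁻¹ • w) i) e.1.1 :=
    ContinuousAt.comp (f := fun w : Fin 3 → ℂ => (conic w ^ (1 / 2 : ℂ))⁻¹ • w)
      (g := fun w : Fin 3 → ℂ => w i) (continuous_apply i).continuousAt h1
  refine ContinuousAt.prodMk h1 (ContinuousAt.mul continuousAt_const
    (ContinuousAt.cpow ?_ continuousAt_const ?_))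
  · refine ContinuousAt.div_const (ContinuousAt.div ((h2 1).sub ((h2 0).pow 2))
      ((h2 1).add ((h2 0).pow 2)) ?_) _
    change ((conic e.1.1 ^ (1 / 2 : ℂ))⁻¹ • e.1.1) 1 +
      ((conic e.1.1 ^ (1 / 2 : ℂ))⁻¹ • e.1.1) 0 ^ 2 ≠ 0
    rw [h]
    exact add_ne_zero e
  · rw [h, cube_eq, div_self (pow_ne_zero 3 (snd_ne_zero e))]
    simp

lemma localLift_mem (e : Cover) {w : Fin 3 → ℂ} (h1 : conic w ≠ 0)
    (h2 : w 1 ^ 2 * conic w ≠ w 0 ^ 4) : localLift e w ∈ Cover := by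
  have hs : (conic w ^ (1 / 2 : ℂ)) ^ 2 = conic w := by
    simp
  set s := conic w ^ (1 / 2 : ℂ) with hsd
  have hs0 : s ≠ 0 := by intro h; apply h1; rw [← hs, h]; ring
  have e1 : conic (s⁻¹ • w) = 1 := by rw [conic_smul, ← hs]; field_simp
  have e2 : (s⁻¹ • w) 1 ^ 2 ≠ (s⁻¹ • w) 0 ^ 4 := by
    intro h
    apply h2
    simp only [Pi.smul_apply, smul_eq_mul] at h
    field_simp at h
    rw [← hs]; linear_combination h
  have h3 : (s⁻¹ • w) 1 + (s⁻¹ • w) 0 ^ 2 ≠ 0 := fun h => e2 (by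
      linear_combination ((s⁻¹ • w) 1 - (s⁻¹ • w) 0 ^ 2) * h)
  refine ⟨e1, e2, ?_⟩
  simp only [localLift, ← hsd]
  rw [mul_pow]
  have := Complex.cpow_nat_inv_pow (((s⁻¹ • w) 1 - (s⁻¹ • w) 0 ^ 2) /
    ((s⁻¹ • w) 1 + (s⁻¹ • w) 0 ^ 2) / e.1.2 ^ 3) (n := 3) (by norm_num)
  rw [one_div, show ((3 : ℂ)⁻¹) = ((3 : ℕ) : ℂ)⁻¹ by norm_num, this]
  generalize (s⁻¹ • w) 1 + (s⁻¹ • w) 0 ^ 2 = p at *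
  have := snd_ne_zero e
  field_simp

lemma isOpenMap_cov : IsOpenMap cov := by
  rw [isOpenMap_iff_nhds_le]
  intro e N hN
  rw [Filter.mem_map] at hN
  obtain ⟨U, hU, hUN⟩ := mem_nhds_subtype _ _ _ |>.1 hN
  have h1 : ∀ᶠ w in 𝓝 e.1.1, localLift e w ∈ U ∧ conic w ≠ 0 ∧ w 1 ^ 2 * conic w ≠ w 0 ^ 4 := by
    refine ((continuousAt_localLift e).eventually (by rw [localLift_self]; exact hU)).and
      (Filter.Eventually.and ?_ ?_)
    · exact continuous_conic.continuousAt.eventually_ne (by rw [e.2.1]; exact one_ne_zero)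
    · have : Continuous fun w : Fin 3 → ℂ => w 1 ^ 2 * conic w - w 0 ^ 4 := by
        have := continuous_conic
        fun_prop
      refine (this.continuousAt.eventually_ne (x := e.1.1) (y := 0) ?_).mono
        fun w hw h => hw (sub_eq_zero.2 h)
      simpa only [e.2.1, mul_one] using sub_ne_zero.2 e.2.2.1
  have h2 : ∀ᶠ w : {v : Fin 3 → ℂ // v ≠ 0} in 𝓝 ⟨e.1.1, ne_zero e⟩, localLift e w ∈ U ∧
      conic w ≠ 0 ∧ w.1 1 ^ 2 * conic w ≠ w.1 0 ^ 4 :=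
    (continuous_subtype_val (p := fun v : Fin 3 → ℂ => v ≠ 0)).continuousAt
      (x := ⟨e.1.1, ne_zero e⟩) |>.eventually h1
  have h3 := isOpenMap_proj.image_mem_nhds h2
  refine mem_nhds_subtype _ _ _ |>.2 ⟨_, h3, ?_⟩
  rintro ⟨P, hP⟩ ⟨w, hw, h⟩
  have hm := localLift_mem e hw.2.1 hw.2.2
  have : cov ⟨_, hm⟩ = ⟨P, hP⟩ := Subtype.ext
    (((Projectivization.mk_eq_mk_iff' ℂ _ _ _ _).2 ⟨_, rfl⟩).trans h)
  rw [← this]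
  exact hUN hw.1

lemma isQuotientCoveringMap_cov : IsQuotientCoveringMap cov (DihedralGroup 3) where
  toIsQuotientMap := isOpenMap_cov.isQuotientMap continuous_cov surjective_cov
  toContinuousConstSMul := inferInstance
  apply_eq_iff_mem_orbit := cov_eq_iff _ _
  disjoint e := by
    have h (g : DihedralGroup 3) : ∃ U ∈ 𝓝 e, (((g • ·) '' U) ∩ U).Nonempty → g = 1 := by
      by_cases hg : g = 1
      · exact ⟨univ, Filter.univ_mem, fun _ => hg⟩
      obtain ⟨V, W, hV, hW, h1, h2, h3⟩ := t2_separation fun h => hg (eq_one_of_smul_eq g e h)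
      refine ⟨(g • ·) ⁻¹' V ∩ W, Filter.inter_mem ((continuous_const_smul g).continuousAt
        (hV.mem_nhds h1)) (hW.mem_nhds h2), ?_⟩
      rintro ⟨_, ⟨y, hy, rfl⟩, hy'⟩
      exact absurd hy'.2 (disjoint_left.1 h3 hy.1)
    choose U hU hU' using h
    refine ⟨⋂ g, U g, Filter.iInter_mem.2 hU, fun g hg => hU' g (hg.mono ?_)⟩
    exact inter_subset_inter (image_mono (iInter_subset _ _)) (iInter_subset _ _)

end SecondSextic

namespace SecondSextic

open ProjPlane Topology unitInterval Set

lemma mem_cover {x y z k : ℂ} (h1 : 3 * x ^ 2 + 2 * x * y + 108 * z ^ 2 = 1)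
    (h2 : y ^ 2 ≠ x ^ 4) (h3 : k ^ 3 * (y + x ^ 2) = y - x ^ 2) :
    ((![x, y, z] : Fin 3 → ℂ), k) ∈ Cover := ⟨by simpa [conic] using h1, by simpa using h2,
      by simpa using h3⟩

lemma joined_of_continuous {x y z k : ℝ → ℂ} (hx : Continuous x) (hy : Continuous y)
    (hz : Continuous z) (hk : Continuous k)
    (h : ∀ t, ((![x t, y t, z t] : Fin 3 → ℂ), k t) ∈ Cover) {e e' : Cover}
    (he : e.1 = (![x 0, y 0, z 0], k 0)) (he' : e'.1 = (![x 1, y 1, z 1], k 1)) :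
    Joined e e' := by
  refine ⟨⟨⟨fun t => ⟨_, h t⟩, ?_⟩, ?_, ?_⟩⟩
  · refine Continuous.subtype_mk (Continuous.prodMk (continuous_pi fun i => ?_)
      (hk.comp continuous_subtype_val)) _
    fin_cases i
    · exact hx.comp continuous_subtype_val
    · exact hy.comp continuous_subtype_val
    · exact hz.comp continuous_subtype_val
  · exact Subtype.ext he.symm
  · exact Subtype.ext he'.symm

lemma norm_exp_I (r : ℝ) : ‖Complex.exp (r * Complex.I)‖ = 1 := Complex.norm_exp_ofReal_mul_I r

lemma joined_sr {a : ℂ} (ha : 3 * a ^ 2 = 1) {e : Cover} (he : e.1 = (![a, 0, 0], -1)) :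
    Joined e ((DihedralGroup.sr 0 : DihedralGroup 3) • e) := by
  have ha0 : a ≠ 0 := by rintro rfl; norm_num at ha
  obtain ⟨c, hc⟩ := IsAlgClosed.exists_pow_nat_eq (1 / 108 : ℂ) (n := 2) (by norm_num)
  let q : ℝ → ℂ := fun t => Complex.exp ((Real.pi * t : ℝ) * Complex.I)
  have hq : Continuous q := by unfold q; fun_prop
  have hqn t : ‖q t‖ = 1 := norm_exp_I _
  have hq0 t : q t ≠ 0 := Complex.exp_ne_zero _
  have hre t : 0 ≤ (1 - q t ^ 2).re := by
    have := (Complex.re_le_norm (q t ^ 2))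
    rw [norm_pow, hqn] at this
    simpa using this
  refine joined_of_continuous (x := fun t => a * q t) (y := fun _ => 0)
    (z := fun t => c * (1 - q t ^ 2) ^ (1 / 2 : ℂ)) (k := fun _ => -1) (by fun_prop) (by fun_prop)
    ?_ (by fun_prop) ?_ ?_ ?_
  · refine continuous_const.mul (continuous_iff_continuousAt.2 fun t => ?_)
    exact ContinuousAt.comp (f := fun t => 1 - q t ^ 2) (g := fun z : ℂ => z ^ (1 / 2 : ℂ))
      (Complex.continuousAt_cpow_const_of_re_pos (Or.inl (hre t)) (by norm_num))
      (by fun_prop)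
  · intro t
    refine mem_cover ?_ ?_ (by ring)
    · have : ((1 - q t ^ 2) ^ (1 / 2 : ℂ)) ^ 2 = 1 - q t ^ 2 := by simp
      rw [mul_pow c, this, hc, mul_pow]
      linear_combination q t ^ 2 * ha
    · have := pow_ne_zero 4 (mul_ne_zero ha0 (hq0 t))
      intro h; apply this; rw [← h]; ring
  · rw [he]
    simp [q]
  · rw [sr_smul, he]
    simp [q]

lemma joined_r {a : ℂ} (ha : 3 * a ^ 2 = 1) {e : Cover} (he : e.1 = (![a, 0, 0], -1)) :
    Joined e ((DihedralGroup.r (-1) : DihedralGroup 3) • e) := by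
  have ha0 : a ≠ 0 := by rintro rfl; norm_num at ha
  obtain ⟨b, hb⟩ := IsAlgClosed.exists_pow_nat_eq (a ^ 3 / 54 : ℂ) (n := 2) (by norm_num)
  let q : ℝ → ℂ := fun t => Complex.exp ((2 * Real.pi * t : ℝ) * Complex.I)
  let p : ℝ → ℂ := fun t => Complex.exp (-((2 * Real.pi * t / 3 : ℝ) * Complex.I))
  have hp : Continuous p := by unfold p; fun_prop
  have hpq t : p t ^ 3 * q t = 1 := by
    simp only [p, q]
    rw [← Complex.exp_nat_mul, ← Complex.exp_add, ← Complex.exp_zero]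
    congr 1
    push_cast
    ring
  have hq : Continuous q := by unfold q; fun_prop
  have hqn t : ‖q t‖ = 1 := norm_exp_I _
  have hq0 t : q t ≠ 0 := Complex.exp_ne_zero _
  have key (w : ℂ) (hw : 1 < ‖w‖) (t) : 1 - q t / w ∈ Complex.slitPlane := by
    have h1 : ‖q t / w‖ < 1 := by
      rw [norm_div, hqn]
      exact (div_lt_one (by linarith)).2 hw
    have := (Complex.re_le_norm (q t / w)).trans_lt h1
    left
    simp only [Complex.sub_re, Complex.one_re]; linarith
  have hi1 : 1 < ‖1 + Complex.I‖ := by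
    rw [Complex.norm_def, Complex.normSq_apply]
    norm_num [Real.lt_sqrt]
  have hi2 : 1 < ‖1 - Complex.I‖ := by
    rw [Complex.norm_def, Complex.normSq_apply]
    norm_num [Real.lt_sqrt]
  have hi3 : 1 < ‖(2 : ℂ)‖ := by simp
  have hcb (w : ℂ) (hw : 1 < ‖w‖) (t) : ((1 - q t / w) ^ (1 / 3 : ℂ)) ^ 3 = 1 - q t / w := by simp
  have hcont (w : ℂ) (hw : 1 < ‖w‖) : Continuous fun t => (1 - q t / w) ^ (1 / 3 : ℂ) := by
    refine continuous_iff_continuousAt.2 fun t => ?_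
    exact ContinuousAt.cpow (by fun_prop) continuousAt_const (key w hw t)
  have hn0 (w : ℂ) (hw : 1 < ‖w‖) (t) : (1 - q t / w) ^ (1 / 3 : ℂ) ≠ 0 := by
    have := Complex.slitPlane_ne_zero (key w hw t)
    intro h
    apply this
    rw [← hcb w hw t, h]; ring
  let c : ℝ → ℂ := fun t => (1 - q t / (1 + Complex.I)) ^ (1 / 3 : ℂ) *
    (1 - q t / (1 - Complex.I)) ^ (1 / 3 : ℂ) / (1 - q t / 2) ^ (1 / 3 : ℂ)
  have hc : Continuous c :=
    ((hcont _ hi1).mul (hcont _ hi2)).div (hcont _ hi3) (hn0 _ hi3)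
  have hc0 t : c t ≠ 0 := div_ne_zero (mul_ne_zero (hn0 _ hi1 t) (hn0 _ hi2 t)) (hn0 _ hi3 t)
  have hne1 : (1 + Complex.I) ≠ 0 := norm_pos_iff.1 (by linarith)
  have hne2 : (1 - Complex.I) ≠ 0 := norm_pos_iff.1 (by linarith)
  have hden t : 2 - q t ≠ 0 := fun h => Complex.slitPlane_ne_zero (key _ hi3 t) (by
    linear_combination h / 2)
  have h1 t : (1 + Complex.I - q t) ≠ 0 := fun h => Complex.slitPlane_ne_zero (key _ hi1 t) (by
    rw [← sub_eq_zero.1 h]; field_simp; ring)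
  have h2 t : (1 - Complex.I - q t) ≠ 0 := fun h => Complex.slitPlane_ne_zero (key _ hi2 t) (by
    rw [← sub_eq_zero.1 h]; field_simp; ring)
  have hI := Complex.I_sq
  have hc3 t : c t ^ 3 * (2 - q t) = 1 + (1 - q t) ^ 2 := by
    simp only [c]
    rw [div_pow, mul_pow, hcb _ hi1, hcb _ hi2, hcb _ hi3]
    have := hden t
    field_simp
    rw [show (1 + Complex.I) * (1 - Complex.I) = 2 by linear_combination -hI]
    linear_combination (-2 : ℂ) * hI
  have q0 : q 0 = 1 := by simp [q]
  have q1 : q 1 = 1 := by simp [q]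
  have c01 : c 1 = c 0 := by simp only [c, q0, q1]
  have c03 : c 0 ^ 3 = 1 := by have := hc3 0; rw [q0] at this; linear_combination this
  refine joined_of_continuous (x := fun _ => a) (y := fun t => -a ^ 2 * (1 - q t) ^ 2)
    (z := fun t => b * (1 - q t)) (k := fun t => -p t * (c t / c 0)) (by fun_prop) (by fun_prop)
    (by fun_prop) (by fun_prop) ?_ ?_ ?_
  · intro t
    refine mem_cover ?_ ?_ ?_
    · rw [mul_pow, hb]; linear_combination ha
    · intro h
      have h3 : a ^ 4 * (q t * (2 - q t)) *
          ((1 + Complex.I - q t) * (1 - Complex.I - q t)) = 0 := by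
        linear_combination -h - a ^ 4 * q t * (2 - q t) * hI
      exact mul_ne_zero (mul_ne_zero (pow_ne_zero 4 ha0) (mul_ne_zero (hq0 t) (hden t)))
        (mul_ne_zero (h1 t) (h2 t)) h3
    · rw [mul_pow, div_pow, c03, div_one, neg_pow]
      linear_combination (-a ^ 2 * c t ^ 3 * (2 - q t)) * hpq t - a ^ 2 * hc3 t
  · rw [he]
    simp [q0, p, hc0]
  · rw [r_smul, he]
    have : ZMod.stdAddChar (N := 3) (-1) = p 1 := by
      rw [show (-1 : ZMod 3) = ((-1 : ℤ) : ZMod 3) by norm_num, ZMod.stdAddChar_coe]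
      simp only [p]
      congr 1
      push_cast
      ring
    simp [q1, c01, this, hc0]

lemma exists_base : ∃ (a : ℂ) (e : Cover), 3 * a ^ 2 = 1 ∧ e.1 = (![a, 0, 0], -1) := by
  obtain ⟨a, ha⟩ := IsAlgClosed.exists_pow_nat_eq (1 / 3 : ℂ) (n := 2) (by norm_num)
  have h : 3 * a ^ 2 = 1 := by rw [ha]; norm_num
  refine ⟨a, ⟨_, mem_cover (x := a) (y := 0) (z := 0) (k := -1) (by linear_combination h) ?_
    (by ring)⟩, h, rfl⟩
  intro h'
  have : a = 0 := by simpa using h'.symm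
  rw [this] at h; norm_num at h

instance : PathConnectedSpace Compl := by
  obtain ⟨a, e, -⟩ := exists_base
  exact isPathConnected_iff_pathConnectedSpace.1 (isPathConnected_compl_VV
    (by rw [eval_mul]; simp [conic]) (mk_mem_VV_iff eval_smul) ⟨_, (cov e).2⟩)

instance : PathConnectedSpace Cover := by
  obtain ⟨a, e, ha, he⟩ := exists_base
  have hmul (g h : DihedralGroup 3) (hg : Joined e (g • e)) (hh : Joined e (h • e)) :
      Joined e ((g * h) • e) := by
    rw [mul_smul]
    exact hg.trans (hh.map (continuous_const_smul g))
  have hr := joined_r ha he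
  have hs := joined_sr ha he
  have h1 : Joined e ((1 : DihedralGroup 3) • e) := by rw [one_smul]
  have hrr := hmul _ _ hr hr
  have hall (g : DihedralGroup 3) : Joined e (g • e) := by
    have : g = 1 ∨ g = .r (-1) ∨ g = .r (-1) * .r (-1) ∨ g = .sr 0 ∨ g = .sr 0 * .r (-1) ∨
      g = .sr 0 * (.r (-1) * .r (-1)) := by revert g; decide
    rcases this with rfl | rfl | rfl | rfl | rfl | rfl
    exacts [h1, hr, hrr, hs, hmul _ _ hs hr, hmul _ _ hs hrr]
  have : Nonempty Cover := ⟨e⟩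
  have hj (f : Cover) : Joined f e := by
    obtain ⟨γ⟩ := PathConnectedSpace.joined (cov f) (cov e)
    let Γ := isQuotientCoveringMap_cov.isCoveringMap.liftPath γ f (by simp)
    have h0 : Γ 0 = f := isQuotientCoveringMap_cov.isCoveringMap.liftPath_zero ..
    have h1 : cov (Γ 1) = cov e := by
      have := isQuotientCoveringMap_cov.isCoveringMap.liftPath_lifts γ f (by simp)
      rw [show cov (Γ 1) = γ 1 from congrFun this 1, γ.target]
    obtain ⟨g, hg⟩ := (cov_eq_iff _ _).1 h1
    have h2 : Joined f (Γ 1) := ⟨⟨Γ, h0, rfl⟩⟩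
    rw [← hg] at h2
    exact h2.trans (hall g).symm
  exact ⟨inferInstance, fun x y => (hj x).trans (hj y).symm⟩

/-- The fundamental group of the complement surjects onto the dihedral group of order six. -/
lemma exists_surjective (x : Compl) :
    ∃ f : FundamentalGroup Compl x →* (DihedralGroup 3)ᵐᵒᵖ, Function.Surjective f := by
  obtain ⟨e, he⟩ := surjective_cov x
  exact ⟨_, isQuotientCoveringMap_cov.fundamentalGroupToMulOpposite_surjective ⟨e, he⟩⟩

end SecondSextic

namespace FirstSextic

open ProjPlane Topology unitInterval Set

/-- The linear forms giving adapted coordinates of the plane. -/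
def tau (v : Fin 3 → ℂ) : ℂ := v 1 - 2 * v 2

/-- See `tau`. -/
def sig (v : Fin 3 → ℂ) : ℂ := 2 * (v 1 + v 2)

/-- See `tau`. -/
def pii (v : Fin 3 → ℂ) : ℂ := 9 / 2 * v 0 - 13 / 4 * v 1 + v 2 / 2

/-- The values of the conic component. -/
def conic (v : Fin 3 → ℂ) : ℂ := sig v ^ 2 - 4 * pii v * tau v

/-- The vector with prescribed adapted coordinates. -/
def vec (p s t : ℂ) : Fin 3 → ℂ :=
  ![2 / 9 * (p + 13 / 4 * ((s + t) / 3) - ((s / 2 - t) / 3) / 2), (s + t) / 3, (s / 2 - t) / 3]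

@[simp] lemma tau_vec (p s t : ℂ) : tau (vec p s t) = t := by simp [tau, vec]; ring

@[simp] lemma sig_vec (p s t : ℂ) : sig (vec p s t) = s := by simp [sig, vec]; ring

@[simp] lemma pii_vec (p s t : ℂ) : pii (vec p s t) = p := by simp [pii, vec]; ring

lemma vec_eq (v : Fin 3 → ℂ) : vec (pii v) (sig v) (tau v) = v := by
  ext i; fin_cases i <;> simp [vec, pii, sig, tau] <;> ring

lemma smul_vec (c p s t : ℂ) : c • vec p s t = vec (c * p) (c * s) (c * t) := by
  ext i; fin_cases i <;> simp [vec] <;> ring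

lemma continuous_vec : Continuous fun q : ℂ × ℂ × ℂ => vec q.1 q.2.1 q.2.2 := by
  refine continuous_pi fun i => ?_
  fin_cases i <;> simp only [vec] <;> fun_prop

lemma tau_smul (c : ℂ) (v : Fin 3 → ℂ) : tau (c • v) = c * tau v := by simp [tau]; ring

lemma sig_smul (c : ℂ) (v : Fin 3 → ℂ) : sig (c • v) = c * sig v := by simp [sig]; ring

lemma pii_smul (c : ℂ) (v : Fin 3 → ℂ) : pii (c • v) = c * pii v := by simp [pii]; ring

lemma conic_smul (c : ℂ) (v : Fin 3 → ℂ) : conic (c • v) = c ^ 2 * conic v := by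
  simp only [conic, tau_smul, sig_smul, pii_smul]; ring

lemma continuous_tau : Continuous tau := by unfold tau; fun_prop

lemma continuous_sig : Continuous sig := by unfold sig; fun_prop

lemma continuous_pii : Continuous pii := by unfold pii; fun_prop

lemma continuous_conic : Continuous conic := by unfold conic sig pii tau; fun_prop

/-- The values of a multiple of the sextic, in terms of the adapted coordinates. -/
def sextic (v : Fin 3 → ℂ) : ℂ := conic v * (16 * pii v ^ 2 * conic v - 6 * conic v ^ 2
  - 6 * sig v ^ 2 * conic v + 9 * tau v ^ 2 * conic v - 16 * sig v * tau v * conic v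
  - 16 * tau v ^ 4)

lemma eval_mul (v : Fin 3 → ℂ) : -324 * MvPolynomial.eval v (F₁ * Q₁) = sextic v := by
  simp only [F₁, Q₁, sextic, conic, tau, sig, pii, map_mul, map_add, map_sub, map_pow,
    MvPolynomial.eval_X, map_ofNat]
  ring

lemma sextic_smul (c : ℂ) (v : Fin 3 → ℂ) : sextic (c • v) = c ^ 6 * sextic v := by
  simp only [sextic, conic_smul, tau_smul, sig_smul, pii_smul]; ring

lemma eval_smul (c : ℂ) (v : Fin 3 → ℂ) : MvPolynomial.eval (c • v) (F₁ * Q₁) =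
    c ^ 6 * MvPolynomial.eval v (F₁ * Q₁) := by
  have h1 := eval_mul v
  have h2 := eval_mul (c • v)
  rw [sextic_smul, ← h1] at h2
  linear_combination -h2 / 324

/-- The complement of the first sextic. -/
abbrev Compl : Set P2 := (VV (F₁ * Q₁))ᶜ

lemma mk_mem {v : Fin 3 → ℂ} (hv : v ≠ 0) :
    Projectivization.mk ℂ v hv ∈ Compl ↔ sextic v ≠ 0 := by
  rw [mem_compl_iff, mk_mem_VV_iff eval_smul, ← eval_mul, mul_ne_zero_iff]
  simp

lemma vec_ne_zero {p s t : ℂ} (h : t ≠ 0 ∨ s ≠ 0) : vec p s t ≠ 0 := by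
  intro h0
  have h1 := tau_vec p s t
  have h2 := sig_vec p s t
  rw [h0] at h1 h2
  rcases h with h | h
  · exact h (by rw [← h1]; simp [tau])
  · exact h (by rw [← h2]; simp [sig])

/-- The double covering of the affine chart branched along the conic. -/
def chart : C(ℂ × ℂ, P2) where
  toFun q := Projectivization.mk ℂ (vec ((q.2 ^ 2 - q.1 ^ 2) / 4) q.2 1)
    (vec_ne_zero (Or.inl one_ne_zero))
  continuous_toFun := continuous_proj.comp (Continuous.subtype_mk (continuous_vec.comp
    (f := fun q : ℂ × ℂ => ((q.2 ^ 2 - q.1 ^ 2) / 4, q.2, (1 : ℂ))) (by fun_prop))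
    fun _ => vec_ne_zero (Or.inl one_ne_zero))

lemma chart_neg (d s : ℂ) : chart (-d, s) = chart (d, s) := by
  change Projectivization.mk ℂ (vec ((s ^ 2 - (-d) ^ 2) / 4) s 1) _ =
    Projectivization.mk ℂ (vec ((s ^ 2 - d ^ 2) / 4) s 1) _
  simp only [neg_sq]

/-- The preimage of the complement of the sextic, away from the conic. -/
def Dom : Set (ℂ × ℂ) :=
  {q | q.1 ≠ 0 ∧ (q.2 - q.1) ^ 2 ≠ 3 + 4 / q.1 ∧ (q.2 + q.1) ^ 2 ≠ 3 - 4 / q.1}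

lemma chart_mem_iff (q : ℂ × ℂ) : chart q ∈ Compl ↔ q ∈ Dom := by
  obtain ⟨d, s⟩ := q
  have h : sextic (vec ((s ^ 2 - d ^ 2) / 4) s 1) =
      d ^ 2 * ((d * (s - d) ^ 2 - (3 * d + 4)) * (d * (s + d) ^ 2 - (3 * d - 4))) := by
    simp only [sextic, conic, tau_vec, sig_vec, pii_vec]
    ring
  refine (mk_mem _).trans ?_
  rw [h, mul_ne_zero_iff, mul_ne_zero_iff]
  simp only [Dom, mem_ofPred_eq]
  rw [pow_ne_zero_iff two_ne_zero]
  refine and_congr_right fun hd => and_congr (not_congr ?_) (not_congr ?_)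
  · rw [sub_eq_zero]
    constructor <;> intro h
    · field_simp; linear_combination h
    · field_simp at h; linear_combination h
  · rw [sub_eq_zero]
    constructor <;> intro h
    · field_simp; linear_combination h
    · field_simp at h; linear_combination h

lemma neg_mem_dom {d s : ℂ} : (-d, s) ∈ Dom ↔ (d, s) ∈ Dom := by
  rw [← chart_mem_iff, chart_neg, chart_mem_iff]

lemma isOpen_dom : IsOpen Dom := by
  have : Dom = {q | q.1 ≠ 0 ∧ q.1 * (q.2 - q.1) ^ 2 ≠ 3 * q.1 + 4 ∧
      q.1 * (q.2 + q.1) ^ 2 ≠ 3 * q.1 - 4} := by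
    ext q
    refine and_congr_right fun hd => and_congr (not_congr ?_) (not_congr ?_) <;>
    · constructor <;> intro h
      · field_simp at h; linear_combination h
      · field_simp; linear_combination h
  rw [this]
  refine IsOpen.inter ?_ (IsOpen.inter ?_ ?_) <;> exact isOpen_ne_fun (by fun_prop) (by fun_prop)

instance : PathConnectedSpace Compl := by
  refine isPathConnected_iff_pathConnectedSpace.1 (isPathConnected_compl_VV
    ?_ (mk_mem_VV_iff eval_smul) ⟨chart (1, 0), (chart_mem_iff _).2 ?_⟩)
  · have := eval_mul 0
    have h : sextic 0 = 0 := by simp [sextic, conic, tau, sig, pii]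
    rw [h] at this
    simpa using this
  · simp only [Dom, mem_ofPred_eq]; norm_num

end FirstSextic

namespace FirstSextic

open ProjPlane Holonomy Topology unitInterval Set

/-- The points over `D` from which one can go to infinity vertically in the direction `ε`
without leaving the domain. -/
def Vis (D : Set ℂ) (ε : ℝ) : Set (ℂ × ℂ) :=
  {q | q.1 ∈ D ∧ ∀ t : ℝ, 0 ≤ t → (q.1, q.2 + (ε * t : ℝ) * Complex.I) ∈ Dom}

lemma Vis.mem_dom {D : Set ℂ} {ε : ℝ} {q : ℂ × ℂ} (h : q ∈ Vis D ε) : q ∈ Dom := by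
  simpa using h.2 0 le_rfl

lemma Vis.mono {D D' : Set ℂ} {ε : ℝ} (h : D ⊆ D') : Vis D ε ⊆ Vis D' ε :=
  fun _ hq => ⟨h hq.1, hq.2⟩

lemma Vis.push {D : Set ℂ} {ε : ℝ} {q : ℂ × ℂ} (h : q ∈ Vis D ε) {t : ℝ} (ht : 0 ≤ t) :
    (q.1, q.2 + (ε * t : ℝ) * Complex.I) ∈ Vis D ε := by
  refine ⟨h.1, fun s hs => ?_⟩
  have := h.2 (t + s) (by positivity)
  convert this using 2
  push_cast; ring

lemma le_of_sq_eq {w z : ℂ} {k : ℝ} (hk : 1 ≤ k) (hz : ‖z‖ ≤ k) (h : w ^ 2 = z) : ‖w‖ ≤ k := by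
  have : ‖w‖ ^ 2 = ‖z‖ := by rw [← h, norm_pow]
  nlinarith [norm_nonneg w]

lemma mem_dom_of_norm {d s : ℂ} (hd : d ≠ 0) (hs : ‖d‖ + 3 + 4 / ‖d‖ < ‖s‖) : (d, s) ∈ Dom := by
  have hd' : 0 < 4 / ‖d‖ := by positivity
  refine ⟨hd, fun h => ?_, fun h => ?_⟩
  · have h1 := le_of_sq_eq (k := 3 + 4 / ‖d‖) (by linarith)
      ((norm_add_le _ _).trans (by simp)) h
    have h2 := norm_sub_norm_le s d
    dsimp at h1
    linarith
  · have h1 := le_of_sq_eq (k := 3 + 4 / ‖d‖) (by linarith)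
      ((norm_sub_le _ _).trans (by simp)) h
    have h2 := norm_sub_norm_le s (-d)
    rw [norm_neg, sub_neg_eq_add] at h2
    dsimp at h1
    linarith

lemma contractibleSpace_of_retraction {E : Type*} [AddCommGroup E] [Module ℝ E] [TopologicalSpace E]
    [ContinuousAdd E] [ContinuousSMul ℝ E] {T C : Set E} (hCT : C ⊆ T) (hC : Convex ℝ C)
    (hne : T.Nonempty) (r : T → E) (hr : Continuous r) (hrC : ∀ z, r z ∈ C)
    (hseg : ∀ z : T, segment ℝ (z : E) (r z) ⊆ T) : ContractibleSpace T := by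
  obtain ⟨z0, hz0⟩ := hne
  let c0 : E := r ⟨z0, hz0⟩
  have hc0 : c0 ∈ C := hrC _
  have := (hC.contractibleSpace ⟨c0, hc0⟩)
  let i : C(C, T) := ⟨fun c => ⟨c, hCT c.2⟩, by fun_prop⟩
  let r' : C(T, C) := ⟨fun z => ⟨r z, hrC z⟩, by fun_prop⟩
  rw [contractible_iff_id_nullhomotopic]
  have h1 : (ContinuousMap.id T).Homotopic (i.comp r') := by
    refine ⟨⟨⟨fun p => ⟨(1 - (p.1 : ℝ)) • (p.2 : E) + (p.1 : ℝ) • r p.2, ?_⟩, ?_⟩, ?_, ?_⟩⟩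
    · exact hseg p.2 ⟨_, _, sub_nonneg.2 p.1.2.2, p.1.2.1, by ring, rfl⟩
    · fun_prop
    · intro z; simp
    · intro z; simp [i, r']
  have h2 : (ContinuousMap.id C).Nullhomotopic := (contractible_iff_id_nullhomotopic _).1 this
  obtain ⟨y, hy⟩ := h2
  refine ⟨i y, h1.trans ?_⟩
  have := (ContinuousMap.Homotopic.refl i).comp (hy.comp (ContinuousMap.Homotopic.refl r'))
  exact this

/-- A real linear form, positive on the relevant sets, controlling the size of the inverse. -/
def IsHeight (l : ℂ →L[ℝ] ℝ) : Prop := ∀ d, l d ≤ ‖d‖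

lemma isHeight_re : IsHeight Complex.reCLM := fun d => Complex.re_le_norm d

lemma isHeight_im : IsHeight Complex.imCLM := fun d => Complex.im_le_norm d

lemma convexOn_bound (l : ℂ →L[ℝ] ℝ) :
    ConvexOn ℝ {d : ℂ | 0 < l d} fun d => ‖d‖ + 3 + 4 / l d := by
  have h0 : Convex ℝ {d : ℂ | 0 < l d} := convex_halfSpace_gt l.isLinear 0
  have h1 : ConvexOn ℝ {d : ℂ | 0 < l d} fun d => ‖d‖ :=
    (convexOn_univ_norm).subset (subset_univ _) h0
  have h2 : ConvexOn ℝ (Ioi (0 : ℝ)) fun x => x⁻¹ := by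
    simpa using convexOn_zpow (𝕜 := ℝ) (-1)
  have h3 : ConvexOn ℝ {d : ℂ | 0 < l d} fun d => (l d)⁻¹ := h2.comp_linearMap l.toLinearMap
  have h4 := (h1.add_const 3).add (h3.smul (c := 4) (by norm_num))
  refine h4.congr fun d _ => ?_
  simp [div_eq_mul_inv]

section

variable {l : ℂ →L[ℝ] ℝ} {D : Set ℂ} {ε : ℝ}

lemma mem_dom_of_bound (hl : IsHeight l) {d s : ℂ} (hd : 0 < l d)
    (hs : ‖d‖ + 3 + 4 / l d < ‖s‖) : (d, s) ∈ Dom := by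
  have h1 : 0 < ‖d‖ := hd.trans_le (hl d)
  refine mem_dom_of_norm (norm_pos_iff.1 h1) (lt_of_le_of_lt ?_ hs)
  have := div_le_div_of_nonneg_left (by norm_num : (0 : ℝ) ≤ 4) hd (hl d)
  linarith

lemma high_mem_vis (hl : IsHeight l) (hlD : ∀ d ∈ D, 0 < l d) (hε : ε ^ 2 = 1) {d s : ℂ}
    (hd : d ∈ D) (hs : ‖d‖ + 3 + 4 / l d < ε * s.im) : (d, s) ∈ Vis D ε := by
  refine ⟨hd, fun t ht => mem_dom_of_bound hl (hlD d hd) (hs.trans_le ?_)⟩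
  have h1 : |ε| = 1 := by
    have : |ε| ^ 2 = 1 := by rw [sq_abs, hε]
    nlinarith [abs_nonneg ε]
  calc ε * s.im ≤ ε * (s + (ε * t : ℝ) * Complex.I).im := by
        simp; nlinarith
    _ ≤ |ε * (s + (ε * t : ℝ) * Complex.I).im| := le_abs_self _
    _ = |(s + (ε * t : ℝ) * Complex.I).im| := by rw [abs_mul, h1, one_mul]
    _ ≤ _ := Complex.abs_im_le_norm _

lemma contractibleSpace_vis (hl : IsHeight l) (hlD : ∀ d ∈ D, 0 < l d) (hD : Convex ℝ D)
    (hne : D.Nonempty) (hε : ε ^ 2 = 1) : ContractibleSpace (Vis D ε) := by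
  let C : Set (ℂ × ℂ) := {q | q.1 ∈ D ∧ ‖q.1‖ + 3 + 4 / l q.1 < ε * q.2.im}
  have hCV : C ⊆ Vis D ε := fun q hq => high_mem_vis hl hlD hε hq.1 hq.2
  have hcv : ConvexOn ℝ D fun d => ‖d‖ + 3 + 4 / l d := (convexOn_bound l).subset hlD hD
  have hC : Convex ℝ C := by
    let u : ℂ × ℂ →ₗ[ℝ] ℂ × ℝ :=
      (LinearMap.fst ℝ ℂ ℂ).prod (ε • (Complex.imLm.comp (LinearMap.snd ℝ ℂ ℂ)))
    have := (hcv.convex_strict_epigraph).linear_preimage u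
    exact this
  have hbd : ∀ d ∈ D, 0 < ‖d‖ + 3 + 4 / l d := fun d hd => by
    have := hlD d hd
    positivity
  obtain ⟨d0, hd0⟩ := hne
  have habs : ∀ s : ℂ, 0 ≤ |s.im| + ε * s.im := fun s => by
    have h1 : |ε| = 1 := by
      have : |ε| ^ 2 = 1 := by rw [sq_abs, hε]
      nlinarith [abs_nonneg ε]
    have := neg_abs_le (ε * s.im)
    rw [abs_mul, h1, one_mul] at this
    linarith
  have hεε : ∀ x : ℝ, ε * (ε * x) = x := fun x => by rw [← mul_assoc, ← sq, hε, one_mul]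
  refine contractibleSpace_of_retraction hCV hC
    ⟨(d0, (ε * (‖d0‖ + 3 + 4 / l d0 + 1) : ℝ) * Complex.I), hCV ⟨hd0, ?_⟩⟩
    (fun q => (q.1.1, q.1.2 + (ε * (‖q.1.1‖ + 3 + 4 / l q.1.1 + |q.1.2.im| + 1) : ℝ) * Complex.I))
    ?_ ?_ ?_
  · simp only [Complex.mul_im, Complex.ofReal_re, Complex.I_im, Complex.ofReal_im, Complex.I_re]
    rw [mul_zero, add_zero, mul_one, hεε]
    linarith
  · have : Continuous fun q : Vis D ε => 4 / l q.1.1 :=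
      continuous_const.div (by fun_prop) fun q => (hlD _ q.2.1).ne'
    fun_prop
  · intro q
    refine ⟨q.2.1, ?_⟩
    simp only [Complex.add_im, Complex.mul_im, Complex.ofReal_re, Complex.I_im, Complex.ofReal_im,
      Complex.I_re]
    have := habs q.1.2
    rw [mul_zero, add_zero, mul_one, mul_add, hεε]
    linarith
  · rintro q z ⟨a, b, ha, hb, hab, rfl⟩
    have hb' : 0 ≤ b * (‖q.1.1‖ + 3 + 4 / l q.1.1 + |q.1.2.im| + 1) :=
      mul_nonneg hb (by have := hbd _ q.2.1; positivity)
    have := Vis.push q.2 hb'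
    convert this using 1
    have ha' : (a : ℂ) = 1 - b := by rw [eq_sub_iff_add_eq]; exact_mod_cast hab
    ext1
    · simp only [Prod.fst_add, Prod.smul_fst, Complex.real_smul]
      rw [ha']; ring
    · simp only [Prod.snd_add, Prod.smul_snd, Complex.real_smul]
      rw [ha']; push_cast; ring

lemma isPathConnected_vis (hl : IsHeight l) (hlD : ∀ d ∈ D, 0 < l d) (hD : Convex ℝ D)
    (hne : D.Nonempty) (hε : ε ^ 2 = 1) : IsPathConnected (Vis D ε) := by
  have := contractibleSpace_vis hl hlD hD hne hε
  exact isPathConnected_iff_pathConnectedSpace.2 inferInstance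

end

end FirstSextic

namespace FirstSextic

open ProjPlane Holonomy Topology unitInterval Set

section

variable {l : ℂ →L[ℝ] ℝ} {D : Set ℂ} {ε : ℝ}

lemma far_mem_vis (hl : IsHeight l) (hlD : ∀ d ∈ D, 0 < l d) {d s : ℂ}
    (hd : d ∈ D) (hs : ‖d‖ + 3 + 4 / l d < s.re) (ε : ℝ) : (d, s) ∈ Vis D ε := by
  refine ⟨hd, fun t ht => mem_dom_of_bound hl (hlD d hd) (hs.trans_le ?_)⟩
  refine le_trans ?_ (Complex.re_le_norm _)
  simp

lemma isPathConnected_far (l : ℂ →L[ℝ] ℝ) (hlD : ∀ d ∈ D, 0 < l d) (hD : Convex ℝ D)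
    (hne : D.Nonempty) :
    IsPathConnected {q : ℂ × ℂ | q.1 ∈ D ∧ ‖q.1‖ + 3 + 4 / l q.1 < q.2.re} := by
  have hcv : ConvexOn ℝ D fun d => ‖d‖ + 3 + 4 / l d := (convexOn_bound l).subset hlD hD
  let u : ℂ × ℂ →ₗ[ℝ] ℂ × ℝ :=
    (LinearMap.fst ℝ ℂ ℂ).prod ((Complex.reLm.comp (LinearMap.snd ℝ ℂ ℂ)))
  have : Convex ℝ {q : ℂ × ℂ | q.1 ∈ D ∧ ‖q.1‖ + 3 + 4 / l q.1 < q.2.re} :=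
    (hcv.convex_strict_epigraph).linear_preimage u
  obtain ⟨d0, hd0⟩ := hne
  refine this.isPathConnected ⟨(d0, ((‖d0‖ + 3 + 4 / l d0 + 1 : ℝ) : ℂ)), hd0, ?_⟩
  rw [Complex.ofReal_re]
  exact lt_add_one _

end

/-- The right half-plane. -/
def RH : Set ℂ := {d | 0 < Complex.reCLM d}

/-- The upper half-plane. -/
def UH : Set ℂ := {d | 0 < Complex.imCLM d}

/-- The first quadrant. -/
def Q1 : Set ℂ := RH ∩ UH

/-- The fourth quadrant. -/
def Q4 : Set ℂ := RH ∩ {d | Complex.imCLM d < 0}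

lemma convex_RH : Convex ℝ RH := convex_halfSpace_gt Complex.reCLM.isLinear 0

lemma convex_UH : Convex ℝ UH := convex_halfSpace_gt Complex.imCLM.isLinear 0

lemma convex_Q1 : Convex ℝ Q1 := convex_RH.inter convex_UH

lemma convex_Q4 : Convex ℝ Q4 :=
  convex_RH.inter (convex_halfSpace_lt Complex.imCLM.isLinear 0)

@[simp] lemma mem_RH {d : ℂ} : d ∈ RH ↔ 0 < d.re := Iff.rfl

@[simp] lemma mem_UH {d : ℂ} : d ∈ UH ↔ 0 < d.im := Iff.rfl

@[simp] lemma mem_Q1 {d : ℂ} : d ∈ Q1 ↔ 0 < d.re ∧ 0 < d.im := Iff.rfl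

@[simp] lemma mem_Q4 {d : ℂ} : d ∈ Q4 ↔ 0 < d.re ∧ d.im < 0 := Iff.rfl

lemma Vis.neg {D D' : Set ℂ} (h : ∀ d ∈ D, -d ∈ D') {ε : ℝ} {d s : ℂ} (hq : (d, s) ∈ Vis D ε) :
    (-d, s) ∈ Vis D' ε :=
  ⟨h _ hq.1, fun t ht => neg_mem_dom.2 (hq.2 t ht)⟩

variable {K : Type*} [Group K] {x₁ : Compl}

/-- Compatible gauges over the visible sets. -/
structure GaugeSystem (ρ : FundamentalGroup Compl x₁ →* K) where
  /-- The gauges over the right half-plane. -/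
  r : ℝ → ℂ × ℂ → K
  /-- The gauges over the upper half-plane. -/
  u : ℝ → ℂ × ℂ → K
  /-- The glueing constant over the fourth quadrant. -/
  c : K
  isGauge_r : ∀ ε : ℝ, ε ^ 2 = 1 → IsGauge (hol ρ) chart (Vis RH ε) (r ε)
  isGauge_u : ∀ ε : ℝ, ε ^ 2 = 1 → IsGauge (hol ρ) chart (Vis UH ε) (u ε)
  far : ∀ d s : ℂ, d ∈ RH → ‖d‖ + 3 + 4 / d.re < s.re → r (-1) (d, s) = r 1 (d, s)
  q1 : ∀ ε : ℝ, ε ^ 2 = 1 → ∀ q ∈ Vis Q1 ε, u ε q = r ε q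
  q4 : ∀ ε : ℝ, ε ^ 2 = 1 → ∀ d s : ℂ, (d, s) ∈ Vis Q4 ε → u ε (-d, s) = c * r ε (d, s)

lemma eq_on_far {l : ℂ →L[ℝ] ℝ} {D : Set ℂ} {R : C(I, P2) → K} (hl : IsHeight l)
    (hlD : ∀ d ∈ D, 0 < l d) (hD : Convex ℝ D) {g : ℝ → ℂ × ℂ → K}
    (hg : ∀ ε : ℝ, ε ^ 2 = 1 → IsGauge R chart (Vis D ε) (g ε)) {d0 s0 : ℂ}
    (hd0 : d0 ∈ D) (hs0 : ‖d0‖ + 3 + 4 / l d0 < s0.re) (h0 : g (-1) (d0, s0) = g 1 (d0, s0))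
    {d s : ℂ} (hd : d ∈ D) (hs : ‖d‖ + 3 + 4 / l d < s.re) : g (-1) (d, s) = g 1 (d, s) := by
  have h := (hg (-1) (by norm_num)).eq_of_isPathConnected (hg 1 (by norm_num))
    (isPathConnected_far l hlD hD ⟨d, hd⟩) (fun q hq => far_mem_vis hl hlD hq.1 hq.2 _)
    (fun q hq => far_mem_vis hl hlD hq.1 hq.2 _) (z := (d, s)) (w := (d0, s0)) ⟨hd, hs⟩ ⟨hd0, hs0⟩
  rwa [h0, mul_inv_cancel, mul_inv_eq_one] at h

lemma chart_comp_neg :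
    chart.comp ⟨fun q : ℂ × ℂ => (-q.1, q.2), by fun_prop⟩ = chart := by
  ext q
  exact chart_neg q.1 q.2

lemma norm_le_two {d : ℂ} (h1 : |d.re| ≤ 1) (h2 : |d.im| ≤ 1) : ‖d‖ ≤ 2 :=
  (Complex.norm_le_abs_re_add_abs_im d).trans (by linarith)

theorem nonempty_gaugeSystem (ρ : FundamentalGroup Compl x₁ →* K) : Nonempty (GaugeSystem ρ) := by
  have hex : ∀ {l : ℂ →L[ℝ] ℝ} {D : Set ℂ} (_ : IsHeight l) (_ : ∀ d ∈ D, 0 < l d)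
      (_ : Convex ℝ D) (_ : D.Nonempty) (d0 s0 : ℂ), ∃ g : ℝ → ℂ × ℂ → K,
      (∀ ε, g ε (d0, s0) = 1) ∧ ∀ ε : ℝ, ε ^ 2 = 1 → IsGauge (hol ρ) chart (Vis D ε) (g ε) := by
    intro l D hl hlD hD hne d0 s0
    have : ∀ ε : ℝ, ∃ g : ℂ × ℂ → K, ε ^ 2 = 1 → IsGauge (hol ρ) chart (Vis D ε) g := by
      intro ε
      by_cases hε : ε ^ 2 = 1
      · have := contractibleSpace_vis hl hlD hD hne hε
        obtain ⟨g, hg⟩ := exists_isGauge ρ chart (Vis D ε) (fun _ => inferInstance)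
          fun q hq => (chart_mem_iff q).2 (Vis.mem_dom hq)
        exact ⟨g, fun _ => hg⟩
      · exact ⟨fun _ => 1, fun h => (hε h).elim⟩
    choose g hg using this
    exact ⟨fun ε q => (g ε (d0, s0))⁻¹ * g ε q, fun ε => by simp, fun ε hε =>
      (hg ε hε).const_mul _⟩
  let d0 : ℂ := ⟨1, 1⟩
  let d1 : ℂ := ⟨1, -1⟩
  let s0 : ℂ := 100
  have hd0 : ‖d0‖ ≤ 2 := norm_le_two (by simp [d0]) (by simp [d0])
  have hd1 : ‖d1‖ ≤ 2 := norm_le_two (by simp [d1]) (by simp [d1])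
  obtain ⟨r, hr0, hr⟩ := hex isHeight_re (D := RH) (fun _ h => h) convex_RH ⟨1, by simp⟩ d0 s0
  obtain ⟨u, hu0, hu⟩ := hex isHeight_im (D := UH) (fun _ h => h) convex_UH
    ⟨Complex.I, by simp⟩ d0 s0
  have hfr0 : ‖d0‖ + 3 + 4 / Complex.reCLM d0 < s0.re := by
    simp only [Complex.reCLM_apply, d0, s0] at *; norm_num; linarith
  have hfu0 : ‖d0‖ + 3 + 4 / Complex.imCLM d0 < s0.re := by
    simp only [Complex.imCLM_apply, d0, s0] at *; norm_num; linarith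
  have hfr1 : ‖d1‖ + 3 + 4 / Complex.reCLM d1 < s0.re := by
    simp only [Complex.reCLM_apply, d1, s0] at *; norm_num; linarith
  have hfu1 : ‖-d1‖ + 3 + 4 / Complex.imCLM (-d1) < s0.re := by
    rw [norm_neg]
    simp only [Complex.imCLM_apply, Complex.neg_im, d1, s0] at *; norm_num; linarith
  have hd0R : d0 ∈ RH := by simp [d0]
  have hd0U : d0 ∈ UH := by simp [d0]
  have hd1R : d1 ∈ RH := by simp [d1]
  have hd1U : -d1 ∈ UH := by simp [d1]
  have farR : ∀ d s : ℂ, d ∈ RH → ‖d‖ + 3 + 4 / d.re < s.re → r (-1) (d, s) = r 1 (d, s) :=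
    fun d s hd hs => eq_on_far isHeight_re (fun _ h => h) convex_RH hr hd0R hfr0
      (by rw [hr0, hr0]) hd hs
  have farU : u (-1) (-d1, s0) = u 1 (-d1, s0) :=
    eq_on_far isHeight_im (fun _ h => h) convex_UH hu hd0U hfu0 (by rw [hu0, hu0]) hd1U hfu1
  let c (ε : ℝ) : K := u ε (-d1, s0) * (r ε (d1, s0))⁻¹
  have hc : ∀ ε : ℝ, ε ^ 2 = 1 → c ε = c 1 := by
    intro ε hε
    rcases mul_self_eq_one_iff.1 ((sq ε).symm.trans hε) with rfl | rfl
    · rfl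
    · simp only [c]
      rw [farU, farR d1 s0 hd1R hfr1]
  refine ⟨⟨r, u, c 1, hr, hu, farR, ?_, ?_⟩⟩
  · intro ε hε q hq
    have h := (hu ε hε).eq_of_isPathConnected (hr ε hε)
      (isPathConnected_vis isHeight_re (D := Q1) (fun d hd => hd.1) convex_Q1 ⟨d0, by simp [d0]⟩ hε)
      (Vis.mono inter_subset_right) (Vis.mono inter_subset_left) hq (w := (d0, s0))
      (far_mem_vis isHeight_re (D := Q1) (fun d hd => hd.1) ⟨hd0R, hd0U⟩ hfr0 ε)
    rwa [hu0, hr0, mul_inv_cancel, mul_inv_eq_one] at h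
  · intro ε hε d s hq
    have hu' := (hu ε hε).comp ⟨fun q : ℂ × ℂ => (-q.1, q.2), by fun_prop⟩
    rw [chart_comp_neg] at hu'
    have h := hu'.eq_of_isPathConnected (hr ε hε)
      (isPathConnected_vis isHeight_re (D := Q4) (fun d hd => hd.1) convex_Q4 ⟨d1, by simp [d1]⟩ hε)
      (fun q hq => Vis.neg (D := Q4) (fun d hd => by
        have : d.im < 0 := hd.2
        simpa using this) hq) (Vis.mono inter_subset_left) hq (w := (d1, s0))
      (far_mem_vis isHeight_re (D := Q4) (fun d hd => hd.1) ⟨hd1R, by simp [d1]⟩ hfr1 ε)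
    have h' : u ε (-d, s) * (r ε (d, s))⁻¹ = c ε := h
    rw [← hc ε hε, ← h']
    simp

end FirstSextic

namespace FirstSextic

open ProjPlane Holonomy Topology unitInterval Set

/-- The function whose square roots are the punctures of the slices, up to a shift. -/
def zeta (d : ℂ) : ℂ := 3 + 4 / d

/-- The absolute value of the real part of the square roots of `zeta`. -/
def rt (d : ℂ) : ℝ := √((‖zeta d‖ + (zeta d).re) / 2)

/-- The real part of the right puncture attached to `d`. -/
def colR (d : ℂ) : ℝ := d.re + rt d

/-- The real part of the left puncture attached to `d`. -/
def colL (d : ℂ) : ℝ := d.re - rt d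

lemma zeta_re (d : ℂ) : (zeta d).re = 3 + 4 * d.re / Complex.normSq d := by
  simp [zeta, Complex.div_re]

lemma zeta_im (d : ℂ) : (zeta d).im = -4 * d.im / Complex.normSq d := by
  simp [zeta, Complex.div_im, neg_div]

lemma rt_sq (d : ℂ) : rt d ^ 2 = (‖zeta d‖ + (zeta d).re) / 2 := by
  refine Real.sq_sqrt ?_
  have h1 := neg_abs_le (zeta d).re
  have h2 := Complex.abs_re_le_norm (zeta d)
  linarith

lemma rt_nonneg (d : ℂ) : 0 ≤ rt d := Real.sqrt_nonneg _

lemma re_sq_of_sq_eq {w z : ℂ} (h : w ^ 2 = z) : w.re ^ 2 = (‖z‖ + z.re) / 2 := by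
  rw [← h, norm_pow, Complex.sq_norm, Complex.normSq_apply]
  simp [sq]

lemma re_eq_col {d s : ℂ} (h : (s - d) ^ 2 = zeta d) : s.re = colR d ∨ s.re = colL d := by
  have h1 := re_sq_of_sq_eq h
  rw [← rt_sq, Complex.sub_re] at h1
  rcases sq_eq_sq_iff_eq_or_eq_neg.1 h1 with h2 | h2
  · left; rw [colR, ← h2]; ring
  · right; rw [colL, ← neg_eq_iff_eq_neg.2 h2]; ring

lemma im_relation {d s : ℂ} (hd : d ≠ 0) (h : (s - d) ^ 2 = zeta d) :
    Complex.normSq d * ((s.re - d.re) * (s.im - d.im)) = -2 * d.im := by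
  have h1 := congrArg Complex.im h
  have h2 : 0 < Complex.normSq d := Complex.normSq_pos.2 hd
  rw [zeta_im, eq_div_iff h2.ne', sq, Complex.mul_im] at h1
  simp only [Complex.sub_re, Complex.sub_im] at h1
  linarith

/-- The punctures attached to `d` on a vertical line lie below the real axis. -/
def DownAt (d : ℂ) (u : ℝ) : Prop := ∀ s : ℂ, (s - d) ^ 2 = zeta d → s.re = u → s.im < 0

/-- The punctures attached to `d` on a vertical line lie above the real axis. -/
def UpAt (d : ℂ) (u : ℝ) : Prop := ∀ s : ℂ, (s - d) ^ 2 = zeta d → s.re = u → 0 < s.im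

lemma downAt_of {d : ℂ} {u : ℝ} (hd : d ≠ 0) (hl : u = colL d → d.im < 0)
    (hr : u = colR d → d.im * (Complex.normSq d * rt d - 2) < 0) : DownAt d u := by
  intro s hs hu
  have h1 := im_relation hd hs
  have hN : 0 ≤ Complex.normSq d * rt d := mul_nonneg (Complex.normSq_nonneg d) (rt_nonneg d)
  rcases re_eq_col hs with h | h
  · have h2 := hr (hu.symm.trans h)
    rw [h, colR] at h1
    refine neg_of_mul_neg_right (a := Complex.normSq d * rt d) ?_ hN
    nlinarith
  · have h2 := hl (hu.symm.trans h)
    rw [h, colL] at h1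
    refine neg_of_mul_neg_right (a := Complex.normSq d * rt d) ?_ hN
    nlinarith

lemma upAt_of {d : ℂ} {u : ℝ} (hd : d ≠ 0) (hl : u = colL d → 0 < d.im)
    (hr : u = colR d → 0 < d.im * (Complex.normSq d * rt d - 2)) : UpAt d u := by
  intro s hs hu
  have h1 := im_relation hd hs
  have hN : 0 ≤ Complex.normSq d * rt d := mul_nonneg (Complex.normSq_nonneg d) (rt_nonneg d)
  rcases re_eq_col hs with h | h
  · have h2 := hr (hu.symm.trans h)
    rw [h, colR] at h1
    refine pos_of_mul_pos_right (a := Complex.normSq d * rt d) ?_ hN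
    nlinarith
  · have h2 := hl (hu.symm.trans h)
    rw [h, colL] at h1
    refine pos_of_mul_pos_right (a := Complex.normSq d * rt d) ?_ hN
    nlinarith

lemma mem_dom_iff {d s : ℂ} :
    (d, s) ∈ Dom ↔ d ≠ 0 ∧ (s - d) ^ 2 ≠ zeta d ∧ (s - -d) ^ 2 ≠ zeta (-d) := by
  simp only [Dom, mem_ofPred_eq, zeta, sub_neg_eq_add, div_neg, ← sub_eq_add_neg]

lemma mem_vis_one {D : Set ℂ} {d : ℂ} {u : ℝ} (hd : d ∈ D) (h0 : d ≠ 0) (h1 : DownAt d u)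
    (h2 : DownAt (-d) u) : (d, (u : ℂ)) ∈ Vis D 1 := by
  refine ⟨hd, fun t ht => mem_dom_iff.2 ⟨h0, fun h => ?_, fun h => ?_⟩⟩
  · have := h1 _ h (by simp)
    simp at this
    linarith
  · have := h2 _ h (by simp)
    simp at this
    linarith

lemma mem_vis_neg_one {D : Set ℂ} {d : ℂ} {u : ℝ} (hd : d ∈ D) (h0 : d ≠ 0) (h1 : UpAt d u)
    (h2 : UpAt (-d) u) : (d, (u : ℂ)) ∈ Vis D (-1) := by
  refine ⟨hd, fun t ht => mem_dom_iff.2 ⟨h0, fun h => ?_, fun h => ?_⟩⟩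
  · have := h1 _ h (by simp)
    simp at this
    linarith
  · have := h2 _ h (by simp)
    simp at this
    linarith

/-- The vertical line through a point avoids the four punctures of a slice. -/
def Clear (d : ℂ) (u : ℝ) : Prop :=
  d ≠ 0 ∧ (u ≠ colR d ∧ u ≠ colL d) ∧ u ≠ colR (-d) ∧ u ≠ colL (-d)

lemma Clear.mem_vis {D : Set ℂ} {d s : ℂ} (h : Clear d s.re) (hd : d ∈ D) (ε : ℝ) :
    (d, s) ∈ Vis D ε := by
  refine ⟨hd, fun t ht => mem_dom_iff.2 ⟨h.1, fun h' => ?_, fun h' => ?_⟩⟩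
  · rcases re_eq_col h' with h1 | h1
    · exact h.2.1.1 (by simpa using h1)
    · exact h.2.1.2 (by simpa using h1)
  · rcases re_eq_col h' with h1 | h1
    · exact h.2.2.1 (by simpa using h1)
    · exact h.2.2.2 (by simpa using h1)

lemma continuousOn_rt : ContinuousOn rt {0}ᶜ := by
  have : ContinuousOn zeta {0}ᶜ := by
    unfold zeta
    exact continuousOn_const.add (continuousOn_const.div continuousOn_id fun d hd => hd)
  exact ((this.norm.add (Complex.continuous_re.comp_continuousOn this)).div_const 2).sqrt

lemma continuousOn_colR : ContinuousOn colR {0}ᶜ := by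
  have := continuousOn_rt
  unfold colR
  fun_prop

lemma continuousOn_colL : ContinuousOn colL {0}ᶜ := by
  have := continuousOn_rt
  unfold colL
  fun_prop

lemma continuousOn_colR_neg : ContinuousOn (fun d => colR (-d)) {0}ᶜ :=
  continuousOn_colR.comp continuousOn_neg fun d hd => by simpa using hd

lemma continuousOn_colL_neg : ContinuousOn (fun d => colL (-d)) {0}ᶜ :=
  continuousOn_colL.comp continuousOn_neg fun d hd => by simpa using hd

section

variable {K : Type*} [Group K] {R : C(I, P2) → K} {D : Set ℂ} {g : ℝ → ℂ × ℂ → K}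

/-- The transition between the two gauges. -/
def jump (g : ℝ → ℂ × ℂ → K) (q : ℂ × ℂ) : K := g (-1) q * (g 1 q)⁻¹

lemma jump_eq_of_path (hg : ∀ ε : ℝ, ε ^ 2 = 1 → IsGauge R chart (Vis D ε) (g ε))
    (γ : C(I, ℂ × ℂ)) (h : ∀ t, (γ t).1 ∈ D) (h' : ∀ t, Clear (γ t).1 (γ t).2.re) :
    jump g (γ 1) = jump g (γ 0) :=
  (hg (-1) (by norm_num)).eq_of_path (hg 1 (by norm_num)) γ (fun t => (h' t).mem_vis (h t) _)
    fun t => (h' t).mem_vis (h t) _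

lemma jump_eq_re (hg : ∀ ε : ℝ, ε ^ 2 = 1 → IsGauge R chart (Vis D ε) (g ε)) {d s : ℂ}
    (hd : d ∈ D) (h : Clear d s.re) : jump g (d, s) = jump g (d, (s.re : ℂ)) := by
  have := jump_eq_of_path hg ⟨fun t : I => (d, (s.re : ℂ) + ((t : ℝ) * s.im : ℝ) * Complex.I),
    by fun_prop⟩ (fun t => hd) (fun t => by simpa using h)
  simpa using this

/-- The jump is constant on each chamber cut out by the columns. -/
lemma jump_eq_of_chamber (hg : ∀ ε : ℝ, ε ^ 2 = 1 → IsGauge R chart (Vis D ε) (g ε))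
    {D' : Set ℂ} (hD' : D' ⊆ D) (hc : Convex ℝ D') {α β : ℂ → ℝ} (hα : ContinuousOn α D')
    (hβ : ContinuousOn β D') (hαβ : ∀ d ∈ D', α d < β d)
    (hV : ∀ d ∈ D', ∀ u : ℝ, α d < u → u < β d → Clear d u)
    {d d' : ℂ} {u u' : ℝ} (hd : d ∈ D') (hd' : d' ∈ D') (h1 : α d < u) (h2 : u < β d)
    (h1' : α d' < u') (h2' : u' < β d') :
    jump g (d', (u' : ℂ)) = jump g (d, (u : ℂ)) := by
  obtain ⟨p, hp⟩ := (hc.isPathConnected ⟨d, hd⟩).joinedIn d hd d' hd'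
  have h12 : 0 < β d - α d := by linarith
  have h12' : 0 < β d' - α d' := by linarith
  let θ : I → ℝ := fun t => (1 - (t : ℝ)) * ((u - α d) / (β d - α d)) +
    (t : ℝ) * ((u' - α d') / (β d' - α d'))
  have hθ : Continuous θ := by fun_prop
  have hθ0 : ∀ t, 0 < θ t ∧ θ t < 1 := by
    intro t
    have e1 : 0 < (u - α d) / (β d - α d) := div_pos (by linarith) h12
    have e2 : (u - α d) / (β d - α d) < 1 := (div_lt_one h12).2 (by linarith)
    have e3 : 0 < (u' - α d') / (β d' - α d') := div_pos (by linarith) h12'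
    have e4 : (u' - α d') / (β d' - α d') < 1 := (div_lt_one h12').2 (by linarith)
    exact convex_Ioo (0 : ℝ) 1 ⟨e1, e2⟩ ⟨e3, e4⟩ (sub_nonneg.2 t.2.2) t.2.1 (by ring)
  have hα' : Continuous fun t => α (p t) := hα.comp_continuous p.continuous hp
  have hβ' : Continuous fun t => β (p t) := hβ.comp_continuous p.continuous hp
  let γ : C(I, ℂ × ℂ) :=
    ⟨fun t => (p t, ((α (p t) + θ t * (β (p t) - α (p t)) : ℝ) : ℂ)), p.continuous.prodMk
      (Complex.continuous_ofReal.comp (hα'.add (hθ.mul (hβ'.sub hα'))))⟩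
  have hpos : 0 < u - α d := by linarith
  have key := jump_eq_of_path hg γ (fun t => hD' (hp t)) fun t => ?_
  · have e0 : γ 0 = (d, (u : ℂ)) := by
      simp only [γ, θ, ContinuousMap.coe_mk, p.source]
      congr 2
      simp
      field_simp
      ring
    have e1 : γ 1 = (d', (u' : ℂ)) := by
      simp only [γ, θ, ContinuousMap.coe_mk, p.target]
      congr 2
      simp
      field_simp
      ring
    rwa [e0, e1] at key
  · simp only [γ, ContinuousMap.coe_mk, Complex.ofReal_re]
    have := hαβ _ (hp t)
    refine hV _ (hp t) _ ?_ ?_ <;> nlinarith [hθ0 t]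

end

/-- The effect on the jumps of two punctures, on different sides of the real axis, whose
columns get interchanged. -/
lemma jump_crossing {x₁ : Compl} {K : Type*} [Group K] (ρ : FundamentalGroup Compl x₁ →* K)
    {D : Set ℂ} {g : ℝ → ℂ × ℂ → K}
    (hg : ∀ ε : ℝ, ε ^ 2 = 1 → IsGauge (hol ρ) chart (Vis D ε) (g ε)) (δ : C(I, ℂ)) (l r : C(I, ℝ))
    (hδ : ∀ s, δ s ∈ D) (hlr : ∀ s, l s ≤ r s)
    (hreal : ∀ s, ∀ u : ℝ, l s ≤ u → u ≤ r s → (δ s, (u : ℂ)) ∈ Dom)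
    (hl : ∀ s, Clear (δ s) (l s)) (hr : ∀ s, Clear (δ s) (r s)) {μ₀ μ₁ : ℝ}
    (hl₀ : l 0 ≤ μ₀) (hr₀ : μ₀ ≤ r 0) (hl₁ : l 1 ≤ μ₁) (hr₁ : μ₁ ≤ r 1)
    (h₀l : ∀ u : ℝ, l 0 ≤ u → u ≤ μ₀ → (δ 0, (u : ℂ)) ∈ Vis D (-1))
    (h₀r : ∀ u : ℝ, μ₀ ≤ u → u ≤ r 0 → (δ 0, (u : ℂ)) ∈ Vis D 1)
    (h₁l : ∀ u : ℝ, l 1 ≤ u → u ≤ μ₁ → (δ 1, (u : ℂ)) ∈ Vis D 1)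
    (h₁r : ∀ u : ℝ, μ₁ ≤ u → u ≤ r 1 → (δ 1, (u : ℂ)) ∈ Vis D (-1)) :
    jump g (δ 0, (μ₀ : ℂ)) = jump g (δ 1, (l 1 : ℂ)) * (jump g (δ 1, (μ₁ : ℂ)))⁻¹ *
      jump g (δ 1, (r 1 : ℂ)) := by
  have hp := hg 1 (by norm_num)
  have hm := hg (-1) (by norm_num)
  have key := hol_square ρ (f := chart)
    ⟨fun q : I × I => (δ q.1, ((l q.1 + (q.2 : ℝ) * (r q.1 - l q.1) : ℝ) : ℂ)), by fun_prop⟩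
    (fun q => (chart_mem_iff _).2 (hreal q.1 _
      (by nlinarith [hlr q.1, q.2.2.1, q.2.2.2]) (by nlinarith [hlr q.1, q.2.2.1, q.2.2.2])))
    (a := ⟨fun s => (δ s, (l s : ℂ)), by fun_prop⟩) (b := ⟨fun s => (δ s, (r s : ℂ)), by fun_prop⟩)
    (c := ⟨fun t : I => (δ 0, ((l 0 + (t : ℝ) * (r 0 - l 0) : ℝ) : ℂ)), by fun_prop⟩)
    (d := ⟨fun t : I => (δ 1, ((l 1 + (t : ℝ) * (r 1 - l 1) : ℝ) : ℂ)), by fun_prop⟩)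
    (fun t => by simp) (fun t => by simp) (fun t => rfl) (fun t => rfl)
  have side : ∀ (d : ℂ) (a b c : ℝ) (η : ℝ), η ^ 2 = 1 → a ≤ b → b ≤ c →
      (∀ u : ℝ, a ≤ u → u ≤ b → (d, (u : ℂ)) ∈ Vis D η) →
      (∀ u : ℝ, b ≤ u → u ≤ c → (d, (u : ℂ)) ∈ Vis D (-η)) →
      hol ρ (chart.comp ⟨fun t : I => (d, ((a + (t : ℝ) * (c - a) : ℝ) : ℂ)), by fun_prop⟩) =
      (g η (d, (a : ℂ)))⁻¹ * g η (d, (b : ℂ)) *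
        ((g (-η) (d, (b : ℂ)))⁻¹ * g (-η) (d, (c : ℂ))) := by
    intro d a b c η hη hab hbc h1 h2
    have hcont : ContractibleSpace (Icc a c) :=
      (convex_Icc a c).contractibleSpace ⟨a, le_rfl, hab.trans hbc⟩
    obtain ⟨k, hk⟩ := exists_isGauge ρ
      (chart.comp ⟨fun u : ℝ => (d, (u : ℂ)), by fun_prop⟩) (Icc a c) (fun _ => inferInstance)
      fun u hu => (chart_mem_iff _).2 <| by
        rcases le_total u b with h | h
        · exact Vis.mem_dom (h1 u hu.1 h)
        · exact Vis.mem_dom (h2 u h hu.2)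
    have seg : ∀ (e f : ℝ), e ≤ f → a ≤ e → f ≤ c → ∃ γ : C(I, ℝ), γ 0 = e ∧ γ 1 = f ∧
        (∀ t, e ≤ γ t ∧ γ t ≤ f) ∧ ∀ t, γ t = e + (t : ℝ) * (f - e) := by
      intro e f hef _ _
      refine ⟨⟨fun t => e + (t : ℝ) * (f - e), by fun_prop⟩, by simp, by simp, fun t => ?_,
        fun t => rfl⟩
      simp only [ContinuousMap.coe_mk]
      constructor <;> nlinarith [t.2.1, t.2.2]
    have cmp : ∀ (e f : ℝ) (ξ : ℝ), ξ ^ 2 = 1 → e ≤ f → a ≤ e → f ≤ c →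
        (∀ u : ℝ, e ≤ u → u ≤ f → (d, (u : ℂ)) ∈ Vis D ξ) →
        (k e)⁻¹ * k f = (g ξ (d, (e : ℂ)))⁻¹ * g ξ (d, (f : ℂ)) := by
      intro e f ξ hξ hef hae hfc hv
      obtain ⟨γ, h0, h1, h2, -⟩ := seg e f hef hae hfc
      have e1 := hk γ fun t => ⟨hae.trans (h2 t).1, (h2 t).2.trans hfc⟩
      have e2 := hg ξ hξ ((⟨fun u : ℝ => (d, (u : ℂ)), by fun_prop⟩ : C(ℝ, ℂ × ℂ)).comp γ)
        fun t => hv _ (h2 t).1 (h2 t).2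
      rw [← ContinuousMap.comp_assoc, e1] at e2
      simpa [h0, h1] using e2
    obtain ⟨γ, h0, h1', h2', h3⟩ := seg a c (hab.trans hbc) le_rfl le_rfl
    have e1 := hk γ h2'
    rw [h0, h1'] at e1
    rw [← cmp a b η hη hab le_rfl hbc h1, ← cmp b c (-η) (by rw [neg_sq, hη]) hbc hab le_rfl h2]
    have e2 : chart.comp ⟨fun t : I => (d, ((a + (t : ℝ) * (c - a) : ℝ) : ℂ)), by fun_prop⟩ =
        (chart.comp ⟨fun u : ℝ => (d, (u : ℂ)), by fun_prop⟩).comp γ := by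
      ext t
      simp [h3]
    rw [e2, e1]
    group
  rw [side _ _ μ₀ _ (-1) (by norm_num) hl₀ hr₀ h₀l (by simpa using h₀r),
    side _ _ μ₁ _ 1 (by norm_num) hl₁ hr₁ h₁l h₁r,
    hp ⟨fun s => (δ s, (r s : ℂ)), by fun_prop⟩ fun s => (hr s).mem_vis (hδ s) _,
    hm ⟨fun s => (δ s, (l s : ℂ)), by fun_prop⟩ fun s => (hl s).mem_vis (hδ s) _] at key
  simp only [neg_neg, ContinuousMap.coe_mk] at key
  simp only [jump]
  generalize g (-1) (δ 0, (l 0 : ℂ)) = a1 at *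
  generalize g (-1) (δ 0, (μ₀ : ℂ)) = a2 at *
  generalize g 1 (δ 0, (μ₀ : ℂ)) = a3 at *
  generalize g 1 (δ 0, (r 0 : ℂ)) = a4 at *
  have key' := congrArg (fun x => a1 * x * (g 1 (δ 1, (r 1 : ℂ)))⁻¹) key
  simp only [mul_assoc, mul_inv_cancel_left, mul_inv_cancel, mul_one,
    mul_inv_rev, inv_inv] at key' ⊢
  exact key'

end FirstSextic

namespace FirstSextic

open ProjPlane Holonomy Topology unitInterval Set

lemma norm_zeta_sq {d : ℂ} (hd : d ≠ 0) :
    ‖zeta d‖ ^ 2 = 9 + (24 * d.re + 16) / Complex.normSq d := by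
  have h2 : 0 < Complex.normSq d := Complex.normSq_pos.2 hd
  rw [Complex.sq_norm, Complex.normSq_apply, zeta_re, zeta_im]
  field_simp
  rw [Complex.normSq_apply]
  ring

lemma rt_sq_le_norm (d : ℂ) : rt d ^ 2 ≤ ‖zeta d‖ := by
  have := Complex.re_le_norm (zeta d)
  rw [rt_sq]; linarith

lemma re_le_rt_sq (d : ℂ) : (zeta d).re ≤ rt d ^ 2 := by
  have := Complex.re_le_norm (zeta d)
  rw [rt_sq]; linarith

lemma norm_zeta_le {d : ℂ} : ‖zeta d‖ ≤ 3 + 4 / ‖d‖ := by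
  refine (norm_add_le _ _).trans ?_
  simp

lemma rt_pos_of_im {d : ℂ} (h : d.im ≠ 0) : 0 < rt d := by
  refine (rt_nonneg d).lt_of_ne' fun h0 => ?_
  have h1 := rt_sq d
  have hd : d ≠ 0 := by rintro rfl; exact h rfl
  have h2 : 0 < Complex.normSq d := Complex.normSq_pos.2 hd
  rw [h0] at h1
  have h3 : ‖zeta d‖ ^ 2 = (zeta d).re ^ 2 := by
    rw [show ‖zeta d‖ = -(zeta d).re by linarith, neg_sq]
  rw [Complex.sq_norm, Complex.normSq_apply, zeta_im] at h3
  have h4 : (-4 * d.im / Complex.normSq d) ^ 2 = 0 := by nlinarith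
  rw [sq_eq_zero_iff, div_eq_zero_iff] at h4
  rcases h4 with h4 | h4
  · exact h (by linarith)
  · exact h2.ne' h4

lemma three_lt_rt_sq {d : ℂ} (h : 0 < d.re) : 3 < rt d ^ 2 := by
  have hd : d ≠ 0 := by rintro rfl; simp at h
  have h2 : 0 < Complex.normSq d := Complex.normSq_pos.2 hd
  refine lt_of_lt_of_le ?_ (re_le_rt_sq d)
  rw [zeta_re]
  have : 0 < 4 * d.re / Complex.normSq d := by positivity
  linarith

lemma rt_gt {d : ℂ} (h : 0 < d.re) : 1.73 < rt d := by
  have := three_lt_rt_sq h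
  nlinarith [rt_nonneg d]

lemma rt_sq_sub_ge {d : ℂ} (h : 0 < d.re) :
    rt (-d) ^ 2 + 4 * d.re / Complex.normSq d ≤ rt d ^ 2 := by
  have hd : d ≠ 0 := by rintro rfl; simp at h
  have h2 : 0 < Complex.normSq d := Complex.normSq_pos.2 hd
  have e1 := norm_zeta_sq hd
  have e2 := norm_zeta_sq (neg_ne_zero.2 hd)
  rw [Complex.normSq_neg, Complex.neg_re] at e2
  have h3 : ‖zeta (-d)‖ ≤ ‖zeta d‖ := by
    rw [← pow_le_pow_iff_left₀ (norm_nonneg _) (norm_nonneg _) two_ne_zero, e1, e2]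
    gcongr
    linarith
  rw [rt_sq, rt_sq, zeta_re, zeta_re, Complex.normSq_neg, Complex.neg_re]
  have : 4 * -d.re / Complex.normSq d = -(4 * d.re / Complex.normSq d) := by ring
  linarith

lemma rt_neg_lt {d : ℂ} (h : 0 < d.re) : rt (-d) < rt d := by
  have hd : d ≠ 0 := by rintro rfl; simp at h
  have h2 : 0 < Complex.normSq d := Complex.normSq_pos.2 hd
  have h1 := rt_sq_sub_ge h
  have : 0 < 4 * d.re / Complex.normSq d := by positivity
  nlinarith [rt_nonneg d, rt_nonneg (-d)]

lemma colL_le_colR (d : ℂ) : colL d ≤ colR d := by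
  have := rt_nonneg d
  unfold colL colR; linarith

lemma colL_lt_colR {d : ℂ} (h : 0 < d.re) : colL d < colR d := by
  have := rt_gt h
  unfold colL colR; linarith

lemma colR_neg_lt {d : ℂ} (h : 0 < d.re) : colR (-d) < colR d := by
  have := rt_neg_lt h
  simp only [colR, Complex.neg_re]; linarith

lemma colL_neg_lt_colR_neg {d : ℂ} (h : d.im ≠ 0) : colL (-d) < colR (-d) := by
  have := rt_pos_of_im (d := -d) (by simpa using h)
  unfold colL colR; linarith

lemma colL_lt_colR_neg {d : ℂ} (h : 0 < d.re) (h' : d.re ≤ 4 / 5) : colL d < colR (-d) := by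
  have := rt_gt h
  have := rt_nonneg (-d)
  simp only [colR, colL, Complex.neg_re]; linarith

lemma colL_lt_colL_neg {d : ℂ} (h : 0 < d.re) (h' : ‖d‖ < 1 / 2) : colL d < colL (-d) := by
  have hd : d ≠ 0 := by rintro rfl; simp at h
  have h0 : 0 < ‖d‖ := norm_pos_iff.2 hd
  have h1 := rt_sq_sub_ge h
  have h2 : rt d ^ 2 ≤ 3 + 4 / ‖d‖ := (rt_sq_le_norm d).trans norm_zeta_le
  have h3 := rt_neg_lt h
  have h4 := rt_nonneg (-d)
  rw [Complex.normSq_eq_norm_sq] at h1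
  set n := ‖d‖
  set p := rt d
  set q := rt (-d)
  set x := d.re
  have h5 : n ^ 2 * p < 1 := by
    have : n * p ^ 2 ≤ 3 * n + 4 := by
      calc n * p ^ 2 ≤ n * (3 + 4 / n) := by gcongr
        _ = 3 * n + 4 := by field_simp
    have h6 : n ^ 4 * p ^ 2 < 1 := by
      have : n ^ 3 ≤ 1 / 8 := by nlinarith
      calc n ^ 4 * p ^ 2 = n ^ 3 * (n * p ^ 2) := by ring
        _ ≤ 1 / 8 * (3 * n + 4) := by gcongr
        _ < 1 := by linarith
    nlinarith [sq_nonneg (n ^ 2 * p)]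
  have h7 : 4 * x / n ^ 2 ≤ (p - q) * (p + q) := by nlinarith
  have h8 : (p - q) * (p + q) ≤ (p - q) * (2 * p) := by nlinarith
  have h9 : 4 * x ≤ (p - q) * (2 * (n ^ 2 * p)) := by
    rw [div_le_iff₀ (by positivity)] at h7
    nlinarith [sq_nonneg n]
  have : 2 * x < p - q := by nlinarith
  simp only [colL, Complex.neg_re]
  linarith

lemma rt_lt_of_re {d : ℂ} (h : 3 / 2 ≤ d.re) : rt d < 2.4 := by
  have h1 : 3 / 2 ≤ ‖d‖ := h.trans (Complex.re_le_norm d)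
  have h2 : rt d ^ 2 ≤ 3 + 4 / ‖d‖ := (rt_sq_le_norm d).trans norm_zeta_le
  have h3 : 4 / ‖d‖ ≤ 4 / (3 / 2) := by gcongr
  norm_num at *
  nlinarith [rt_nonneg d]

lemma rt_neg_pos_of_re {d : ℂ} (h : 3 / 2 ≤ d.re) : 0 < rt (-d) := by
  have h1 := re_le_rt_sq (-d)
  have hd : d ≠ 0 := by rintro rfl; norm_num at h
  have h2 : 0 < Complex.normSq d := Complex.normSq_pos.2 hd
  rw [zeta_re, Complex.normSq_neg, Complex.neg_re] at h1
  have h3 : 4 * d.re / Complex.normSq d ≤ 8 / 3 := by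
    rw [div_le_iff₀ h2, Complex.normSq_apply]
    nlinarith [mul_self_nonneg d.im]
  have h4 : 4 * -d.re / Complex.normSq d = -(4 * d.re / Complex.normSq d) := by ring
  rw [h4] at h1
  have h5 := rt_nonneg (-d)
  by_contra! h6
  rw [le_antisymm h6 h5] at h1
  linarith

lemma colL_neg_lt_colL {d : ℂ} (h : 3 / 2 ≤ d.re) : colL (-d) < colL d := by
  have := rt_lt_of_re h
  have := rt_neg_pos_of_re h
  simp only [colL, Complex.neg_re]; norm_num at *; linarith

variable {x₁ : Compl} {K : Type*} [Group K] {ρ : FundamentalGroup Compl x₁ →* K}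

lemma ne_zero_of_re {d : ℂ} (h : d ∈ RH) : d ≠ 0 := by
  rintro rfl; simp at h

lemma RH_subset : RH ⊆ {0}ᶜ := fun _ h => ne_zero_of_re h

lemma exists_jump_of_chamber {R : C(I, P2) → K} {D : Set ℂ} {g : ℝ → ℂ × ℂ → K}
    (hg : ∀ ε : ℝ, ε ^ 2 = 1 → IsGauge R chart (Vis D ε) (g ε))
    {D' : Set ℂ} (hD' : D' ⊆ D) (hc : Convex ℝ D') {α β : ℂ → ℝ} (hα : ContinuousOn α D')
    (hβ : ContinuousOn β D') (hαβ : ∀ d ∈ D', α d < β d)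
    (hV : ∀ d ∈ D', ∀ u : ℝ, α d < u → u < β d → Clear d u) :
    ∃ k : K, ∀ d ∈ D', ∀ u : ℝ, α d < u → u < β d → jump g (d, (u : ℂ)) = k := by
  by_cases h : ∃ d ∈ D', ∃ u : ℝ, α d < u ∧ u < β d
  · obtain ⟨d, hd, u, h1, h2⟩ := h
    exact ⟨_, fun d' hd' u' h1' h2' =>
      jump_eq_of_chamber hg hD' hc hα hβ hαβ hV hd hd' h1 h2 h1' h2'⟩
  · push Not at h
    exact ⟨1, fun d hd u h1 h2 => absurd h2 (not_lt.2 (h d hd u h1))⟩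

lemma GaugeSystem.jump_right (G : GaugeSystem ρ) {d : ℂ} (hd : d ∈ RH) {u : ℝ} (h : colR d < u) :
    jump G.r (d, (u : ℂ)) = 1 := by
  let M := max (u - colR d) (‖d‖ + 3 + 4 / d.re + 1 - colR d) + 1
  have hu : u < colR d + M := by
    have := le_max_left (u - colR d) (‖d‖ + 3 + 4 / d.re + 1 - colR d)
    dsimp only [M]; linarith
  have hu' : ‖d‖ + 3 + 4 / d.re + 1 < colR d + M := by
    have := le_max_right (u - colR d) (‖d‖ + 3 + 4 / d.re + 1 - colR d)
    dsimp only [M]; linarith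
  have hu0 : 0 < M := by linarith
  have hb : colR d < max u (‖d‖ + 3 + 4 / d.re + 1) := h.trans_le (le_max_left _ _)
  have key := jump_eq_of_chamber G.isGauge_r Subset.rfl convex_RH (α := colR)
    (β := fun d => colR d + M) (continuousOn_colR.mono RH_subset)
    ((continuousOn_colR.mono RH_subset).add continuousOn_const) (fun d hd => by linarith)
    (fun d hd u h1 h2 => ⟨ne_zero_of_re hd, ⟨h1.ne', ((colL_lt_colR hd).trans h1).ne'⟩,
      ((colR_neg_lt hd).trans h1).ne', ((colL_le_colR _).trans_lt
        ((colR_neg_lt hd).trans h1)).ne'⟩) hd hd h hu hb (max_lt hu hu')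
  rw [← key, jump, mul_inv_eq_one]
  refine G.far _ _ hd ?_
  rw [Complex.ofReal_re]
  exact lt_of_lt_of_le (by linarith) (le_max_right _ _)

lemma GaugeSystem.jump_left (G : GaugeSystem ρ) : ∃ ω : K, ∀ d ∈ RH, ∀ u : ℝ, u < colL d →
    u < colL (-d) → jump G.r (d, (u : ℂ)) = ω := by
  let β : ℂ → ℝ := fun d => min (colL d) (colL (-d))
  have hβ : ContinuousOn β RH :=
    (continuousOn_colL.mono RH_subset).inf (continuousOn_colL_neg.mono RH_subset)
  have h1 : (1 : ℂ) ∈ RH := by simp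
  refine ⟨jump G.r (1, ((β 1 - 1 : ℝ) : ℂ)), fun d hd u hu hu' => ?_⟩
  have hu2 : u < β d := lt_min hu hu'
  refine jump_eq_of_chamber G.isGauge_r Subset.rfl convex_RH
    (α := fun d' => β d' - (β d - u + 2)) (β := β) (hβ.sub continuousOn_const) hβ
    (fun d hd => by linarith) (fun d hd u h1 h2 => ?_) h1 hd (by linarith) (by linarith)
    (by linarith) hu2
  have h3 := lt_min_iff.1 h2
  exact ⟨ne_zero_of_re hd, ⟨(h3.1.trans_le (colL_le_colR d)).ne, h3.1.ne⟩,
    (h3.2.trans_le (colL_le_colR _)).ne, h3.2.ne⟩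

lemma GaugeSystem.jump_outer (G : GaugeSystem ρ) : ∃ e : K, ∀ d ∈ RH, ∀ u : ℝ, colL d < u →
    colR (-d) < u → u < colR d → jump G.r (d, (u : ℂ)) = e := by
  obtain ⟨e, he⟩ := exists_jump_of_chamber G.isGauge_r Subset.rfl convex_RH
    (α := fun d => max (colL d) (colR (-d))) (β := colR)
    ((continuousOn_colL.mono RH_subset).sup (continuousOn_colR_neg.mono RH_subset))
    (continuousOn_colR.mono RH_subset)
    (fun d hd => max_lt (colL_lt_colR hd) (colR_neg_lt hd)) fun d hd u h1 h2 => by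
      have h3 := max_lt_iff.1 h1
      exact ⟨ne_zero_of_re hd, ⟨h2.ne, h3.1.ne'⟩, h3.2.ne', ((colL_le_colR _).trans_lt h3.2).ne'⟩
  exact ⟨e, fun d hd u h1 h2 h3 => he d hd u (max_lt h1 h2) h3⟩

lemma GaugeSystem.jump_middle (G : GaugeSystem ρ) {D : Set ℂ} (hc : Convex ℝ D) (hD : D ⊆ RH)
    (him : ∀ d ∈ D, d.im ≠ 0) (hre : ∀ d ∈ D, d.re ≤ 4 / 5) : ∃ m : K, ∀ d ∈ D, ∀ u : ℝ,
    colL d < u → colL (-d) < u → u < colR (-d) → jump G.r (d, (u : ℂ)) = m := by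
  have hD0 := hD.trans RH_subset
  obtain ⟨e, he⟩ := exists_jump_of_chamber G.isGauge_r hD hc
    (α := fun d => max (colL d) (colL (-d))) (β := fun d => colR (-d))
    ((continuousOn_colL.mono hD0).sup (continuousOn_colL_neg.mono hD0))
    (continuousOn_colR_neg.mono hD0)
    (fun d hd => max_lt (colL_lt_colR_neg (hD hd) (hre d hd)) (colL_neg_lt_colR_neg (him d hd)))
    fun d hd u h1 h2 => by
      have h3 := max_lt_iff.1 h1
      exact ⟨hD0 hd, ⟨(h2.trans (colR_neg_lt (hD hd))).ne, h3.1.ne'⟩, h2.ne, h3.2.ne'⟩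
  exact ⟨e, fun d hd u h1 h2 h3 => he d hd u (max_lt h1 h2) h3⟩

lemma GaugeSystem.jump_inner (G : GaugeSystem ρ) : ∃ t : K, ∀ d ∈ RH, ‖d‖ < 1 / 2 → ∀ u : ℝ,
    colL d < u → u < colL (-d) → jump G.r (d, (u : ℂ)) = t := by
  obtain ⟨e, he⟩ := exists_jump_of_chamber G.isGauge_r (D' := RH ∩ Metric.ball 0 (1 / 2))
    inter_subset_left (convex_RH.inter (convex_ball _ _))
    (α := colL) (β := fun d => colL (-d))
    (continuousOn_colL.mono (inter_subset_left.trans RH_subset))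
    (continuousOn_colL_neg.mono (inter_subset_left.trans RH_subset))
    (fun d hd => colL_lt_colL_neg hd.1 (by simpa using hd.2))
    fun d hd u h1 h2 => by
      have h3 := h2.trans_le (colL_le_colR _)
      exact ⟨ne_zero_of_re hd.1, ⟨(h3.trans (colR_neg_lt hd.1)).ne, h1.ne'⟩, h3.ne, h2.ne⟩
  exact ⟨e, fun d hd hd' u h1 h2 => he d ⟨hd, by simpa using hd'⟩ u h1 h2⟩

lemma GaugeSystem.jump_inner' (G : GaugeSystem ρ) : ∃ t : K, ∀ d : ℂ, 3 / 2 ≤ d.re → ∀ u : ℝ,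
    colL (-d) < u → u < colL d → u < colR (-d) → jump G.r (d, (u : ℂ)) = t := by
  have hD : {d : ℂ | 3 / 2 ≤ Complex.reCLM d} ⊆ RH := fun d hd =>
    lt_of_lt_of_le (by norm_num : (0 : ℝ) < 3 / 2) hd
  have hD0 := hD.trans RH_subset
  obtain ⟨e, he⟩ := exists_jump_of_chamber G.isGauge_r hD
    (convex_halfSpace_ge Complex.reCLM.isLinear _)
    (α := fun d => colL (-d)) (β := fun d => min (colL d) (colR (-d)))
    (continuousOn_colL_neg.mono hD0)
    ((continuousOn_colL.mono hD0).inf (continuousOn_colR_neg.mono hD0))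
    (fun d hd => lt_min (colL_neg_lt_colL hd) (by
      have := rt_neg_pos_of_re (d := d) hd
      unfold colL colR; linarith))
    fun d hd u h1 h2 => by
      have h3 := lt_min_iff.1 h2
      exact ⟨hD0 hd, ⟨(h3.1.trans_le (colL_le_colR _)).ne, h3.1.ne⟩, h3.2.ne, h1.ne'⟩
  exact ⟨e, fun d hd u h1 h2 h3 => he d hd u h1 (lt_min h2 h3)⟩

end FirstSextic

namespace FirstSextic

open ProjPlane Holonomy Topology unitInterval Set

lemma upAt_of_ne {d : ℂ} {u : ℝ} (h : u ≠ colR d ∧ u ≠ colL d) : UpAt d u := fun s hs hu => by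
  rcases re_eq_col hs with h' | h'
  · exact absurd (hu.symm.trans h') h.1
  · exact absurd (hu.symm.trans h') h.2

lemma downAt_of_ne {d : ℂ} {u : ℝ} (h : u ≠ colR d ∧ u ≠ colL d) : DownAt d u := fun s hs hu => by
  rcases re_eq_col hs with h' | h'
  · exact absurd (hu.symm.trans h') h.1
  · exact absurd (hu.symm.trans h') h.2

lemma mem_vis_one' {D : Set ℂ} {d e : ℂ} {u : ℝ} (hd : d ∈ D) (h0 : d ≠ 0) (he : d = e ∨ d = -e)
    (h1 : DownAt e u) (h2 : DownAt (-e) u) : (d, (u : ℂ)) ∈ Vis D 1 := by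
  rcases he with rfl | rfl
  · exact mem_vis_one hd h0 h1 h2
  · exact mem_vis_one hd h0 h2 (by rwa [neg_neg])

lemma mem_vis_neg_one' {D : Set ℂ} {d e : ℂ} {u : ℝ} (hd : d ∈ D) (h0 : d ≠ 0)
    (he : d = e ∨ d = -e) (h1 : UpAt e u) (h2 : UpAt (-e) u) : (d, (u : ℂ)) ∈ Vis D (-1) := by
  rcases he with rfl | rfl
  · exact mem_vis_neg_one hd h0 h1 h2
  · exact mem_vis_neg_one hd h0 h2 (by rwa [neg_neg])

lemma mem_dom_of_upAt {d e : ℂ} {u : ℝ} (h0 : d ≠ 0) (he : d = e ∨ d = -e)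
    (h1 : ∀ s : ℂ, (s - e) ^ 2 = zeta e → s.re = u → s.im ≠ 0)
    (h2 : ∀ s : ℂ, (s - -e) ^ 2 = zeta (-e) → s.re = u → s.im ≠ 0) : (d, (u : ℂ)) ∈ Dom := by
  refine mem_dom_iff.2 ⟨h0, fun h => ?_, fun h => ?_⟩
  · rcases he with rfl | rfl
    · exact h1 _ h (by simp) (by simp)
    · exact h2 _ h (by simp) (by simp)
  · rcases he with rfl | rfl
    · exact h2 _ h (by simp) (by simp)
    · rw [neg_neg] at h
      exact h1 _ h (by simp) (by simp)

section

variable {x₁ : Compl} {K : Type*} [Group K] {ρ : FundamentalGroup Compl x₁ →* K}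

/-- The crossing of a column of `η` with a column of `-η`. -/
lemma jump_crossing_neg {D : Set ℂ} {g : ℝ → ℂ × ℂ → K}
    (hg : ∀ ε : ℝ, ε ^ 2 = 1 → IsGauge (hol ρ) chart (Vis D ε) (g ε))
    (δ η : C(I, ℂ)) (l r : C(I, ℝ))
    (hδ : ∀ s, δ s ∈ D) (hη : ∀ s, δ s = η s ∨ δ s = -η s) (hlr : ∀ s, l s ≤ r s)
    (hup : ∀ s, ∀ u : ℝ, l s ≤ u → u ≤ r s → UpAt (η s) u)
    (hdn : ∀ s, ∀ u : ℝ, l s ≤ u → u ≤ r s → DownAt (-η s) u)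
    (hl : ∀ s, Clear (δ s) (l s)) (hr : ∀ s, Clear (δ s) (r s)) {μ₀ μ₁ : ℝ}
    (hl₀ : l 0 ≤ μ₀) (hr₀ : μ₀ ≤ r 0) (hl₁ : l 1 ≤ μ₁) (hr₁ : μ₁ ≤ r 1)
    (h₀l : ∀ u : ℝ, l 0 ≤ u → u ≤ μ₀ → u ≠ colR (-η 0) ∧ u ≠ colL (-η 0))
    (h₀r : ∀ u : ℝ, μ₀ ≤ u → u ≤ r 0 → u ≠ colR (η 0) ∧ u ≠ colL (η 0))
    (h₁l : ∀ u : ℝ, l 1 ≤ u → u ≤ μ₁ → u ≠ colR (η 1) ∧ u ≠ colL (η 1))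
    (h₁r : ∀ u : ℝ, μ₁ ≤ u → u ≤ r 1 → u ≠ colR (-η 1) ∧ u ≠ colL (-η 1)) :
    jump g (δ 0, (μ₀ : ℂ)) = jump g (δ 1, (l 1 : ℂ)) * (jump g (δ 1, (μ₁ : ℂ)))⁻¹ *
      jump g (δ 1, (r 1 : ℂ)) :=
  jump_crossing ρ hg δ l r hδ hlr
    (fun s u h1 h2 => mem_dom_of_upAt (hl s).1 (hη s)
      (fun z hz hu => (hup s u h1 h2 z hz hu).ne') fun z hz hu => (hdn s u h1 h2 z hz hu).ne)
    hl hr hl₀ hr₀ hl₁ hr₁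
    (fun u h1 h2 => mem_vis_neg_one' (hδ _) (hl 0).1 (hη 0) (hup 0 u h1 (h2.trans hr₀))
      (upAt_of_ne (h₀l u h1 h2)))
    (fun u h1 h2 => mem_vis_one' (hδ _) (hl 0).1 (hη 0) (downAt_of_ne (h₀r u h1 h2))
      (hdn 0 u (hl₀.trans h1) h2))
    (fun u h1 h2 => mem_vis_one' (hδ _) (hl 1).1 (hη 1) (downAt_of_ne (h₁l u h1 h2))
      (hdn 1 u h1 (h2.trans hr₁)))
    (fun u h1 h2 => mem_vis_neg_one' (hδ _) (hl 1).1 (hη 1) (hup 1 u (hl₁.trans h1) h2)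
      (upAt_of_ne (h₁r u h1 h2)))

lemma jump_const {D : Set ℂ} {R : C(I, P2) → K} {g : ℝ → ℂ × ℂ → K}
    (hg : ∀ ε : ℝ, ε ^ 2 = 1 → IsGauge R chart (Vis D ε) (g ε)) (δ : C(I, ℂ)) (l : C(I, ℝ))
    (hδ : ∀ s, δ s ∈ D) (hl : ∀ s, Clear (δ s) (l s)) :
    jump g (δ 1, (l 1 : ℂ)) = jump g (δ 0, (l 0 : ℂ)) :=
  jump_eq_of_path hg ⟨fun s => (δ s, (l s : ℂ)), by fun_prop⟩ hδ fun s => by simpa using hl s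

lemma GaugeSystem.jump_u (G : GaugeSystem ρ) {d : ℂ} (hd : d ∈ Q1) {u : ℝ} (h : Clear d u) :
    jump G.u (d, (u : ℂ)) = jump G.r (d, (u : ℂ)) := by
  have h' : Clear d (u : ℂ).re := h
  rw [jump, jump, G.q1 _ (by norm_num) _ (h'.mem_vis hd _),
    G.q1 _ (by norm_num) _ (h'.mem_vis hd _)]

lemma GaugeSystem.jump_u_neg (G : GaugeSystem ρ) {d : ℂ} (hd : d ∈ Q4) {u : ℝ} (h : Clear d u) :
    jump G.u (-d, (u : ℂ)) = G.c * jump G.r (d, (u : ℂ)) * G.c⁻¹ := by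
  have h' : Clear d (u : ℂ).re := h
  rw [jump, jump, G.q4 _ (by norm_num) _ _ (h'.mem_vis hd _),
    G.q4 _ (by norm_num) _ _ (h'.mem_vis hd _)]
  group

lemma Clear.neg {d : ℂ} {u : ℝ} (h : Clear d u) : Clear (-d) u :=
  ⟨neg_ne_zero.2 h.1, h.2.2, by rw [neg_neg]; exact h.2.1⟩

lemma GaugeSystem.jump_u' (G : GaugeSystem ρ) {d : ℂ} (hd : -d ∈ Q4) {u : ℝ} (h : Clear d u) :
    jump G.u (d, (u : ℂ)) = G.c * jump G.r (-d, (u : ℂ)) * G.c⁻¹ := by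
  have := G.jump_u_neg hd h.neg
  rwa [neg_neg] at this

/-- The estimates over a segment through `2 * i`. -/
lemma rt_near_two {d : ℂ} (hi : d.im = 2 ∨ d.im = -2) (hr : |d.re| ≤ 1 / 10) :
    1.7 ≤ rt d ∧ rt d ≤ 1.95 ∧ 2 < Complex.normSq d * rt d := by
  obtain ⟨h1, h2⟩ := abs_le.1 hr
  have hd : d ≠ 0 := by rintro rfl; norm_num at hi
  have hi2 : d.im * d.im = 4 := by rcases hi with h | h <;> rw [h] <;> norm_num
  have hN : Complex.normSq d = d.re * d.re + 4 := by rw [Complex.normSq_apply, hi2]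
  have hN1 : 4 ≤ Complex.normSq d := by nlinarith [mul_self_nonneg d.re]
  have hN2 : 0 < Complex.normSq d := by linarith
  have e1 := norm_zeta_sq hd
  have e2 := re_le_rt_sq d
  have e3 := rt_sq_le_norm d
  have e4 := rt_nonneg d
  rw [zeta_re] at e2
  have e5 : (24 * d.re + 16) / Complex.normSq d ≤ 5 := by
    rw [div_le_iff₀ hN2]; linarith
  have e6 : -0.1 ≤ 4 * d.re / Complex.normSq d := by
    rw [le_div_iff₀ hN2]; linarith
  have e7 : ‖zeta d‖ ≤ 3.75 := by nlinarith [norm_nonneg (zeta d)]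
  have e8 : 1.7 ≤ rt d := by nlinarith
  refine ⟨e8, by nlinarith, by nlinarith⟩

/-- The estimates over a segment through `i / 4`. -/
lemma rt_near_quarter {d : ℂ} (hi : d.im = 1 / 4 ∨ d.im = -(1 / 4)) (hr : |d.re| ≤ 1 / 100) :
    3 ≤ rt d ∧ rt d ≤ 4.1 ∧ Complex.normSq d * rt d < 2 := by
  obtain ⟨h1, h2⟩ := abs_le.1 hr
  have hd : d ≠ 0 := by rintro rfl; norm_num at hi
  have hi2 : d.im * d.im = 1 / 16 := by rcases hi with h | h <;> rw [h] <;> norm_num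
  have hN : Complex.normSq d = d.re * d.re + 1 / 16 := by rw [Complex.normSq_apply, hi2]
  have hN1 : 1 / 16 ≤ Complex.normSq d := by nlinarith [mul_self_nonneg d.re]
  have hN2 : 0 < Complex.normSq d := by linarith
  have hN3 : Complex.normSq d ≤ 0.0626 := by rw [hN]; nlinarith
  have e1 := norm_zeta_sq hd
  have e2 := rt_sq d
  have e3 := rt_sq_le_norm d
  have e4 := rt_nonneg d
  rw [zeta_re] at e2
  have e5 : (24 * d.re + 16) / Complex.normSq d ≤ 259.9 := by
    rw [div_le_iff₀ hN2]; linarith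
  have e5' : 251 ≤ (24 * d.re + 16) / Complex.normSq d := by
    rw [le_div_iff₀ hN2]; linarith
  have e6 : -0.64 ≤ 4 * d.re / Complex.normSq d := by
    rw [le_div_iff₀ hN2]; linarith
  have e7 : ‖zeta d‖ ≤ 16.5 := by nlinarith [norm_nonneg (zeta d)]
  have e7' : 16 ≤ ‖zeta d‖ := by nlinarith [norm_nonneg (zeta d)]
  have e8 : 3 ≤ rt d := by nlinarith
  have e9 : rt d ≤ 4.1 := by nlinarith
  refine ⟨e8, e9, by nlinarith⟩

end

end FirstSextic

namespace FirstSextic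

open ProjPlane Holonomy Topology unitInterval Set

variable {x₁ : Compl} {K : Type*} [Group K] {ρ : FundamentalGroup Compl x₁ →* K}

/-- The values of the jumps in the chambers. -/
structure JumpValues (G : GaugeSystem ρ) where
  /-- The jump to the left of all columns. -/
  ω : K
  /-- The jump across the rightmost column. -/
  e : K
  /-- The jump in the middle, over the first quadrant. -/
  m : K
  /-- The jump in the middle, over the fourth quadrant. -/
  m' : K
  /-- The jump across the leftmost column, close to the origin. -/
  t : K
  /-- The jump across the leftmost column, far from the origin. -/
  t' : K
  left : ∀ d ∈ RH, ∀ u : ℝ, u < colL d → u < colL (-d) → jump G.r (d, (u : ℂ)) = ω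
  outer : ∀ d ∈ RH, ∀ u : ℝ, colL d < u → colR (-d) < u → u < colR d → jump G.r (d, (u : ℂ)) = e
  middle : ∀ d ∈ Q1, d.re ≤ 4 / 5 → ∀ u : ℝ, colL d < u → colL (-d) < u → u < colR (-d) →
    jump G.r (d, (u : ℂ)) = m
  middle' : ∀ d ∈ Q4, d.re ≤ 4 / 5 → ∀ u : ℝ, colL d < u → colL (-d) < u → u < colR (-d) →
    jump G.r (d, (u : ℂ)) = m'
  inner : ∀ d ∈ RH, ‖d‖ < 1 / 2 → ∀ u : ℝ, colL d < u → u < colL (-d) →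
    jump G.r (d, (u : ℂ)) = t
  inner' : ∀ d : ℂ, 3 / 2 ≤ d.re → ∀ u : ℝ, colL (-d) < u → u < colL d → u < colR (-d) →
    jump G.r (d, (u : ℂ)) = t'

lemma nonempty_jumpValues (G : GaugeSystem ρ) : Nonempty (JumpValues G) := by
  obtain ⟨ω, hω⟩ := G.jump_left
  obtain ⟨e, he⟩ := G.jump_outer
  have hc : Convex ℝ {d : ℂ | Complex.reCLM d ≤ 4 / 5} :=
    convex_halfSpace_le Complex.reCLM.isLinear _
  obtain ⟨m, hm⟩ := G.jump_middle (convex_Q1.inter hc) (fun d hd => hd.1.1)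
    (fun d hd => hd.1.2.ne') fun d hd => hd.2
  obtain ⟨m', hm'⟩ := G.jump_middle (convex_Q4.inter hc) (fun d hd => hd.1.1)
    (fun d hd => ne_of_lt hd.1.2) fun d hd => hd.2
  obtain ⟨t, ht⟩ := G.jump_inner
  obtain ⟨t', ht'⟩ := G.jump_inner'
  exact ⟨⟨ω, e, m, m', t, t', hω, he, fun d h1 h2 => hm d ⟨h1, h2⟩, fun d h1 h2 => hm' d ⟨h1, h2⟩,
    ht, ht'⟩⟩

variable {G : GaugeSystem ρ}

/-- The segment through `b i` traversed from the left to the right. -/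
def horizontal (w b : ℝ) : C(I, ℂ) :=
  ⟨fun s => ⟨(2 * (s : ℝ) - 1) * w, b⟩, by
    have : (fun s : I => (⟨(2 * (s : ℝ) - 1) * w, b⟩ : ℂ)) =
        fun s : I => (((2 * (s : ℝ) - 1) * w : ℝ) : ℂ) + (b : ℂ) * Complex.I := by
      funext s
      apply Complex.ext <;> simp
    rw [this]
    fun_prop⟩

@[simp] lemma horizontal_im (w b : ℝ) (s : I) : (horizontal w b s).im = b := rfl

lemma horizontal_re (w b : ℝ) (s : I) : (horizontal w b s).re = (2 * (s : ℝ) - 1) * w := rfl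

lemma abs_horizontal_re (w b : ℝ) (s : I) : |(horizontal w b s).re| ≤ |w| := by
  rw [horizontal_re, abs_mul]
  refine mul_le_of_le_one_left (abs_nonneg w) (abs_le.2 ⟨?_, ?_⟩) <;> linarith [s.2.1, s.2.2]

lemma JumpValues.crossing_far (J : JumpValues G) :
    G.c * J.e * G.c⁻¹ = J.m * J.e⁻¹ ∧ G.c * J.m' * G.c⁻¹ = J.m := by
  let δ := horizontal (1 / 10) 2
  have hre : ∀ s, |(δ s).re| ≤ 1 / 10 := fun s => (abs_horizontal_re _ _ s).trans
    (by norm_num [abs_of_pos])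
  have h1 : ∀ s, 1.7 ≤ rt (δ s) ∧ rt (δ s) ≤ 1.95 ∧ 2 < Complex.normSq (δ s) * rt (δ s) :=
    fun s => rt_near_two (Or.inl rfl) (hre s)
  have h2 : ∀ s, 1.7 ≤ rt (-δ s) ∧ rt (-δ s) ≤ 1.95 ∧ 2 < Complex.normSq (-δ s) * rt (-δ s) :=
    fun s => rt_near_two (Or.inr (by simp [δ])) (by rw [Complex.neg_re, abs_neg]; exact hre s)
  have h0 : ∀ s, δ s ≠ 0 := fun s h => by
    have := congrArg Complex.im h; norm_num [δ] at this
  have b1 : ∀ s, 1.6 ≤ colR (δ s) ∧ colR (δ s) ≤ 2.05 ∧ colL (δ s) ≤ -1.6 := fun s => by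
    have h3 := abs_le.1 (hre s)
    have h4 := h1 s
    unfold colR colL
    refine ⟨?_, ?_, ?_⟩ <;> linarith
  have b2 : ∀ s, 1.6 ≤ colR (-δ s) ∧ colR (-δ s) ≤ 2.05 ∧ colL (-δ s) ≤ -1.6 := fun s => by
    have h3 := abs_le.1 (hre s)
    have h4 := h2 s
    unfold colR colL
    rw [Complex.neg_re]
    refine ⟨?_, ?_, ?_⟩ <;> linarith
  have cl : ∀ s (u : ℝ), (u = 0 ∨ u = 10) → Clear (δ s) u := fun s u hu => by
    obtain ⟨p1, p2, p3⟩ := b1 s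
    obtain ⟨q1, q2, q3⟩ := b2 s
    refine ⟨h0 s, ⟨?_, ?_⟩, ?_, ?_⟩ <;> rcases hu with rfl | rfl <;> intro h <;> linarith
  have r0 : (δ 0).re = -(1 / 10) := by simp [δ, horizontal_re]
  have r1 : (δ 1).re = 1 / 10 := by simp [δ, horizontal_re]; norm_num
  have o0 : colR (δ 0) < colR (-δ 0) := by
    have := colR_neg_lt (d := -δ 0) (by rw [Complex.neg_re, r0]; norm_num)
    rwa [neg_neg] at this
  have o1 : colR (-δ 1) < colR (δ 1) := colR_neg_lt (by rw [r1]; norm_num)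
  have b10 := b1 0
  have b11 := b1 1
  have b20 := b2 0
  have b21 := b2 1
  have q4 : -δ 0 ∈ Q4 := by
    rw [mem_Q4, Complex.neg_re, Complex.neg_im, r0]; norm_num [δ]
  have q1 : δ 1 ∈ Q1 := by
    rw [mem_Q1, r1]; norm_num [δ]
  have key := jump_crossing_neg G.isGauge_u δ δ (ContinuousMap.const I 0) (ContinuousMap.const I 10)
    (fun s => by norm_num [δ]) (fun s => Or.inl rfl) (fun s => by simp)
    (fun s u _ _ => upAt_of (h0 s) (fun _ => by norm_num [δ]) fun _ => by
      have := (h1 s).2.2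
      have h3 : (δ s).im = 2 := rfl
      rw [h3]; linarith)
    (fun s u _ _ => downAt_of (neg_ne_zero.2 (h0 s)) (fun _ => by norm_num [δ]) fun _ => by
      have := (h2 s).2.2
      have h3 : (-δ s).im = -2 := rfl
      rw [h3]; linarith)
    (fun s => cl s _ (Or.inl rfl)) (fun s => cl s _ (Or.inr rfl))
    (μ₀ := (colR (δ 0) + colR (-δ 0)) / 2) (μ₁ := (colR (δ 1) + colR (-δ 1)) / 2)
    (by simp only [ContinuousMap.const_apply]; linarith)
    (by simp only [ContinuousMap.const_apply]; linarith)
    (by simp only [ContinuousMap.const_apply]; linarith)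
    (by simp only [ContinuousMap.const_apply]; linarith)
    (fun u hu hu' => by
      simp only [ContinuousMap.const_apply] at hu
      constructor <;> intro h <;> linarith)
    (fun u hu hu' => by
      constructor <;> intro h <;> linarith)
    (fun u hu hu' => by
      simp only [ContinuousMap.const_apply] at hu
      constructor <;> intro h <;> linarith)
    (fun u hu hu' => by
      constructor <;> intro h <;> linarith)
  have key2 := jump_const G.isGauge_u δ (ContinuousMap.const I 0) (fun s => by norm_num [δ])
    (fun s => cl s _ (Or.inl rfl))
  simp only [ContinuousMap.const_apply] at key key2
  have c0 : Clear (δ 0) ((colR (δ 0) + colR (-δ 0)) / 2) := by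
    refine ⟨h0 0, ⟨?_, ?_⟩, ?_, ?_⟩ <;> intro h <;> linarith
  have c1 : Clear (δ 1) ((colR (δ 1) + colR (-δ 1)) / 2) := by
    refine ⟨h0 1, ⟨?_, ?_⟩, ?_, ?_⟩ <;> intro h <;> linarith
  rw [G.jump_u' q4 (cl 0 0 (Or.inl rfl)), J.middle' _ q4 (by rw [Complex.neg_re, r0]; norm_num) 0
    (by linarith) (by rw [neg_neg]; linarith) (by rw [neg_neg]; linarith)] at key2
  have hm := J.middle _ q1 (by rw [r1]; norm_num) 0 (by linarith) (by linarith) (by linarith)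
  rw [G.jump_u q1 (cl 1 0 (Or.inl rfl)), hm] at key2
  rw [G.jump_u' q4 c0, G.jump_u q1 (cl 1 0 (Or.inl rfl)), hm, G.jump_u q1 c1,
    G.jump_u q1 (cl 1 10 (Or.inr rfl)), G.jump_right q1.1 (u := 10) (by linarith), mul_one,
    J.outer _ q1.1 _ (by linarith) (by linarith) (by linarith), J.outer _ q4.1 _ (by linarith)
    (by rw [neg_neg]; linarith) (by linarith)] at key
  exact ⟨key, key2.symm⟩


lemma JumpValues.crossing_near (J : JumpValues G) :
    J.e = G.c * J.m' * G.c⁻¹ * (G.c * J.e * G.c⁻¹)⁻¹ ∧ G.c * J.ω * G.c⁻¹ = J.ω ∧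
      J.t = G.c * J.ω * G.c⁻¹ * (G.c * J.t * G.c⁻¹)⁻¹ * (G.c * J.m' * G.c⁻¹) := by
  let δ := horizontal (-(1 / 100)) (1 / 4)
  have hre : ∀ s, |(δ s).re| ≤ 1 / 100 := fun s => (abs_horizontal_re _ _ s).trans
    (by rw [abs_neg, abs_of_pos (by norm_num)])
  have h1 : ∀ s, 3 ≤ rt (δ s) ∧ rt (δ s) ≤ 4.1 ∧ Complex.normSq (δ s) * rt (δ s) < 2 :=
    fun s => rt_near_quarter (Or.inl rfl) (hre s)
  have h2 : ∀ s, 3 ≤ rt (-δ s) ∧ rt (-δ s) ≤ 4.1 ∧ Complex.normSq (-δ s) * rt (-δ s) < 2 :=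
    fun s => rt_near_quarter (Or.inr (by simp [δ])) (by rw [Complex.neg_re, abs_neg]; exact hre s)
  have h0 : ∀ s, δ s ≠ 0 := fun s h => by
    have := congrArg Complex.im h; norm_num [δ] at this
  have i1 : ∀ s, (δ s).im = 1 / 4 := fun s => rfl
  have i2 : ∀ s, (-δ s).im = -(1 / 4) := fun s => rfl
  have hn : ∀ s, ‖δ s‖ < 1 / 2 := fun s => by
    refine (Complex.norm_le_abs_re_add_abs_im _).trans_lt ?_
    have := hre s
    rw [i1, abs_of_pos (by norm_num : (0 : ℝ) < 1 / 4)]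
    linarith
  have b1 : ∀ s, 2.9 ≤ colR (δ s) ∧ colR (δ s) ≤ 4.2 ∧ -4.2 ≤ colL (δ s) ∧ colL (δ s) ≤ -2.9 :=
    fun s => by
      have h3 := abs_le.1 (hre s)
      have h4 := h1 s
      unfold colR colL
      refine ⟨?_, ?_, ?_, ?_⟩ <;> linarith
  have b2 : ∀ s, 2.9 ≤ colR (-δ s) ∧ colR (-δ s) ≤ 4.2 ∧ -4.2 ≤ colL (-δ s) ∧
      colL (-δ s) ≤ -2.9 := fun s => by
    have h3 := abs_le.1 (hre s)
    have h4 := h2 s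
    unfold colR colL
    rw [Complex.neg_re]
    refine ⟨?_, ?_, ?_, ?_⟩ <;> linarith
  have cl : ∀ s (u : ℝ), (u = 0 ∨ u = 10 ∨ u = -10) → Clear (δ s) u := fun s u hu => by
    obtain ⟨p1, p2, p3, p4⟩ := b1 s
    obtain ⟨q1, q2, q3, q4⟩ := b2 s
    refine ⟨h0 s, ⟨?_, ?_⟩, ?_, ?_⟩ <;> rcases hu with rfl | rfl | rfl <;> intro h <;> linarith
  have cl0 := fun s => cl s 0 (Or.inl rfl)
  have cl1 := fun s => cl s 10 (Or.inr (Or.inl rfl))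
  have cl2 := fun s => cl s (-10) (Or.inr (Or.inr rfl))
  have r0 : (δ 0).re = 1 / 100 := by simp [δ, horizontal_re]
  have r1 : (δ 1).re = -(1 / 100) := by simp [δ, horizontal_re]; norm_num
  have q1 : δ 0 ∈ Q1 := by
    rw [mem_Q1, r0]; norm_num [δ]
  have q4 : -δ 1 ∈ Q4 := by
    rw [mem_Q4, Complex.neg_re, Complex.neg_im, r1]; norm_num [δ]
  have o0 : colR (-δ 0) < colR (δ 0) := colR_neg_lt q1.1
  have o1 : colR (δ 1) < colR (-δ 1) := by
    have := colR_neg_lt (d := -δ 1) q4.1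
    rwa [neg_neg] at this
  have w0 : colL (δ 0) < colL (-δ 0) := colL_lt_colL_neg q1.1 (hn 0)
  have w1 : colL (-δ 1) < colL (δ 1) := by
    have := colL_lt_colL_neg (d := -δ 1) q4.1 (by rw [norm_neg]; exact hn 1)
    rwa [neg_neg] at this
  have b10 := b1 0
  have b11 := b1 1
  have b20 := b2 0
  have b21 := b2 1
  have hU : ∀ s, δ s ∈ UH := fun s => by norm_num [δ]
  have key := jump_crossing_neg G.isGauge_u δ (-δ) (ContinuousMap.const I 0)
    (ContinuousMap.const I 10) hU (fun s => Or.inr (neg_neg _).symm) (fun s => by simp)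
    (fun s u hu _ => upAt_of (neg_ne_zero.2 (h0 s))
      (fun h => absurd h (by
        simp only [ContinuousMap.const_apply, ContinuousMap.neg_apply] at hu h ⊢
        have := (b2 s).2.2.2
        intro h; linarith)) fun _ => by
      have := (h2 s).2.2
      rw [ContinuousMap.neg_apply, i2]; linarith)
    (fun s u hu _ => by
      rw [ContinuousMap.neg_apply, neg_neg]
      exact downAt_of (h0 s) (fun h => absurd h (by
        simp only [ContinuousMap.const_apply] at hu
        have := (b1 s).2.2.2
        intro h; linarith)) fun _ => by
        have := (h1 s).2.2
        rw [i1]; linarith)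
    cl0 cl1
    (μ₀ := (colR (δ 0) + colR (-δ 0)) / 2) (μ₁ := (colR (δ 1) + colR (-δ 1)) / 2)
    (by simp only [ContinuousMap.const_apply]; linarith)
    (by simp only [ContinuousMap.const_apply]; linarith)
    (by simp only [ContinuousMap.const_apply]; linarith)
    (by simp only [ContinuousMap.const_apply]; linarith)
    (fun u hu hu' => by
      simp only [ContinuousMap.const_apply, ContinuousMap.neg_apply, neg_neg] at hu ⊢
      constructor <;> intro h <;> linarith)
    (fun u hu hu' => by
      simp only [ContinuousMap.neg_apply]
      constructor <;> intro h <;> linarith)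
    (fun u hu hu' => by
      simp only [ContinuousMap.const_apply, ContinuousMap.neg_apply] at hu ⊢
      constructor <;> intro h <;> linarith)
    (fun u hu hu' => by
      simp only [ContinuousMap.neg_apply, neg_neg]
      constructor <;> intro h <;> linarith)
  have key2 := jump_const G.isGauge_u δ (ContinuousMap.const I (-10)) hU cl2
  have key3 := jump_crossing_neg G.isGauge_u δ δ (ContinuousMap.const I (-10))
    (ContinuousMap.const I 0) hU (fun s => Or.inl rfl) (fun s => by simp)
    (fun s u _ hu => upAt_of (h0 s) (fun _ => by rw [i1]; norm_num) fun h => absurd h (by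
        simp only [ContinuousMap.const_apply] at hu
        have := (b1 s).1
        intro h; linarith))
    (fun s u _ hu => downAt_of (neg_ne_zero.2 (h0 s)) (fun _ => by rw [i2]; norm_num)
      fun h => absurd h (by
        simp only [ContinuousMap.const_apply] at hu
        have := (b2 s).1
        intro h; linarith))
    cl2 cl0
    (μ₀ := (colL (δ 0) + colL (-δ 0)) / 2) (μ₁ := (colL (δ 1) + colL (-δ 1)) / 2)
    (by simp only [ContinuousMap.const_apply]; linarith)
    (by simp only [ContinuousMap.const_apply]; linarith)
    (by simp only [ContinuousMap.const_apply]; linarith)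
    (by simp only [ContinuousMap.const_apply]; linarith)
    (fun u hu hu' => by constructor <;> intro h <;> linarith)
    (fun u hu hu' => by
      simp only [ContinuousMap.const_apply] at hu'
      constructor <;> intro h <;> linarith)
    (fun u hu hu' => by constructor <;> intro h <;> linarith)
    (fun u hu hu' => by
      simp only [ContinuousMap.const_apply] at hu'
      constructor <;> intro h <;> linarith)
  simp only [ContinuousMap.const_apply] at key key2 key3
  have c0 : Clear (δ 0) ((colR (δ 0) + colR (-δ 0)) / 2) := by
    refine ⟨h0 0, ⟨?_, ?_⟩, ?_, ?_⟩ <;> intro h <;> linarith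
  have c1 : Clear (δ 1) ((colR (δ 1) + colR (-δ 1)) / 2) := by
    refine ⟨h0 1, ⟨?_, ?_⟩, ?_, ?_⟩ <;> intro h <;> linarith
  have c2 : Clear (δ 0) ((colL (δ 0) + colL (-δ 0)) / 2) := by
    refine ⟨h0 0, ⟨?_, ?_⟩, ?_, ?_⟩ <;> intro h <;> linarith
  have c3 : Clear (δ 1) ((colL (δ 1) + colL (-δ 1)) / 2) := by
    refine ⟨h0 1, ⟨?_, ?_⟩, ?_, ?_⟩ <;> intro h <;> linarith
  have v1 : jump G.u (δ 1, ((0 : ℝ) : ℂ)) = G.c * J.m' * G.c⁻¹ := by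
    rw [G.jump_u' q4 (cl0 1), J.middle' _ q4 (by rw [Complex.neg_re, r1]; norm_num) 0
      (by linarith) (by rw [neg_neg]; linarith) (by rw [neg_neg]; linarith)]
  have v2 : jump G.u (δ 1, ((10 : ℝ) : ℂ)) = 1 := by
    rw [G.jump_u' q4 (cl1 1), G.jump_right q4.1 (u := 10) (by linarith), mul_one, mul_inv_cancel]
  have v3 : jump G.u (δ 1, ((-10 : ℝ) : ℂ)) = G.c * J.ω * G.c⁻¹ := by
    rw [G.jump_u' q4 (cl2 1), J.left _ q4.1 _ (by linarith) (by rw [neg_neg]; linarith)]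
  rw [v1, v2, mul_one, G.jump_u q1 c0, J.outer _ q1.1 _ (by linarith) (by linarith) (by linarith),
    G.jump_u' q4 c1, J.outer _ q4.1 _ (by linarith) (by rw [neg_neg]; linarith)
      (by linarith)] at key
  rw [v3, G.jump_u q1 (cl2 0), J.left _ q1.1 _ (by linarith) (by linarith)] at key2
  rw [v1, v3, G.jump_u q1 c2, J.inner _ q1.1 (hn 0) _ (by linarith) (by linarith),
    G.jump_u' q4 c3, J.inner _ q4.1 (by rw [norm_neg]; exact hn 1) _ (by linarith)
    (by rw [neg_neg]; linarith)] at key3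
  exact ⟨key, key2, key3⟩

end FirstSextic

namespace FirstSextic

open ProjPlane Holonomy Topology unitInterval Set

variable {x₁ : Compl} {K : Type*} [Group K] {ρ : FundamentalGroup Compl x₁ →* K}
  {G : GaugeSystem ρ}

/-- The estimates over a segment through `1 / 4`. -/
lemma estimates_quarter {d : ℂ} (hr : d.re = 1 / 4) (hi : |d.im| ≤ 1 / 100) :
    2.5 < rt d ∧ rt (-d) ≤ 1 / 8 ∧ Complex.normSq d * rt (-d) < 2 := by
  obtain ⟨h1, h2⟩ := abs_le.1 hi
  have hd : d ≠ 0 := by rintro rfl; norm_num at hr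
  have hN : Complex.normSq d = 1 / 16 + d.im * d.im := by rw [Complex.normSq_apply, hr]; norm_num
  have hN1 : 1 / 16 ≤ Complex.normSq d := by nlinarith [mul_self_nonneg d.im]
  have hN2 : 0 < Complex.normSq d := by linarith
  have hN3 : Complex.normSq d ≤ 0.0626 := by rw [hN]; nlinarith
  have e1 := norm_zeta_sq (neg_ne_zero.2 hd)
  have e2 := rt_sq (-d)
  have e3 := re_le_rt_sq d
  have e4 := rt_nonneg d
  have e4' := rt_nonneg (-d)
  rw [zeta_re, Complex.normSq_neg, Complex.neg_re, hr] at e2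
  rw [Complex.normSq_neg, Complex.neg_re, hr] at e1
  rw [zeta_re, hr] at e3
  have e5 : (24 * -(1 / 4) + 16) / Complex.normSq d ≤ 160 := by
    rw [div_le_iff₀ hN2]; linarith
  have e6 : 4 * -(1 / 4) / Complex.normSq d ≤ -15.97 := by
    rw [div_le_iff₀ hN2]; linarith
  have e7 : 15 ≤ 4 * (1 / 4) / Complex.normSq d := by
    rw [le_div_iff₀ hN2]; linarith
  have e8 : ‖zeta (-d)‖ ≤ 13 := by nlinarith [norm_nonneg (zeta (-d))]
  have e9 : rt (-d) ≤ 1 / 8 := by nlinarith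
  exact ⟨by nlinarith, e9, by nlinarith⟩

lemma JumpValues.crossing_quarter (J : JumpValues G) : J.m' = J.t * J.m⁻¹ * J.e := by
  let δ : C(I, ℂ) := ⟨fun s => (1 / 4 : ℂ) + (((2 * (s : ℝ) - 1) / 100 : ℝ) : ℂ) * Complex.I,
    by fun_prop⟩
  have hre : ∀ s, (δ s).re = 1 / 4 := fun s => by simp [δ]
  have him : ∀ s : I, (δ s).im = (2 * (s : ℝ) - 1) / 100 := fun s => by simp [δ]
  have him' : ∀ s : I, |(δ s).im| ≤ 1 / 100 := fun s => by
    rw [him, abs_le]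
    constructor <;> linarith [s.2.1, s.2.2]
  have i0 : (δ 0).im = -(1 / 100) := by rw [him]; norm_num
  have i1 : (δ 1).im = 1 / 100 := by rw [him]; norm_num
  have hest := fun s => estimates_quarter (hre s) (him' s)
  have hR : ∀ s, δ s ∈ RH := fun s => by rw [mem_RH, hre]; norm_num
  have h0 : ∀ s, δ s ≠ 0 := fun s => ne_zero_of_re (hR s)
  have hn : ∀ s, ‖δ s‖ < 1 / 2 := fun s => by
    refine (Complex.norm_le_abs_re_add_abs_im _).trans_lt ?_
    have := him' s
    rw [hre, abs_of_pos (by norm_num : (0 : ℝ) < 1 / 4)]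
    linarith
  have bR : ∀ s, 2.5 < colR (δ s) := fun s => by
    have := (hest s).1; unfold colR; rw [hre]; linarith
  have bL : ∀ s, colL (δ s) < -2.2 := fun s => by
    have := (hest s).1; unfold colL; rw [hre]; linarith
  have nR : ∀ s, -(1 / 4) ≤ colR (-δ s) ∧ colR (-δ s) ≤ -(1 / 8) := fun s => by
    have := (hest s).2.1
    have := rt_nonneg (-δ s)
    unfold colR; rw [Complex.neg_re, hre]; constructor <;> linarith
  have nL : ∀ s, -(3 / 8) ≤ colL (-δ s) ∧ colL (-δ s) ≤ -(1 / 4) := fun s => by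
    have := (hest s).2.1
    have := rt_nonneg (-δ s)
    unfold colL; rw [Complex.neg_re, hre]; constructor <;> linarith
  have sR : ∀ s, (δ s).im ≠ 0 → -(1 / 4) < colR (-δ s) ∧ colL (-δ s) < -(1 / 4) := fun s hs => by
    have : 0 < rt (-δ s) := rt_pos_of_im (by simpa using hs)
    unfold colR colL; rw [Complex.neg_re, hre]; constructor <;> linarith
  have cl : ∀ s (u : ℝ), (u = -2 ∨ u = 1) → Clear (δ s) u := fun s u hu => by
    have h1 := bR s
    have h2 := bL s
    have h3 := nR s
    have h4 := nL s
    refine ⟨h0 s, ⟨?_, ?_⟩, ?_, ?_⟩ <;> rcases hu with rfl | rfl <;> intro h <;> linarith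
  have free : ∀ s (u : ℝ), -2 ≤ u → u ≤ 1 → u ≠ colR (δ s) ∧ u ≠ colL (δ s) := fun s u h1 h2 => by
    have h3 := bR s
    have h4 := bL s
    constructor <;> intro h <;> linarith
  have key := jump_crossing ρ G.isGauge_r δ (ContinuousMap.const I (-2)) (ContinuousMap.const I 1)
    hR (fun s => by norm_num)
    (fun s u h1 h2 => by
      simp only [ContinuousMap.const_apply] at h1 h2
      refine mem_dom_iff.2 ⟨h0 s, fun h => ?_, fun h => ?_⟩
      · rcases re_eq_col h with h' | h'
        · exact (free s u h1 h2).1 (by simpa using h')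
        · exact (free s u h1 h2).2 (by simpa using h')
      · have h3 := im_relation (neg_ne_zero.2 (h0 s)) h
        have hN := Complex.normSq_pos.2 (neg_ne_zero.2 (h0 s))
        have hN2 : Complex.normSq (-δ s) ≤ 0.0626 := by
          rw [Complex.normSq_neg, Complex.normSq_apply, hre]
          nlinarith [abs_le.1 (him' s)]
        simp only [Complex.ofReal_re, Complex.ofReal_im, Complex.neg_re, Complex.neg_im, hre] at h3
        have h4 : (δ s).im * (Complex.normSq (-δ s) * (u + 1 / 4) - 2) = 0 := by linarith
        rcases mul_eq_zero.1 h4 with h5 | h5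
        · have h6 : δ s = ((1 / 4 : ℝ) : ℂ) := Complex.ext (by rw [hre]; simp) (by rw [h5]; simp)
          rw [h6] at h
          have h7 := congrArg Complex.re h
          simp [zeta, sq] at h7
          norm_num at h7
          nlinarith [mul_self_nonneg (u + 1 / 4)]
        · nlinarith)
    (fun s => cl s _ (Or.inl rfl)) (fun s => cl s _ (Or.inr rfl)) (μ₀ := -(1 / 4)) (μ₁ := -(1 / 4))
    (by norm_num) (by norm_num) (by norm_num) (by norm_num)
    (fun u h1 h2 => by
      simp only [ContinuousMap.const_apply] at h1
      refine mem_vis_neg_one (hR 0) (h0 0) (upAt_of_ne (free 0 u h1 (by linarith)))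
        (upAt_of (neg_ne_zero.2 (h0 0)) (fun _ => by rw [Complex.neg_im, i0]; norm_num)
          fun h => ?_)
      have := sR 0 (by rw [i0]; norm_num)
      linarith)
    (fun u h1 h2 => by
      simp only [ContinuousMap.const_apply] at h2
      refine mem_vis_one (hR 0) (h0 0) (downAt_of_ne (free 0 u (by linarith) h2))
        (downAt_of (neg_ne_zero.2 (h0 0)) (fun h => ?_) fun _ => ?_)
      · have := sR 0 (by rw [i0]; norm_num)
        linarith
      · have := (hest 0).2.2
        rw [Complex.neg_im, i0, Complex.normSq_neg]
        linarith)
    (fun u h1 h2 => by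
      simp only [ContinuousMap.const_apply] at h1
      refine mem_vis_one (hR 1) (h0 1) (downAt_of_ne (free 1 u h1 (by linarith)))
        (downAt_of (neg_ne_zero.2 (h0 1)) (fun _ => by rw [Complex.neg_im, i1]; norm_num)
          fun h => ?_)
      have := sR 1 (by rw [i1]; norm_num)
      linarith)
    (fun u h1 h2 => by
      simp only [ContinuousMap.const_apply] at h2
      refine mem_vis_neg_one (hR 1) (h0 1) (upAt_of_ne (free 1 u (by linarith) h2))
        (upAt_of (neg_ne_zero.2 (h0 1)) (fun h => ?_) fun _ => ?_)
      · have := sR 1 (by rw [i1]; norm_num)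
        linarith
      · have := (hest 1).2.2
        rw [Complex.neg_im, i1, Complex.normSq_neg]
        linarith)
  have hL0 := bL 0
  have hL1 := bL 1
  have hR1 := bR 1
  have n0 := nL 0
  have n1 := nL 1
  have m1 := nR 1
  have s0 := sR 0 (by rw [i0]; norm_num)
  have s1 := sR 1 (by rw [i1]; norm_num)
  simp only [ContinuousMap.const_apply] at key
  rw [J.middle' _ ⟨hR 0, by simpa only [mem_ofPred_eq, Complex.imCLM_apply, i0] using (by norm_num)⟩
      (by rw [hre]; norm_num) _ (by linarith) (by linarith) (by linarith),
    J.middle _ ⟨hR 1, by rw [mem_UH, i1]; norm_num⟩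
      (by rw [hre]; norm_num) (-(1 / 4)) (by linarith) (by linarith) (by linarith),
    J.inner _ (hR 1) (hn 1) _ (by linarith) (by linarith),
    J.outer _ (hR 1) _ (by linarith) (by linarith) (by linarith)] at key
  exact key

lemma JumpValues.crossing_ray (J : JumpValues G) : J.t = J.ω * J.t'⁻¹ * J.m := by
  let k : C(I, ℝ) := ⟨fun s => 1 / 20 + 31 / 20 * (s : ℝ), by fun_prop⟩
  let δ : C(I, ℂ) := ⟨fun s => (k s : ℂ) + ((6 * k s : ℝ) : ℂ) * Complex.I, by fun_prop⟩
  have hk : ∀ s, 1 / 20 ≤ k s ∧ k s ≤ 8 / 5 := fun s => by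
    simp only [k, ContinuousMap.coe_mk]
    constructor <;> linarith [s.2.1, s.2.2]
  have hre : ∀ s, (δ s).re = k s := fun s => by simp [δ]
  have him : ∀ s, (δ s).im = 6 * k s := fun s => by simp [δ]
  have hR : ∀ s, δ s ∈ RH := fun s => by rw [mem_RH, hre]; linarith [hk s]
  have h0 : ∀ s, δ s ≠ 0 := fun s => ne_zero_of_re (hR s)
  have k0 : k 0 = 1 / 20 := by simp [k]
  have k1 : k 1 = 8 / 5 := by simp [k]; norm_num
  have hWa : ∀ s, colL (δ s) < colR (-δ s) := fun s => by
    rcases le_total (k s) (4 / 5) with h | h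
    · exact colL_lt_colR_neg (hR s) (by rwa [hre])
    · have h1 := rt_gt (d := δ s) (hR s)
      have h2 := re_le_rt_sq (-δ s)
      have hN : Complex.normSq (δ s) = 37 * k s * k s := by
        rw [Complex.normSq_apply, hre, him]; ring
      have h3 : -(1 / 7) ≤ 4 * -k s / (37 * k s * k s) := by
        rw [le_div_iff₀ (by nlinarith)]; nlinarith
      rw [zeta_re, Complex.normSq_neg, Complex.neg_re, hre, hN] at h2
      have h4 : 1.6 < rt (-δ s) := by nlinarith [rt_nonneg (-δ s)]
      unfold colL colR
      rw [Complex.neg_re, hre]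
      linarith [(hk s).2]
  have hba : ∀ s, colL (-δ s) < colR (-δ s) := fun s =>
    colL_neg_lt_colR_neg (by rw [him]; linarith [hk s])
  have haE : ∀ s, colR (-δ s) < colR (δ s) := fun s => colR_neg_lt (hR s)
  have cc : ∀ {f : ℂ → ℝ}, ContinuousOn f {0}ᶜ → Continuous fun s => f (δ s) := fun hf =>
    hf.comp_continuous δ.continuous h0
  let l : C(I, ℝ) := ⟨fun s => min (colL (δ s)) (colL (-δ s)) - 1,
    ((cc continuousOn_colL).min (cc continuousOn_colL_neg)).sub continuous_const⟩
  let r : C(I, ℝ) := ⟨fun s => (max (colL (δ s)) (colL (-δ s)) + colR (-δ s)) / 2,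
    (((cc continuousOn_colL).max (cc continuousOn_colL_neg)).add
      (cc continuousOn_colR_neg)).div_const 2⟩
  have hl : ∀ s, l s < colL (δ s) ∧ l s < colL (-δ s) := fun s => by
    have h1 := min_le_left (colL (δ s)) (colL (-δ s))
    have h2 := min_le_right (colL (δ s)) (colL (-δ s))
    simp only [l, ContinuousMap.coe_mk]
    constructor <;> linarith
  have hr : ∀ s, colL (δ s) < r s ∧ colL (-δ s) < r s ∧ r s < colR (-δ s) := fun s => by
    have h1 := le_max_left (colL (δ s)) (colL (-δ s))
    have h2 := le_max_right (colL (δ s)) (colL (-δ s))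
    have h3 := max_lt (hWa s) (hba s)
    simp only [r, ContinuousMap.coe_mk]
    refine ⟨?_, ?_, ?_⟩ <;> linarith
  have cll : ∀ s, Clear (δ s) (l s) := fun s => by
    have h1 := hl s
    have h2 := hr s
    have h3 := haE s
    refine ⟨h0 s, ⟨?_, ?_⟩, ?_, ?_⟩ <;> intro h <;> linarith
  have clr : ∀ s, Clear (δ s) (r s) := fun s => by
    have h2 := hr s
    have h3 := haE s
    refine ⟨h0 s, ⟨?_, ?_⟩, ?_, ?_⟩ <;> intro h <;> linarith
  have w0 : colL (δ 0) < colL (-δ 0) := colL_lt_colL_neg (hR 0) (by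
    refine (Complex.norm_le_abs_re_add_abs_im _).trans_lt ?_
    rw [hre, him, k0, abs_of_pos, abs_of_pos] <;> norm_num)
  have n0 : ‖δ 0‖ < 1 / 2 := by
    refine (Complex.norm_le_abs_re_add_abs_im _).trans_lt ?_
    rw [hre, him, k0, abs_of_pos, abs_of_pos] <;> norm_num
  have w1 : colL (-δ 1) < colL (δ 1) := colL_neg_lt_colL (by rw [hre, k1]; norm_num)
  have hl0 := hl 0
  have hl1 := hl 1
  have hr0 := hr 0
  have hr1 := hr 1
  have e0 := haE 0
  have e1 := haE 1
  have key := jump_crossing_neg G.isGauge_r δ δ l r hR (fun s => Or.inl rfl)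
    (fun s => (hl s).1.le.trans (hr s).1.le)
    (fun s u _ hu => upAt_of (h0 s) (fun _ => by rw [him]; linarith [hk s]) fun h => by
      linarith [hr s, haE s])
    (fun s u _ hu => downAt_of (neg_ne_zero.2 (h0 s))
      (fun _ => by rw [Complex.neg_im, him]; linarith [hk s]) fun h => by
      linarith [hr s])
    cll clr (μ₀ := (colL (δ 0) + colL (-δ 0)) / 2) (μ₁ := (colL (δ 1) + colL (-δ 1)) / 2)
    (by linarith) (by linarith) (by linarith) (by linarith)
    (fun u _ hu => by constructor <;> intro h <;> linarith)
    (fun u hu hu' => by constructor <;> intro h <;> linarith)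
    (fun u _ hu => by constructor <;> intro h <;> linarith)
    (fun u hu hu' => by constructor <;> intro h <;> linarith)
  rw [jump_const G.isGauge_r δ r hR clr, J.middle _ ⟨hR 0, by rw [mem_UH, him, k0]; norm_num⟩
      (by rw [hre, k0]; norm_num) (r 0) (by linarith) (by linarith) (by linarith),
    J.inner _ (hR 0) n0 _ (by linarith) (by linarith),
    J.inner' _ (by rw [hre, k1]; norm_num) ((colL (δ 1) + colL (-δ 1)) / 2) (by linarith)
      (by linarith) (by linarith),
    J.left _ (hR 1) _ (by linarith) (by linarith)] at key
  exact key

end FirstSextic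

namespace FirstSextic

open ProjPlane Holonomy Topology unitInterval Set

/-- A parametrization of the line `π = 0` close to its point at infinity. -/
def lineChart : C(ℂ, P2) where
  toFun w := Projectivization.mk ℂ (vec 0 1 w) (vec_ne_zero (Or.inr one_ne_zero))
  continuous_toFun := continuous_proj.comp (Continuous.subtype_mk (continuous_vec.comp
    (f := fun w : ℂ => ((0 : ℂ), (1 : ℂ), w)) (by fun_prop))
    fun _ => vec_ne_zero (Or.inr one_ne_zero))

lemma chart_diag {s : ℂ} (hs : s ≠ 0) : chart (s, s) = lineChart s⁻¹ := by
  refine (Projectivization.mk_eq_mk_iff' ..).2 ⟨s, ?_⟩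
  rw [smul_vec, mul_inv_cancel₀ hs, mul_one, mul_zero]
  simp

lemma zeta_ne_neg_sq {d : ℂ} (hd : 2 < ‖d‖) (t : ℝ) : -((t : ℂ) ^ 2) ≠ zeta d := by
  intro h
  have h1 := congrArg Complex.re h
  have h2 : (4 / d).re ≥ -(4 / ‖d‖) := by
    have := Complex.abs_re_le_norm (4 / d)
    rw [norm_div, Complex.norm_ofNat] at this
    exact (abs_le.1 this).1
  have h3 : 4 / ‖d‖ ≤ 4 / 2 := by gcongr
  rw [zeta, Complex.add_re] at h1
  have h4 : (-((t : ℂ) ^ 2)).re = -t ^ 2 := by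
    rw [← Complex.ofReal_pow, ← Complex.ofReal_neg, Complex.ofReal_re]
  rw [h4] at h1
  norm_num at h1 h3
  nlinarith [sq_nonneg t]

lemma diag_mem_vis {D : Set ℂ} {ε : ℝ} {d s : ℂ} (hd : d ∈ D) (hds : d = s ∨ d = -s)
    (hs : 2 < ‖s‖) (h : ∀ t : ℝ, 0 ≤ t → 3 ≤ ‖2 * s + (ε * t : ℝ) * Complex.I‖) :
    (d, s) ∈ Vis D ε := by
  have h0 : s ≠ 0 := by rintro rfl; norm_num at hs
  have h1 : ∀ t : ℝ, (s + (ε * t : ℝ) * Complex.I - s) ^ 2 ≠ zeta s := fun t => by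
    have := zeta_ne_neg_sq hs (ε * t)
    rwa [add_sub_cancel_left, mul_pow, Complex.I_sq, mul_neg_one]
  have h2 : ∀ t : ℝ, 0 ≤ t → (s + (ε * t : ℝ) * Complex.I - -s) ^ 2 ≠ zeta (-s) := fun t ht h3 => by
    have h4 := congrArg norm h3
    rw [norm_pow, show s + (ε * t : ℝ) * Complex.I - -s = 2 * s + (ε * t : ℝ) * Complex.I by ring]
      at h4
    have h5 := norm_zeta_le (d := -s)
    have h6 := h t ht
    rw [norm_neg] at h5
    have h7 : 4 / ‖s‖ ≤ 4 / 2 := by gcongr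
    norm_num at h7
    nlinarith
  refine ⟨hd, fun t ht => mem_dom_iff.2 ?_⟩
  rcases hds with rfl | rfl
  · exact ⟨h0, h1 t, h2 t ht⟩
  · exact ⟨neg_ne_zero.2 h0, h2 t ht, by rw [neg_neg]; exact h1 t⟩

lemma lineChart_mem {w : ℂ} (hw : ‖w‖ < 1 / 2) : lineChart w ∈ Compl := by
  by_cases h0 : w = 0
  · refine (mk_mem _).2 ?_
    rw [h0]
    simp [sextic, conic]
    norm_num
  · have h1 : 2 < ‖w⁻¹‖ := by
      rw [norm_inv, lt_inv_comm₀ two_pos (norm_pos_iff.2 h0)]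
      linarith
    rw [← inv_inv w, ← chart_diag (inv_ne_zero h0), chart_mem_iff]
    refine Vis.mem_dom (diag_mem_vis (D := univ) (ε := 0) (mem_univ _) (Or.inl rfl) h1
      fun t _ => ?_)
    rw [zero_mul, Complex.ofReal_zero, zero_mul, add_zero, norm_mul, Complex.norm_ofNat]
    linarith

variable {x₁ : Compl} {K : Type*} [Group K] {ρ : FundamentalGroup Compl x₁ →* K}
  {G : GaugeSystem ρ}

lemma exists_isGauge_diag (ρ : FundamentalGroup Compl x₁ →* K) : ∃ H : ℂ → K,
    IsGauge (hol ρ) (chart.comp ⟨fun s : ℂ => (s, s), by fun_prop⟩) {s : ℂ | 2 < ‖s‖} H := by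
  have hc : ContractibleSpace (Metric.ball (0 : ℂ) (1 / 2)) :=
    (convex_ball _ _).contractibleSpace ⟨0, by simp⟩
  obtain ⟨h, hh⟩ := exists_isGauge ρ lineChart (Metric.ball (0 : ℂ) (1 / 2))
    (fun _ => inferInstance) fun w hw => lineChart_mem (by simpa using hw)
  refine ⟨fun s => h s⁻¹, fun γ hγ => ?_⟩
  have h0 : ∀ t, γ t ≠ 0 := fun t h => by
    have := hγ t
    rw [h] at this
    norm_num at this
  have key := hh ⟨fun t => (γ t)⁻¹, γ.continuous.inv₀ h0⟩ fun t => by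
    have : 2 < ‖γ t‖ := hγ t
    rw [mem_ball_zero_iff, ContinuousMap.coe_mk, norm_inv, inv_lt_comm₀ (by linarith) (by norm_num)]
    linarith
  have e : (chart.comp ⟨fun s : ℂ => (s, s), by fun_prop⟩).comp γ =
      lineChart.comp ⟨fun t => (γ t)⁻¹, γ.continuous.inv₀ h0⟩ := by
    ext t
    exact chart_diag (h0 t)
  rw [e, key]
  rfl

lemma eq_of_diag {H : ℂ → K}
    (hH : IsGauge (hol ρ) (chart.comp ⟨fun s : ℂ => (s, s), by fun_prop⟩) {s : ℂ | 2 < ‖s‖} H)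
    {D : Set ℂ} {ε : ℝ} {g : ℂ × ℂ → K} (hg : IsGauge (hol ρ) chart (Vis D ε) g) {κ : ℂ}
    (hκ : κ = 1 ∨ κ = -1) {S : Set ℂ} (hS : Convex ℝ S) (hSD : ∀ s ∈ S, κ * s ∈ D)
    (h2 : ∀ s ∈ S, 2 < ‖s‖)
    (h3 : ∀ s ∈ S, ∀ t : ℝ, 0 ≤ t → 3 ≤ ‖2 * s + (ε * t : ℝ) * Complex.I‖) {s s' : ℂ} (hs : s ∈ S)
    (hs' : s' ∈ S) : g (κ * s, s) * (H s)⁻¹ = g (κ * s', s') * (H s')⁻¹ := by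
  have h := hg.comp ⟨fun s : ℂ => (κ * s, s), by fun_prop⟩
  have e : chart.comp ⟨fun s : ℂ => (κ * s, s), by fun_prop⟩ =
      chart.comp ⟨fun s : ℂ => (s, s), by fun_prop⟩ := by
    ext s
    rcases hκ with rfl | rfl
    · simp
    · simpa using chart_neg s s
  rw [e] at h
  exact h.eq_of_isPathConnected hH (hS.isPathConnected ⟨s, hs⟩)
    (fun s hs => diag_mem_vis (hSD s hs) (by rcases hκ with rfl | rfl <;> simp) (h2 s hs) (h3 s hs))
    h2 hs hs'

lemma JumpValues.turning (J : JumpValues G) : J.t' = G.c * J.e * G.c := by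
  obtain ⟨H, hH⟩ := exists_isGauge_diag ρ
  have nre : ∀ s : ℂ, 3 ≤ |s.re| → 2 < ‖s‖ := fun s h => by
    linarith [Complex.abs_re_le_norm s]
  have nim : ∀ s : ℂ, 3 ≤ |s.im| → 2 < ‖s‖ := fun s h => by
    linarith [Complex.abs_im_le_norm s]
  have vre : ∀ (ε : ℝ) (s : ℂ), 3 ≤ |s.re| → ∀ t : ℝ, 0 ≤ t →
      3 ≤ ‖2 * s + (ε * t : ℝ) * Complex.I‖ := fun ε s h t _ => by
    refine le_trans ?_ (Complex.abs_re_le_norm _)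
    simp [abs_mul]
    linarith
  let p : ℂ := ⟨3, 3⟩
  let p' : ℂ := ⟨3, -3⟩
  let q : ℂ := ⟨-3, 3⟩
  let q' : ℂ := ⟨-3, -3⟩
  have hnp : -p' = q := by apply Complex.ext <;> simp [p', q]
  have hnq' : -q' = p := by apply Complex.ext <;> simp [q', p]
  have hnq : -q = p' := by apply Complex.ext <;> simp [q, p']
  have i1 := eq_of_diag hH (G.isGauge_u 1 (by norm_num)) (Or.inl rfl)
    (S := {s | 3 ≤ Complex.imCLM s}) (convex_halfSpace_ge Complex.imCLM.isLinear _)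
    (fun s (hs : 3 ≤ s.im) => by rw [one_mul, mem_UH]; linarith)
    (fun s (hs : 3 ≤ s.im) => nim s (hs.trans (le_abs_self _)))
    (fun s (hs : 3 ≤ s.im) t ht => by
      refine le_trans ?_ (Complex.im_le_norm _)
      simp
      linarith) (s := p) (s' := q) (by simp [p]) (by simp [q])
  have i2 := eq_of_diag hH (G.isGauge_u (-1) (by norm_num)) (Or.inr rfl)
    (S := {s | Complex.imCLM s ≤ -3}) (convex_halfSpace_le Complex.imCLM.isLinear _)
    (fun s (hs : s.im ≤ -3) => by rw [neg_one_mul, mem_UH, Complex.neg_im]; linarith)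
    (fun s (hs : s.im ≤ -3) => nim s ((by linarith : 3 ≤ -s.im).trans (neg_le_abs _)))
    (fun s (hs : s.im ≤ -3) t ht => by
      refine le_trans ?_ (Complex.abs_im_le_norm _)
      refine le_trans ?_ (neg_le_abs _)
      simp
      linarith) (s := p') (s' := q') (by simp [p']) (by simp [q'])
  have i3 := eq_of_diag hH (G.isGauge_r 1 (by norm_num)) (Or.inl rfl)
    (S := {s | 3 ≤ Complex.reCLM s}) (convex_halfSpace_ge Complex.reCLM.isLinear _)
    (fun s (hs : 3 ≤ s.re) => by rw [one_mul, mem_RH]; linarith)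
    (fun s (hs : 3 ≤ s.re) => nre s (hs.trans (le_abs_self _)))
    (fun s (hs : 3 ≤ s.re) => vre _ s (hs.trans (le_abs_self _)))
    (s := p) (s' := p') (by simp [p]) (by simp [p'])
  have i4 := eq_of_diag hH (G.isGauge_r 1 (by norm_num)) (Or.inr rfl)
    (S := {s | Complex.reCLM s ≤ -3}) (convex_halfSpace_le Complex.reCLM.isLinear _)
    (fun s (hs : s.re ≤ -3) => by rw [neg_one_mul, mem_RH, Complex.neg_re]; linarith)
    (fun s (hs : s.re ≤ -3) => nre s ((by linarith : 3 ≤ -s.re).trans (neg_le_abs _)))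
    (fun s (hs : s.re ≤ -3) => vre _ s ((by linarith : 3 ≤ -s.re).trans (neg_le_abs _)))
    (s := q) (s' := q') (by simp [q]) (by simp [q'])
  simp only [one_mul, neg_one_mul, hnp, hnq, hnq'] at i1 i2 i3 i4
  have u1 : G.u 1 (p, p) = G.r 1 (p, p) := G.q1 _ (by norm_num) _
    (diag_mem_vis (by simp [p]) (Or.inl rfl) (nre _ (by simp [p])) (vre _ _ (by simp [p])))
  have u2 : G.u 1 (q, q) = G.c * G.r 1 (p', q) := by
    rw [← G.q4 _ (by norm_num) p' q (diag_mem_vis (by simp [p']) (Or.inr hnq.symm)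
      (nre _ (by simp [q])) (vre _ _ (by simp [q]))), hnp]
  have u3 : G.u (-1) (q, p') = G.c * G.r (-1) (p', p') := by
    rw [← G.q4 _ (by norm_num) p' p' (diag_mem_vis (by simp [p']) (Or.inl rfl)
      (nre _ (by simp [p'])) (vre _ _ (by simp [p']))), hnp]
  have u4 : G.u (-1) (p, q') = G.r (-1) (p, q') := G.q1 _ (by norm_num) _
    (diag_mem_vis (by simp [p]) (Or.inr hnq'.symm) (nre _ (by simp [q'])) (vre _ _ (by simp [q'])))
  rw [u1, u2] at i1
  rw [u3, u4] at i2
  have hpR : p ∈ RH := by simp [p]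
  have hpR' : p' ∈ RH := by simp [p']
  have j1 : G.r (-1) (p', p') * (G.r 1 (p', p'))⁻¹ = J.e := by
    have h1 := rt_gt (d := p') hpR'
    have h2 := rt_lt_of_re (d := p') (by norm_num [p'])
    have h3 := rt_neg_lt (d := p') hpR'
    have o1 : colL p' < 3 := by simp only [colL, p'] at *; linarith
    have o2 : colR (-p') < 3 := by
      simp only [colR, p', Complex.neg_re] at *; norm_num at *; linarith
    have o3 : 3 < colR p' := by simp only [colR, p'] at *; linarith
    have hcl : Clear p' p'.re := ⟨ne_zero_of_re hpR', ⟨o3.ne, o1.ne'⟩, o2.ne',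
      ((colL_le_colR _).trans_lt o2).ne'⟩
    exact (jump_eq_re G.isGauge_r hpR' hcl).trans (J.outer _ hpR' _ o1 o2 o3)
  have j2 : G.r (-1) (p, q') * (G.r 1 (p, q'))⁻¹ = J.t' := by
    have h2 := rt_lt_of_re (d := p) (by norm_num [p])
    have h3 := rt_neg_pos_of_re (d := p) (by norm_num [p])
    have o1 : -3 < colL p := by simp only [colL, p] at *; norm_num at *; linarith
    have o2 : -3 < colR (-p) := by simp only [colR, p, Complex.neg_re] at *; linarith
    have o3 : colL (-p) < -3 := by simp only [colL, p, Complex.neg_re] at *; linarith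
    have hcl : Clear p q'.re := ⟨ne_zero_of_re hpR, ⟨(o1.trans_le (colL_le_colR _)).ne, o1.ne⟩,
      o2.ne, o3.ne'⟩
    exact (jump_eq_re G.isGauge_r hpR hcl).trans (J.inner' _ (by norm_num [p]) _ o3 o1 o2)
  rw [← j1, ← j2]
  have e1 : G.r 1 (p', p') = G.c * (G.r 1 (p', q) * (H q)⁻¹) * H p' := by
    rw [← mul_assoc, ← i1, i3]
    group
  have e2 : G.r (-1) (p, q') = G.c * G.r (-1) (p', p') * (H p')⁻¹ * H q' := by
    rw [i2]; group
  rw [e1, e2, i4]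
  group

end FirstSextic

namespace FirstSextic

open ProjPlane Holonomy Topology unitInterval Set

lemma commute_of_relations : ∀ c e : DihedralGroup 3,
    e * (c * e * c⁻¹) = c * e * c⁻¹ * e →
    c * (c⁻¹ * (c * e * c⁻¹ * e) * c * e⁻¹ * (c * e * c⁻¹ * e)) * c⁻¹ = c * e * c →
    c * e = e * c := by
  decide

section

variable {x₁ : Compl} {ρ : FundamentalGroup Compl x₁ →* DihedralGroup 3} {G : GaugeSystem ρ}

lemma JumpValues.commute (J : JumpValues G) : G.c * J.e = J.e * G.c := by
  obtain ⟨f1, f2⟩ := J.crossing_far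
  obtain ⟨n1, n2, n3⟩ := J.crossing_near
  have q := J.crossing_quarter
  have r := J.crossing_ray
  have u := J.turning
  have hm : J.m = G.c * J.e * G.c⁻¹ * J.e := by rw [f1]; group
  have hm' : J.m' = G.c⁻¹ * (G.c * J.e * G.c⁻¹ * J.e) * G.c := by rw [← hm, ← f2]; group
  have ht : J.t = G.c⁻¹ * (G.c * J.e * G.c⁻¹ * J.e) * G.c * J.e⁻¹ *
      (G.c * J.e * G.c⁻¹ * J.e) := by
    rw [← hm', ← hm, q]; group
  refine commute_of_relations _ _ ?_ ?_
  · rw [f2] at n1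
    rw [← hm]
    exact eq_mul_inv_iff_mul_eq.1 n1
  · rw [n2, f2, r] at n3
    have := mul_left_cancel (mul_right_cancel n3)
    rw [← ht, ← u]
    rw [← r] at this
    exact (inv_injective this).symm

end

variable {x₁ : Compl} {K : Type*} [Group K] {ρ : FundamentalGroup Compl x₁ →* K}
  {G : GaugeSystem ρ}

/-- The subgroup generated by the glueing constant and the jumps. -/
def JumpValues.group (J : JumpValues G) : Subgroup K := Subgroup.closure {G.c, J.e}

namespace JumpValues

variable (J : JumpValues G)

lemma c_mem : G.c ∈ J.group := Subgroup.subset_closure (by simp)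

lemma e_mem : J.e ∈ J.group := Subgroup.subset_closure (by simp)

lemma m_mem : J.m ∈ J.group := by
  have : J.m = G.c * J.e * G.c⁻¹ * J.e := by rw [J.crossing_far.1]; group
  rw [this]
  have h1 := J.c_mem
  have h2 := J.e_mem
  exact mul_mem (mul_mem (mul_mem h1 h2) (inv_mem h1)) h2

lemma t_mem : J.t ∈ J.group := by
  have h1 := J.c_mem
  have h2 := J.e_mem
  have h3 := J.m_mem
  have h4 : J.t = G.c⁻¹ * J.m * G.c * J.e⁻¹ * J.m := by
    have h5 : G.c⁻¹ * J.m * G.c = J.m' := by rw [← J.crossing_far.2]; group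
    rw [h5, J.crossing_quarter]; group
  rw [h4]
  exact mul_mem (mul_mem (mul_mem (mul_mem (inv_mem h1) h3) h1) (inv_mem h2)) h3

lemma ω_mem : J.ω ∈ J.group := by
  have h1 := J.c_mem
  have h2 := J.e_mem
  have h4 : J.ω = J.t * J.m⁻¹ * (G.c * J.e * G.c) := by
    rw [← J.turning, J.crossing_ray]; group
  rw [h4]
  exact mul_mem (mul_mem J.t_mem (inv_mem J.m_mem)) (mul_mem (mul_mem h1 h2) h1)

lemma group_commute (h : G.c * J.e = J.e * G.c) :
    ∀ a ∈ J.group, ∀ b ∈ J.group, a * b = b * a := by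
  have := Subgroup.isMulCommutative_closure (k := {G.c, J.e}) (by
    rintro x (rfl | rfl) y (rfl | rfl) <;> first | rfl | exact h | exact h.symm)
  intro a ha b hb
  exact congrArg Subtype.val (this.is_comm.comm ⟨a, ha⟩ ⟨b, hb⟩)

end JumpValues

end FirstSextic

namespace FirstSextic

open ProjPlane Holonomy Topology unitInterval Set

/-- The points of the base without collisions of punctures. -/
def Generic : Set ℂ := {d | d ^ 2 ≠ 0 ∧ d ^ 2 ≠ 16 / 9 ∧ d ^ 2 ≠ 2 ∧ d ^ 2 ≠ -1}

lemma exists_sq_eq (z : ℂ) : ∃ w : ℂ, w ^ 2 = z := IsAlgClosed.exists_pow_nat_eq z two_pos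

lemma finite_compl_generic : Generic.compl.Finite := by
  have key : ∀ z : ℂ, {d : ℂ | d ^ 2 = z}.Finite := by
    intro z
    obtain ⟨w, hw⟩ := exists_sq_eq z
    refine (({w, -w} : Set ℂ).toFinite).subset fun d (hd : d ^ 2 = z) => ?_
    rw [← hw] at hd
    exact sq_eq_sq_iff_eq_or_eq_neg.1 hd
  refine ((((key 0).union (key (16 / 9))).union (key 2)).union (key (-1))).subset fun d hd => ?_
  by_contra h
  simp only [mem_union, mem_ofPred_eq, not_or] at h
  exact hd ⟨h.1.1.1, h.1.1.2, h.1.2, h.2⟩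

lemma one_lt_rank : 1 < Module.rank ℝ ℂ := by
  rw [Complex.rank_real_complex]
  norm_num

lemma isPreconnected_range_inter {φ : ℂ → ℂ} (hφ : Continuous φ) (hinj : Function.Injective φ) :
    IsPreconnected (range φ ∩ Generic) := by
  have h := ((finite_compl_generic.preimage
    hinj.injOn).countable.isPathConnected_compl_of_one_lt_rank
    one_lt_rank).isConnected.isPreconnected.image φ hφ.continuousOn
  convert h using 1
  ext d
  constructor
  · rintro ⟨⟨z, rfl⟩, hg⟩
    exact ⟨z, fun h => h hg, rfl⟩
  · rintro ⟨z, hz, rfl⟩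
    exact ⟨⟨z, rfl⟩, by_contra fun h => hz h⟩

lemma isPreconnected_RH_inter : IsPreconnected (RH ∩ Generic) := by
  let φ : ℂ → ℂ := fun z => (Real.exp z.re : ℂ) + z.im * Complex.I
  have hφ : Continuous φ := by fun_prop
  have hre : ∀ z, (φ z).re = Real.exp z.re := fun z => by
    simp only [φ, Complex.add_re, Complex.ofReal_re]
    simp
  have him : ∀ z, (φ z).im = z.im := fun z => by
    simp only [φ, Complex.add_im, Complex.ofReal_im]
    simp
  convert isPreconnected_range_inter hφ fun z z' h => Complex.ext
    (Real.exp_injective (by rw [← hre, ← hre z', h])) (by rw [← him, ← him z', h]) using 2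
  ext d
  refine ⟨fun hd => ⟨⟨Real.log d.re, d.im⟩, Complex.ext ?_ ?_⟩, ?_⟩
  · rw [hre]; exact Real.exp_log hd
  · rw [him]
  · rintro ⟨z, rfl⟩
    rw [mem_RH, hre]
    exact Real.exp_pos _

lemma isPreconnected_UH_inter : IsPreconnected (UH ∩ Generic) := by
  let φ : ℂ → ℂ := fun z => (z.re : ℂ) + (Real.exp z.im : ℂ) * Complex.I
  have hφ : Continuous φ := by fun_prop
  have hre : ∀ z, (φ z).re = z.re := fun z => by
    simp only [φ, Complex.add_re, Complex.re_ofReal_mul]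
    simp
  have him : ∀ z, (φ z).im = Real.exp z.im := fun z => by
    simp only [φ, Complex.add_im, Complex.im_ofReal_mul]
    simp
  convert isPreconnected_range_inter hφ fun z z' h => Complex.ext
    (by rw [← hre, ← hre z', h]) (Real.exp_injective (by rw [← him, ← him z', h])) using 2
  ext d
  refine ⟨fun hd => ⟨⟨d.re, Real.log d.im⟩, Complex.ext ?_ ?_⟩, ?_⟩
  · rw [hre]
  · rw [him]; exact Real.exp_log hd
  · rintro ⟨z, rfl⟩
    rw [mem_UH, him]
    exact Real.exp_pos _

lemma isPathConnected_slice {p : Fin 4 → ℂ} {d : ℂ} (hp : ∀ s, (d, s) ∈ Dom ↔ ∀ i, s ≠ p i) :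
    IsPathConnected {s | (d, s) ∈ Dom} := by
  have h := (Set.finite_range p).countable.isPathConnected_compl_of_one_lt_rank one_lt_rank
  convert h using 1
  ext s
  simp only [mem_ofPred_eq, hp, mem_compl_iff, mem_range, not_exists, ne_comm, ne_eq]

lemma isOpen_vis_slice {p : Fin 4 → ℂ} {d : ℂ} (hp : ∀ s, (d, s) ∈ Dom ↔ ∀ i, s ≠ p i) {D : Set ℂ}
    (hd : d ∈ D) (ε : ℝ) (hε : ε ^ 2 = 1) : IsOpen {s | (d, s) ∈ Vis D ε} := by
  have : {s | (d, s) ∈ Vis D ε} = ⋂ i, {s | s.re = (p i).re ∧ ε * s.im ≤ ε * (p i).im}ᶜ := by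
    ext s
    simp only [Vis, mem_ofPred_eq, mem_iInter, mem_compl_iff, hd, true_and, hp]
    constructor
    · rintro h i ⟨h1, h2⟩
      refine h (ε * (p i).im - ε * s.im) (by linarith) i (Complex.ext ?_ ?_)
      · simp [h1]
      · simp
        linear_combination ((p i).im - s.im) * hε
    · rintro h t ht i h1
      refine h i ⟨?_, ?_⟩
      · simp [← h1]
      · simp [← h1]
        nlinarith
  rw [this]
  refine isOpen_iInter_of_finite fun i => isOpen_compl_iff.2 ?_
  exact (isClosed_eq Complex.continuous_re continuous_const).inter
    (isClosed_le (f := fun s : ℂ => ε * s.im) (by fun_prop) continuous_const)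

/-- Continuous parametrization of the punctures close to a generic point. -/
lemma exists_punctures {d₀ : ℂ} (hd₀ : d₀ ∈ Generic) : ∃ U : Set ℂ, IsOpen U ∧ d₀ ∈ U ∧
    ∃ p : Fin 4 → ℂ → ℂ, (∀ i, ContinuousOn (p i) U) ∧
      (∀ i j, i ≠ j → p i d₀ ≠ p j d₀) ∧
      ∀ d ∈ U, ∀ s, (d, s) ∈ Dom ↔ ∀ i, s ≠ p i d := by
  obtain ⟨g0, g1, g2, g3⟩ := hd₀
  have h0 : d₀ ≠ 0 := fun h => g0 (by simp [h])
  have hsqrt : ∀ κ : ℂ, κ ^ 2 = 1 → ∃ U : Set ℂ, IsOpen U ∧ d₀ ∈ U ∧ ∃ w : ℂ → ℂ, ContinuousOn w U ∧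
      w d₀ ≠ 0 ∧ ∀ d ∈ U, d ≠ 0 ∧ w d ^ 2 = zeta (κ * d) := by
    intro κ hκ
    have hκ0 : κ ≠ 0 := fun h => by simp [h] at hκ
    have hz0 : zeta (κ * d₀) ≠ 0 := by
      intro h
      apply g1
      rw [zeta] at h
      field_simp at h
      have : κ * d₀ = -4 / 3 := by linear_combination h / 3
      calc d₀ ^ 2 = (κ * d₀) ^ 2 := by rw [mul_pow, hκ, one_mul]
        _ = 16 / 9 := by rw [this]; norm_num
    obtain ⟨w₀, hw₀⟩ := exists_sq_eq (zeta (κ * d₀))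
    have hc : ContinuousOn (fun d => zeta (κ * d) / zeta (κ * d₀)) {0}ᶜ := by
      unfold zeta
      refine ContinuousOn.div_const (continuousOn_const.add (continuousOn_const.div (by fun_prop)
        fun d hd => mul_ne_zero hκ0 hd)) _
    refine ⟨_, hc.isOpen_inter_preimage isOpen_compl_singleton Complex.isOpen_slitPlane,
      ⟨h0, ?_⟩, fun d => w₀ * (zeta (κ * d) / zeta (κ * d₀)) ^ (1 / 2 : ℂ), ?_, ?_, ?_⟩
    · rw [mem_preimage, div_self hz0]
      exact Complex.one_mem_slitPlane
    · refine continuousOn_const.mul (ContinuousOn.cpow (hc.mono inter_subset_left)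
        continuousOn_const fun d hd => hd.2)
    · simp only [div_self hz0, Complex.one_cpow, mul_one]
      rintro rfl
      exact hz0 (by rw [← hw₀]; simp)
    · intro d hd
      refine ⟨hd.1, ?_⟩
      rw [mul_pow, hw₀, ← Complex.cpow_nat_mul]
      norm_num
      field_simp
  obtain ⟨U, hU, hdU, w, hw, hw0, hwz⟩ := hsqrt 1 (by norm_num)
  obtain ⟨U', hU', hdU', w', hw', hw0', hwz'⟩ := hsqrt (-1) (by norm_num)
  have hroot : ∀ d ∈ U ∩ U', ∀ s, (d, s) ∈ Dom ↔
      ∀ i, s ≠ ![d + w d, d + -w d, -d + w' d, -d + -w' d] i := by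
    intro d hd s
    have e1 := (hwz d hd.1).2
    have e2 := (hwz' d hd.2).2
    rw [one_mul] at e1
    rw [neg_one_mul] at e2
    rw [mem_dom_iff, ← e1, ← e2]
    simp only [Fin.forall_fin_succ, ne_eq, sq_eq_sq_iff_eq_or_eq_neg, not_or]
    simp only [sub_eq_iff_eq_add']
    simp [(hwz d hd.1).1, and_assoc]
  have hcross : ∀ s : ℂ, ¬ ((s - d₀) ^ 2 = zeta d₀ ∧ (s - -d₀) ^ 2 = zeta (-d₀)) := by
    rintro s ⟨h1, h2⟩
    simp only [zeta] at h1 h2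
    field_simp at h1 h2
    have h3 : s * d₀ ^ 2 = -2 := by
      linear_combination (h2 - h1) / 4
    have h4 : (d₀ ^ 2 + 1) * (d₀ ^ 2 - 2) ^ 2 = 0 := by
      linear_combination d₀ ^ 3 * h1 - (s * d₀ ^ 2 - 2 - 2 * d₀ ^ 3) * h3
    rcases mul_eq_zero.1 h4 with h | h
    · exact g3 (by linear_combination h)
    · exact g2 (by linear_combination pow_eq_zero_iff two_ne_zero |>.1 h)
  refine ⟨U ∩ U', hU.inter hU', ⟨hdU, hdU'⟩,
    fun i d => ![d + w d, d + -w d, -d + w' d, -d + -w' d] i, ?_, ?_, hroot⟩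
  · have h1 := hw.mono (inter_subset_left (t := U'))
    have h2 := hw'.mono (inter_subset_right (s := U))
    intro i
    fin_cases i
    · exact continuousOn_id.add h1
    · exact continuousOn_id.add h1.neg
    · exact continuousOn_id.neg.add h2
    · exact continuousOn_id.neg.add h2.neg
  · have e1 := (hwz d₀ hdU).2
    have e2 := (hwz' d₀ hdU').2
    rw [one_mul] at e1
    rw [neg_one_mul] at e2
    have hne : ∀ u v, u ^ 2 = w d₀ ^ 2 → v ^ 2 = w' d₀ ^ 2 → d₀ + u ≠ -d₀ + v := by
      intro u v hu hv h
      refine hcross (d₀ + u) ⟨by rw [← e1, ← hu]; ring, ?_⟩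
      rw [h, ← e2, ← hv]
      ring
    intro i j hij
    fin_cases i <;> fin_cases j <;> first
      | exact (hij rfl).elim
      | exact hne _ _ (by ring) (by ring)
      | exact (hne _ _ (by ring) (by ring)).symm
      | exact fun h => hw0 (self_eq_neg.1 (add_left_cancel h))
      | exact fun h => hw0 (neg_eq_self.1 (add_left_cancel h))
      | exact fun h => hw0' (self_eq_neg.1 (add_left_cancel h))
      | exact fun h => hw0' (neg_eq_self.1 (add_left_cancel h))

end FirstSextic

namespace FirstSextic

open ProjPlane Holonomy Topology unitInterval Set

/-- A piecewise linear cutoff function. -/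
def cutoff (x : ℝ) : ℝ := max 0 (min 1 (2 - x))

lemma abs_cutoff_le (x : ℝ) : |cutoff x| ≤ 1 := by
  rw [cutoff, abs_of_nonneg (le_max_left _ _)]
  exact max_le zero_le_one (min_le_left _ _)

lemma cutoff_of_le {x : ℝ} (h : x ≤ 1) : cutoff x = 1 := by
  rw [cutoff, min_eq_left (by linarith), max_eq_right zero_le_one]

lemma cutoff_of_ge {x : ℝ} (h : 2 ≤ x) : cutoff x = 0 := by
  rw [cutoff, min_eq_right (by linarith), max_eq_left (by linarith)]

lemma continuous_cutoff : Continuous cutoff := by unfold cutoff; fun_prop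

/-- Displacement of a point following the motion of the punctures from `p` to `p'`. -/
def shift (r : ℝ) (p p' : Fin 4 → ℂ) (z : ℂ) : ℂ :=
  z + ∑ i, (cutoff (‖z - p i‖ / r) : ℂ) * (p' i - p i)

lemma shift_self (r : ℝ) (p : Fin 4 → ℂ) (z : ℂ) : shift r p p z = z := by
  simp [shift]

lemma shift_of_far {r : ℝ} (hr : 0 < r) {p : Fin 4 → ℂ} (p' : Fin 4 → ℂ) {z : ℂ}
    (h : ∀ i, 2 * r ≤ ‖z - p i‖) : shift r p p' z = z := by
  rw [shift, Finset.sum_eq_zero, add_zero]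
  intro i _
  rw [cutoff_of_ge ((le_div_iff₀ hr).2 (h i)), Complex.ofReal_zero, zero_mul]

lemma shift_ne {r : ℝ} (hr : 0 < r) {p p' : Fin 4 → ℂ} (hsep : ∀ i j, i ≠ j → 4 * r ≤ ‖p i - p j‖)
    (hm : ∀ i, ‖p' i - p i‖ ≤ r / 8) {z : ℂ} (hz : ∀ i, z ≠ p i) (j : Fin 4) :
    shift r p p' z ≠ p' j := by
  intro h
  have h1 : ‖∑ i, (cutoff (‖z - p i‖ / r) : ℂ) * (p' i - p i)‖ ≤ r / 2 := by
    refine (norm_sum_le _ _).trans ?_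
    refine (Finset.sum_le_card_nsmul _ _ (r / 8) fun i _ => ?_).trans ?_
    · rw [norm_mul, Complex.norm_real, Real.norm_eq_abs]
      exact (mul_le_of_le_one_left (norm_nonneg _) (abs_cutoff_le _)).trans (hm i)
    · simp
      linarith
  have h2 : ‖z - p j‖ ≤ r := by
    have e : z - p j = (p' j - p j) - ∑ i, (cutoff (‖z - p i‖ / r) : ℂ) * (p' i - p i) := by
      rw [← h, shift]; ring
    rw [e]
    refine (norm_sub_le _ _).trans ?_
    linarith [hm j]
  rw [shift, Finset.sum_eq_single j, cutoff_of_le (div_le_one_of_le₀ h2 hr.le)] at h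
  · refine hz j ?_
    push_cast at h
    linear_combination h
  · intro i _ hij
    have h3 := norm_sub_le (p i - z) (p j - z)
    rw [sub_sub_sub_cancel_right, norm_sub_rev (p i) z, norm_sub_rev (p j) z] at h3
    rw [cutoff_of_ge ((le_div_iff₀ hr).2 (by linarith [hsep i j hij])), Complex.ofReal_zero,
      zero_mul]
  · simp

variable {x₁ : Compl} {K : Type*} [Group K] {ρ : FundamentalGroup Compl x₁ →* K}
  {A : Subgroup K} {D : Set ℂ} {g : ℂ × ℂ → K} {l : ℂ →L[ℝ] ℝ}

/-- A section over the part of the domain over `T` which is flat modulo `A` and compatible with a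
given gauge. -/
def IsFlat (ρ : FundamentalGroup Compl x₁ →* K) (A : Subgroup K) (D : Set ℂ) (g : ℂ × ℂ → K)
    (T : Set ℂ) (h : ℂ × ℂ → K) : Prop :=
  FlatOn (fun γ : C(I, ℂ × ℂ) => hol ρ (chart.comp γ)) A {q | q ∈ Dom ∧ q.1 ∈ T} h ∧
    ∀ q ∈ Vis D 1, q.1 ∈ T → h q * (g q)⁻¹ ∈ A

lemma IsFlat.mono {T T' : Set ℂ} {h : ℂ × ℂ → K} (hT : T ⊆ T') (hh : IsFlat ρ A D g T' h) :
    IsFlat ρ A D g T h :=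
  ⟨fun γ hγ => hh.1 γ fun t => ⟨(hγ t).1, hT (hγ t).2⟩, fun q hq hqT => hh.2 q hq (hT hqT)⟩

lemma exists_radius {d₀ : ℂ} (hd₀ : d₀ ∈ Generic) (hD : IsOpen D) (hd₀D : d₀ ∈ D) :
    ∃ U ⊆ D, IsOpen U ∧ d₀ ∈ U ∧ Convex ℝ U ∧ ∃ r > 0, ∃ p : ℂ → Fin 4 → ℂ, ContinuousOn p U ∧
      (∀ d ∈ U, ∀ i j, i ≠ j → 4 * r ≤ ‖p d i - p d j‖) ∧
      (∀ d ∈ U, ∀ d' ∈ U, ∀ i, ‖p d i - p d' i‖ ≤ r / 8) ∧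
      ∀ d ∈ U, ∀ s, (d, s) ∈ Dom ↔ ∀ i, s ≠ p d i := by
  obtain ⟨U, hU, hdU, p, hp, hne, hdom⟩ := exists_punctures hd₀
  obtain ⟨r, hr, hsep⟩ : ∃ r > 0, ∀ i j, i ≠ j → 5 * r ≤ ‖p i d₀ - p j d₀‖ := by
    have : ∀ k : Fin 4 × Fin 4, ∃ r > 0, k.1 ≠ k.2 → 5 * r ≤ ‖p k.1 d₀ - p k.2 d₀‖ := by
      intro k
      by_cases hk : k.1 = k.2
      · exact ⟨1, one_pos, fun h => (h hk).elim⟩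
      · exact ⟨‖p k.1 d₀ - p k.2 d₀‖ / 5, div_pos (norm_pos_iff.2 (sub_ne_zero.2 (hne _ _ hk)))
          (by norm_num), fun _ => by linarith⟩
    choose r hr hr' using this
    refine ⟨Finset.univ.inf' Finset.univ_nonempty r, (Finset.lt_inf'_iff _).2 fun k _ => hr k,
      fun i j hij => le_trans ?_ (hr' (i, j) hij)⟩
    have := Finset.inf'_le r (Finset.mem_univ (i, j))
    linarith
  have hev : ∀ᶠ d in 𝓝 d₀, d ∈ U ∩ D ∧ ∀ i, ‖p i d - p i d₀‖ < r / 16 := by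
    have hm : ∀ᶠ d in 𝓝 d₀, d ∈ U ∩ D := (hU.inter hD).mem_nhds ⟨hdU, hd₀D⟩
    refine hm.and (Filter.eventually_all.2 fun i => ?_)
    have := ((hp i).continuousAt (hU.mem_nhds hdU))
    filter_upwards [this (Metric.ball_mem_nhds _ (by positivity : 0 < r / 16))] with d hd
    simpa [dist_eq_norm] using hd
  obtain ⟨δ, hδ, hball⟩ := Metric.eventually_nhds_iff_ball.1 hev
  refine ⟨Metric.ball d₀ δ, fun d hd => (hball d hd).1.2, Metric.isOpen_ball,
    Metric.mem_ball_self hδ, convex_ball _ _, r, hr, fun d i => p i d,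
    continuousOn_pi.2 fun i => (hp i).mono fun d hd => (hball d hd).1.1, ?_, ?_,
    fun d hd => hdom d (hball d hd).1.1⟩
  · intro d hd i j hij
    have h1 := (hball d hd).2 i
    have h2 := (hball d hd).2 j
    have h3 := hsep i j hij
    have h4 := norm_add_le (p i d - p j d) ((p j d - p j d₀) - (p i d - p i d₀))
    have h5 := norm_sub_le (p j d - p j d₀) (p i d - p i d₀)
    rw [show p i d - p j d + ((p j d - p j d₀) - (p i d - p i d₀)) = p i d₀ - p j d₀ by ring] at h4
    linarith
  · intro d hd d' hd' i
    have h1 := (hball d hd).2 i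
    have h2 := (hball d' hd').2 i
    have h3 := norm_sub_le (p i d - p i d₀) (p i d' - p i d₀)
    rw [sub_sub_sub_cancel_right] at h3
    linarith

/-- Flat sections over a slice extend to neighbouring slices. -/
lemma exists_isFlat_nhds (hl : IsHeight l) (hlD : ∀ d ∈ D, 0 < l d) (hDo : IsOpen D)
    (hDc : Convex ℝ D) (hg : IsGauge (hol ρ) chart (Vis D 1) g) {d₀ : ℂ} (hd₀ : d₀ ∈ Generic)
    (hd₀D : d₀ ∈ D) : ∃ U : Set ℂ, IsOpen U ∧ d₀ ∈ U ∧
      ∀ d ∈ U, (∃ h, IsFlat ρ A D g {d} h) → ∃ h, IsFlat ρ A D g U h := by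
  obtain ⟨U, hUD, hU, hdU, hUc, r, hr, p, hp, hsep, hmove, hdom⟩ := exists_radius hd₀ hDo hd₀D
  refine ⟨U, hU, hdU, fun d hd ⟨h₀, hflat, hvis⟩ => ?_⟩
  let base : ℂ → I → ℂ := fun d' s => (1 - (s : ℂ)) * d' + s * d
  have hbase : ∀ d' ∈ U, ∀ s, base d' s ∈ segment ℝ d' d := fun d' _ s =>
    ⟨1 - s, s, sub_nonneg.2 s.2.2, s.2.1, by ring, by simp [base]⟩
  have hbU : ∀ d' ∈ U, ∀ s, base d' s ∈ U := fun d' hd' s =>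
    hUc.segment_subset hd' hd (hbase d' hd' s)
  let F : (ℂ × ℂ) × I → ℂ × ℂ := fun w =>
    (base w.1.1 w.2, shift r (p w.1.1) (p (base w.1.1 w.2)) w.1.2)
  have hFc : ContinuousOn F {w | w.1.1 ∈ U} := by
    have h1 : ContinuousOn (fun w : (ℂ × ℂ) × I => p w.1.1) {w | w.1.1 ∈ U} :=
      hp.comp (by fun_prop) fun w hw => hw
    have hb : Continuous fun w : (ℂ × ℂ) × I => base w.1.1 w.2 := by fun_prop
    have h2 : ContinuousOn (fun w : (ℂ × ℂ) × I => p (base w.1.1 w.2)) {w | w.1.1 ∈ U} :=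
      hp.comp hb.continuousOn fun w hw => hbU _ hw _
    refine hb.continuousOn.prodMk ?_
    unfold shift
    refine ContinuousOn.add (by fun_prop) (continuousOn_finsetSum _ fun i _ => ?_)
    have h1i := continuousOn_pi.1 h1 i
    have h2i := continuousOn_pi.1 h2 i
    have h3 := continuous_cutoff
    exact (Complex.continuous_ofReal.comp_continuousOn (continuous_cutoff.comp_continuousOn
      (((by fun_prop : Continuous fun w : (ℂ × ℂ) × I => w.1.2).continuousOn.sub h1i).norm.div_const
        r))).mul (h2i.sub h1i)
  have hF0 : ∀ q, F (q, 0) = q := fun q => by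
    simp only [F, base]
    ext <;> simp [shift_self]
  have hF1 : ∀ q, (F (q, 1)).1 = d := fun q => by simp [F, base]
  have hFD : ∀ q ∈ Dom, q.1 ∈ U → ∀ s, F (q, s) ∈ Dom := fun q hq hqU s => by
    refine (hdom _ (hbU _ hqU _) _).2 fun j => shift_ne hr (hsep _ hqU)
      (hmove _ (hbU _ hqU s) _ hqU) ((hdom _ hqU _).1 hq) j
  have htr : ∀ q : ℂ × ℂ, ∃ tr : C(I, ℂ × ℂ), q.1 ∈ U → ∀ s, tr s = F (q, s) := by
    intro q
    by_cases hq : q.1 ∈ U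
    · exact ⟨⟨fun s => F (q, s), hFc.comp_continuous (by fun_prop) fun _ => hq⟩, fun _ _ => rfl⟩
    · exact ⟨ContinuousMap.const _ 0, fun h => (hq h).elim⟩
  choose tr htr using htr
  let h : ℂ × ℂ → K := fun q => h₀ (F (q, 1)) * (hol ρ (chart.comp (tr q)))⁻¹
  have hflatU : FlatOn (fun γ : C(I, ℂ × ℂ) => hol ρ (chart.comp γ)) A
      {q | q ∈ Dom ∧ q.1 ∈ U} h := by
    intro γ hγ
    let Q : C(I × I, ℂ × ℂ) := ⟨fun w => F (γ w.1, w.2), hFc.comp_continuous (by fun_prop)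
      fun w => (hγ w.1).2⟩
    let b : C(I, ℂ × ℂ) := Q.comp ⟨fun t => (t, 1), by fun_prop⟩
    have key := hol_square ρ (f := chart) Q
      (fun w => (chart_mem_iff _).2 (hFD _ (hγ w.1).1 (hγ w.1).2 _)) (a := γ) (b := b)
      (c := tr (γ 0)) (d := tr (γ 1)) (fun t => (hF0 _).symm) (fun t => rfl)
      (fun t => htr _ (hγ 0).2 t) (fun t => htr _ (hγ 1).2 t)
    have h1 := hflat b fun t => ⟨hFD _ (hγ t).1 (hγ t).2 _, hF1 _⟩
    beta_reduce at h1 ⊢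
    have e : (hol ρ (chart.comp (tr (γ 0))))⁻¹ * hol ρ (chart.comp γ) *
        hol ρ (chart.comp (tr (γ 1))) = hol ρ (chart.comp b) := by
      rw [mul_assoc, ← key]; group
    rw [← e] at h1
    convert h1 using 1
    simp only [h, b, Q, ContinuousMap.comp_apply, ContinuousMap.coe_mk]
    group
  refine ⟨h, hflatU, fun q hq hqU => ?_⟩
  let B : ℝ := max (‖q.1‖ + 3 + 4 / l q.1) (‖d‖ + 3 + 4 / l d)
  have hB : ∀ s, ‖base q.1 s‖ + 3 + 4 / l (base q.1 s) ≤ B := fun s =>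
    ((convexOn_bound l).subset hlD hDc).le_max_of_mem_segment (hUD hqU) (hUD hd) (hbase _ hqU s)
  let T : ℝ := |B| + ‖q.2‖ + 2 * r + ∑ i, ‖p q.1 i‖ + 1
  have hS : 0 ≤ ∑ i, ‖p q.1 i‖ := Finset.sum_nonneg fun i _ => norm_nonneg _
  have hT : 0 ≤ T := by positivity
  let q' : ℂ × ℂ := (q.1, q.2 + (1 * T : ℝ) * Complex.I)
  have him : |B| + 2 * r + ∑ i, ‖p q.1 i‖ + 1 ≤ q'.2.im := by
    have := (abs_le.1 (Complex.abs_im_le_norm q.2)).1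
    simp [q', T]
    linarith
  have hfar : ∀ s, F (q', s) = (base q.1 s, q'.2) := fun s => by
    refine Prod.ext rfl (shift_of_far hr _ fun i => ?_)
    have h1 := Finset.single_le_sum (f := fun i => ‖p q.1 i‖) (fun i _ => norm_nonneg _)
      (Finset.mem_univ i)
    have h2 := Complex.im_le_norm q'.2
    have h3 := norm_sub_norm_le q'.2 (p q'.1 i)
    have h4 := abs_nonneg B
    change 2 * r ≤ ‖q'.2 - p q'.1 i‖
    change ‖p q'.1 i‖ ≤ _ at h1
    linarith
  have hfarV : ∀ s, F (q', s) ∈ Vis D 1 := fun s => by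
    rw [hfar]
    refine high_mem_vis hl hlD (by norm_num) (hUD (hbU _ hqU s)) ?_
    have := hB s
    have h4 := le_abs_self B
    linarith
  have e1 := hg (tr q') fun s => by rw [htr q' hqU]; exact hfarV s
  rw [htr q' hqU, htr q' hqU, hF0] at e1
  have h1 : h q' * (g q')⁻¹ ∈ A := by
    have := hvis _ (hfarV 1) (hF1 q')
    convert this using 1
    simp only [h, e1]
    group
  let v : C(I, ℂ × ℂ) := ⟨fun s => (q.1, q.2 + (1 * (s * T) : ℝ) * Complex.I), by fun_prop⟩
  have hv : ∀ s, v s ∈ Vis D 1 := fun s => Vis.push hq (mul_nonneg s.2.1 hT)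
  have e2 := hg v hv
  have hv0 : v 0 = q := by simp [v]
  have hv1 : v 1 = q' := by simp [v, q']
  have h2 := hflatU v fun s => ⟨Vis.mem_dom (hv s), hqU⟩
  beta_reduce at h2
  rw [e2, hv0, hv1] at h2
  convert A.mul_mem h2 h1 using 1
  group

end FirstSextic

namespace FirstSextic

open ProjPlane Holonomy Topology unitInterval Set

/-- The punctures of the slice over `d`. -/
def IsPuncture (d s : ℂ) : Prop := (s - d) ^ 2 = zeta d ∨ (s - -d) ^ 2 = zeta (-d)

lemma not_mem_dom_iff {d s : ℂ} (hd : d ≠ 0) : (d, s) ∉ Dom ↔ IsPuncture d s := by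
  rw [mem_dom_iff, IsPuncture]
  tauto

lemma eq_of_re_eq {d s s' : ℂ} (h : colL d < colR d) (hs : (s - d) ^ 2 = zeta d)
    (hs' : (s' - d) ^ 2 = zeta d) (hre : s.re = s'.re) : s = s' := by
  rcases sq_eq_sq_iff_eq_or_eq_neg.1 (hs.trans hs'.symm) with h1 | h1
  · linear_combination h1
  · have h2 := congrArg Complex.re h1
    simp only [Complex.sub_re, Complex.neg_re] at h2
    have h3 := re_eq_col hs
    have h4 : s.re = d.re := by linarith
    simp only [colL, colR] at h h3
    rcases h3 with h3 | h3 <;> linarith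

lemma puncture_unique {d s s' : ℂ} (h1 : colL d < colL (-d)) (h2 : colL (-d) < colR (-d))
    (h3 : colR (-d) < colR d) (hs : IsPuncture d s) (hs' : IsPuncture d s') (hre : s.re = s'.re) :
    s = s' := by
  have h4 : colL d < colR d := by linarith
  rcases hs with hs | hs <;> rcases hs' with hs' | hs'
  · exact eq_of_re_eq h4 hs hs' hre
  · rcases re_eq_col hs with h | h <;> rcases re_eq_col hs' with h' | h' <;> linarith
  · rcases re_eq_col hs with h | h <;> rcases re_eq_col hs' with h' | h' <;> linarith
  · exact eq_of_re_eq h2 hs hs' hre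

lemma exists_root_col (d : ℂ) : (∃ s, (s - d) ^ 2 = zeta d ∧ s.re = colR d) ∧
    ∃ s, (s - d) ^ 2 = zeta d ∧ s.re = colL d := by
  obtain ⟨w, hw⟩ := exists_sq_eq (zeta d)
  have h := re_sq_of_sq_eq hw
  rw [← rt_sq] at h
  rcases sq_eq_sq_iff_eq_or_eq_neg.1 h with h1 | h1
  · exact ⟨⟨d + w, by rw [← hw]; ring, by simp [h1, colR]⟩, ⟨d - w, by rw [← hw]; ring,
      by simp [h1, colL]⟩⟩
  · exact ⟨⟨d - w, by rw [← hw]; ring, by simp [h1, colR]⟩, ⟨d + w, by rw [← hw]; ring,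
      by simp [h1, colL, sub_eq_add_neg]⟩⟩

lemma clear_of_mem_vis {D : Set ℂ} {d z : ℂ} (h1 : (d, z) ∈ Vis D 1) (h2 : (d, z) ∈ Vis D (-1)) :
    Clear d z.re := by
  have hd : d ≠ 0 := (Vis.mem_dom h1).1
  have h : ∀ s : ℂ, IsPuncture d s → z.re ≠ s.re := by
    intro s hs hre
    have hs' := (not_mem_dom_iff hd).2 hs
    rcases le_total z.im s.im with h | h
    · have := h1.2 (s.im - z.im) (by linarith)
      rw [show z + (1 * (s.im - z.im) : ℝ) * Complex.I = s by apply Complex.ext <;> simp [hre]]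
        at this
      exact hs' this
    · have := h2.2 (z.im - s.im) (by linarith)
      rw [show z + (-1 * (z.im - s.im) : ℝ) * Complex.I = s by apply Complex.ext <;> simp [hre]]
        at this
      exact hs' this
  obtain ⟨⟨a, ha, ha'⟩, b, hb, hb'⟩ := exists_root_col d
  obtain ⟨⟨a', ha1, ha1'⟩, b', hb1, hb1'⟩ := exists_root_col (-d)
  exact ⟨hd, ⟨ha' ▸ h a (Or.inl ha), hb' ▸ h b (Or.inl hb)⟩, ha1' ▸ h a' (Or.inr ha1),
    hb1' ▸ h b' (Or.inr hb1)⟩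

variable {x₁ : Compl} {K : Type*} [Group K] {ρ : FundamentalGroup Compl x₁ →* K}

section

variable {A : Subgroup K} {D : Set ℂ} {g : ℂ × ℂ → K} {l : ℂ →L[ℝ] ℝ}

lemma mul_inv_mem_of_flat {d : ℂ} (hd : d ∈ Generic) {h h' : ℂ × ℂ → K}
    (hh : FlatOn (fun γ : C(I, ℂ × ℂ) => hol ρ (chart.comp γ)) A
      {q | q ∈ Dom ∧ q.1 ∈ ({d} : Set ℂ)} h)
    (hh' : FlatOn (fun γ : C(I, ℂ × ℂ) => hol ρ (chart.comp γ)) A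
      {q | q ∈ Dom ∧ q.1 ∈ ({d} : Set ℂ)} h')
    {z z' : ℂ} (hz : (d, z) ∈ Dom) (hz' : (d, z') ∈ Dom) (hA : h (d, z) * (h' (d, z))⁻¹ ∈ A) :
    h (d, z') * (h' (d, z'))⁻¹ ∈ A := by
  obtain ⟨U, -, hdU, p, -, -, hdom⟩ := exists_punctures hd
  obtain ⟨γ, hγ⟩ := (isPathConnected_slice (p := fun i => p i d) (hdom d hdU)).joinedIn z' hz' z hz
  let v : C(I, ℂ × ℂ) := ⟨fun t => (d, γ t), by fun_prop⟩
  have h1 := hh v fun t => ⟨hγ t, rfl⟩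
  have h2 := hh' v fun t => ⟨hγ t, rfl⟩
  have e0 : v 0 = (d, z') := by simp [v]
  have e1 : v 1 = (d, z) := by simp [v]
  beta_reduce at h1 h2
  rw [e0, e1] at h1 h2
  convert A.mul_mem (A.mul_mem h1 hA) (A.inv_mem h2) using 1
  group

lemma exists_mem_vis (hl : IsHeight l) (hlD : ∀ d ∈ D, 0 < l d) {d : ℂ} (hd : d ∈ D) :
    ∃ z, (d, z) ∈ Vis D 1 := by
  refine ⟨((‖d‖ + 3 + 4 / l d + 1 : ℝ) : ℂ) * Complex.I, high_mem_vis hl hlD (by norm_num) hd ?_⟩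
  rw [Complex.im_ofReal_mul, Complex.I_im]
  linarith

lemma exists_isFlat (hl : IsHeight l) (hlD : ∀ d ∈ D, 0 < l d) (hDo : IsOpen D)
    (hDc : Convex ℝ D) (hg : IsGauge (hol ρ) chart (Vis D 1) g) (hpc : IsPreconnected (D ∩ Generic))
    {d₀ : ℂ} (hd₀ : d₀ ∈ D ∩ Generic) (h₀ : ∃ h, IsFlat ρ A D g {d₀} h) :
    ∃ h, IsFlat ρ A D g (D ∩ Generic) h := by
  have hloc : ∀ d ∈ D ∩ Generic, ∃ U : Set ℂ, IsOpen U ∧ d ∈ U ∧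
      ∀ d ∈ U, (∃ h, IsFlat ρ A D g {d} h) → ∃ h, IsFlat ρ A D g U h :=
    fun d hd => exists_isFlat_nhds hl hlD hDo hDc hg hd.2 hd.1
  have hall : ∀ d ∈ D ∩ Generic, ∃ h, IsFlat ρ A D g {d} h := by
    intro d hd
    refine (IsPreconnected.induction₂ hpc
      (fun d d' => (∃ h, IsFlat ρ A D g {d} h) ↔ ∃ h, IsFlat ρ A D g {d'} h) ?_ ?_ ?_ hd₀ hd).1 h₀
    · intro d hd
      obtain ⟨U, hU, hdU, hUf⟩ := hloc d hd
      filter_upwards [mem_nhdsWithin_of_mem_nhds (hU.mem_nhds hdU)] with d' hd'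
      constructor <;> intro h
      · obtain ⟨h', hh'⟩ := hUf d hdU h
        exact ⟨h', hh'.mono (singleton_subset_iff.2 hd')⟩
      · obtain ⟨h', hh'⟩ := hUf d' hd' h
        exact ⟨h', hh'.mono (singleton_subset_iff.2 hdU)⟩
    · intro a b c _ _ _ h1 h2
      exact h1.trans h2
    · intro a b _ _ h
      exact h.symm
  choose! H hH using hall
  refine ⟨fun q => H q.1 q, ?_, fun q hq hqT => (hH q.1 hqT).2 q hq rfl⟩
  refine flatOn_of_local ρ chart (fun q hq => (chart_mem_iff q).2 hq.1) fun x hx => ?_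
  obtain ⟨U, hU, hxU, hUf⟩ := hloc x.1 hx.2
  obtain ⟨h, hh⟩ := hUf x.1 hxU ⟨_, hH x.1 hx.2⟩
  refine ⟨_, (hU.preimage continuous_fst).mem_nhds hxU, fun γ hγ hγU => ?_⟩
  have key : ∀ q : ℂ × ℂ, q ∈ Dom → q.1 ∈ D ∩ Generic → q.1 ∈ U → H q.1 q * (h q)⁻¹ ∈ A := by
    intro q hq hqD hqU
    obtain ⟨z, hz⟩ := exists_mem_vis hl hlD hqD.1
    refine mul_inv_mem_of_flat hqD.2 (hH q.1 hqD).1 (hh.mono (singleton_subset_iff.2 hqU)).1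
      (Vis.mem_dom hz) hq ?_
    convert A.mul_mem ((hH q.1 hqD).2 _ hz rfl) (A.inv_mem (hh.2 _ hz hqU)) using 1
    group
  have h1 := key (γ 0) (hγ 0).1 (hγ 0).2 (hγU 0)
  have h2 := key (γ 1) (hγ 1).1 (hγ 1).2 (hγU 1)
  have h3 := hh.1 γ fun t => ⟨(hγ t).1, hγU t⟩
  convert A.mul_mem (A.mul_mem h1 h3) (A.inv_mem h2) using 1
  group

end

/-- The point of the base where the monodromy is computed. -/
def baseDir : ℂ := ⟨1 / 4, 1 / 4⟩

lemma norm_baseDir_lt : ‖baseDir‖ < 1 / 2 := by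
  have : ‖baseDir‖ ^ 2 = 1 / 8 := by
    rw [Complex.sq_norm, Complex.normSq_apply]
    norm_num [baseDir]
  nlinarith [norm_nonneg baseDir]

lemma baseDir_mem_generic : baseDir ∈ Generic := by
  have h : (baseDir ^ 2).im = 1 / 8 := by
    rw [sq, Complex.mul_im]
    norm_num [baseDir]
  refine ⟨?_, ?_, ?_, ?_⟩ <;>
  · intro h0
    rw [h0] at h
    norm_num at h

variable {G : GaugeSystem ρ}

lemma JumpValues.jump_mem (J : JumpValues G) {d : ℂ} (hd : d ∈ Q1) (hre : d.re ≤ 4 / 5)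
    (hn : ‖d‖ < 1 / 2) {u : ℝ} (hu : Clear d u) : jump G.r (d, (u : ℂ)) ∈ J.group := by
  have hdR : d ∈ RH := hd.1
  have hc1 := colR_neg_lt (d := d) hd.1
  rcases lt_or_gt_of_ne hu.2.1.2 with h1 | h1
  · rw [J.left d hdR u h1 (h1.trans (colL_lt_colL_neg (d := d) hd.1 hn))]
    exact J.ω_mem
  rcases lt_or_gt_of_ne hu.2.2.2 with h2 | h2
  · rw [J.inner d hdR hn u h1 h2]
    exact J.t_mem
  rcases lt_or_gt_of_ne hu.2.2.1 with h3 | h3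
  · rw [J.middle d hd hre u h1 h2 h3]
    exact J.m_mem
  rcases lt_or_gt_of_ne hu.2.1.1 with h4 | h4
  · rw [J.outer d hdR u h1 h3 h4]
    exact J.e_mem
  · rw [G.jump_right hdR h4]
    exact one_mem _

lemma JumpValues.exists_isFlat_slice (J : JumpValues G) :
    ∃ h, IsFlat ρ J.group RH (G.r 1) {baseDir} h := by
  classical
  have hQ : baseDir ∈ Q1 := by norm_num [baseDir]
  have hR : baseDir ∈ RH := hQ.1
  have hre : baseDir.re ≤ 4 / 5 := by norm_num [baseDir]
  have him : baseDir.im ≠ 0 := by norm_num [baseDir]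
  have c1 := colL_lt_colL_neg (d := baseDir) hQ.1 norm_baseDir_lt
  have c2 := colL_neg_lt_colR_neg (d := baseDir) him
  have c3 := colR_neg_lt (d := baseDir) hQ.1
  have h0 : baseDir ≠ 0 := ne_zero_of_re hR
  obtain ⟨U, -, hdU, p, -, -, hdom⟩ := exists_punctures baseDir_mem_generic
  have hopen : ∀ ε : ℝ, ε ^ 2 = 1 → IsOpen {z | (baseDir, z) ∈ Vis RH ε} := fun ε hε =>
    isOpen_vis_slice (p := fun i => p i baseDir) (hdom _ hdU) hR ε hε
  have hcover : ∀ z, (baseDir, z) ∈ Dom → (baseDir, z) ∉ Vis RH 1 → (baseDir, z) ∈ Vis RH (-1) := by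
    intro z hz h1
    by_contra h2
    have h1' : ∃ t : ℝ, 0 ≤ t ∧ IsPuncture baseDir (z + (1 * t : ℝ) * Complex.I) := by
      by_contra! h
      exact h1 ⟨hR, fun t ht => by_contra fun h' => h t ht ((not_mem_dom_iff h0).1 h')⟩
    have h2' : ∃ t : ℝ, 0 ≤ t ∧ IsPuncture baseDir (z + (-1 * t : ℝ) * Complex.I) := by
      by_contra! h
      exact h2 ⟨hR, fun t ht => by_contra fun h' => h t ht ((not_mem_dom_iff h0).1 h')⟩
    obtain ⟨t, ht, hpt⟩ := h1'
    obtain ⟨t', ht', hpt'⟩ := h2'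
    have := puncture_unique c1 c2 c3 hpt hpt' (by simp)
    have h3 := congrArg Complex.im this
    simp at h3
    have h4 : t = 0 := by linarith
    rw [h4] at hpt
    refine (not_mem_dom_iff h0).2 hpt ?_
    simpa using hz
  let h : ℂ × ℂ → K := fun q => if q ∈ Vis RH 1 then G.r 1 q else G.r (-1) q
  refine ⟨h, ?_, fun q hq _ => ?_⟩
  swap
  · simp only [h, if_pos hq, mul_inv_cancel]
    exact one_mem _
  refine flatOn_of_local ρ chart (fun q hq => (chart_mem_iff q).2 hq.1) ?_
  rintro ⟨d, z⟩ ⟨hz, rfl : d = baseDir⟩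
  by_cases hzV : (baseDir, z) ∈ Vis RH 1
  · refine ⟨_, ((hopen 1 (by norm_num)).preimage continuous_snd).mem_nhds hzV, fun γ hγ hγU => ?_⟩
    have hγV : ∀ t, γ t ∈ Vis RH 1 := fun t => by
      have := hγU t
      rw [show γ t = (baseDir, (γ t).2) from Prod.ext (hγ t).2 rfl]
      exact this
    rw [G.isGauge_r 1 (by norm_num) γ hγV]
    simp only [h, if_pos (hγV _)]
    convert one_mem J.group using 1
    group
  · refine ⟨_, ((hopen (-1) (by norm_num)).preimage continuous_snd).mem_nhds (hcover z hz hzV),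
      fun γ hγ hγU => ?_⟩
    have hγV : ∀ t, γ t ∈ Vis RH (-1) := fun t => by
      have := hγU t
      rw [show γ t = (baseDir, (γ t).2) from Prod.ext (hγ t).2 rfl]
      exact this
    rw [G.isGauge_r (-1) (by norm_num) γ hγV]
    have key : ∀ t, G.r (-1) (γ t) * (h (γ t))⁻¹ ∈ J.group := by
      intro t
      by_cases ht : γ t ∈ Vis RH 1
      · simp only [h, if_pos ht]
        have e : γ t = (baseDir, (γ t).2) := Prod.ext (hγ t).2 rfl
        have hV := hγV t
        rw [e] at ht hV ⊢
        have hcl := clear_of_mem_vis ht hV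
        have := J.jump_mem hQ hre norm_baseDir_lt hcl
        rw [← jump_eq_re G.isGauge_r hR hcl] at this
        exact this
      · simp only [h, if_neg ht, mul_inv_cancel]
        exact one_mem _
    convert mul_mem (inv_mem (key 0)) (key 1) using 1
    group

end FirstSextic

namespace FirstSextic

open ProjPlane Holonomy Topology unitInterval Set

variable {x₁ : Compl} {K : Type*} [Group K] {ρ : FundamentalGroup Compl x₁ →* K}

lemma FlatOn.neg {A : Subgroup K} {O : Set (ℂ × ℂ)} {h : ℂ × ℂ → K}
    (hh : FlatOn (fun γ : C(I, ℂ × ℂ) => hol ρ (chart.comp γ)) A O h) :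
    FlatOn (fun γ : C(I, ℂ × ℂ) => hol ρ (chart.comp γ)) A {q | (-q.1, q.2) ∈ O}
      fun q => h (-q.1, q.2) := by
  intro γ hγ
  have := hh ((⟨fun q => (-q.1, q.2), by fun_prop⟩ : C(ℂ × ℂ, ℂ × ℂ)).comp γ) hγ
  beta_reduce at this
  rwa [← ContinuousMap.comp_assoc, chart_comp_neg] at this

lemma neg_mem_generic {d : ℂ} : -d ∈ Generic ↔ d ∈ Generic := by
  simp only [Generic, mem_ofPred_eq, neg_sq]

variable {G : GaugeSystem ρ}

lemma JumpValues.exists_flatOn (J : JumpValues G) : ∃ h : ℂ × ℂ → K,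
    FlatOn (fun γ : C(I, ℂ × ℂ) => hol ρ (chart.comp γ)) J.group {q | q ∈ Dom ∧ q.1 ∈ Generic} h ∧
    ∀ q ∈ Dom, q.1 ∈ Generic → h q * (h (-q.1, q.2))⁻¹ ∈ J.group := by
  classical
  have hbR : baseDir ∈ RH := by norm_num [baseDir]
  have hbU : baseDir ∈ UH := by norm_num [baseDir]
  obtain ⟨h₀, hh₀⟩ := J.exists_isFlat_slice
  have oR : IsOpen RH := isOpen_lt continuous_const Complex.reCLM.continuous
  have oU : IsOpen UH := isOpen_lt continuous_const Complex.imCLM.continuous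
  obtain ⟨r, hr, hr'⟩ := exists_isFlat (D := RH) isHeight_re (fun _ h => h) oR convex_RH
    (G.isGauge_r 1 (by norm_num)) isPreconnected_RH_inter ⟨hbR, baseDir_mem_generic⟩ ⟨h₀, hh₀⟩
  obtain ⟨u, hu, hu'⟩ := exists_isFlat (D := UH) (A := J.group) isHeight_im (fun _ h => h) oU
    convex_UH (G.isGauge_u 1 (by norm_num)) isPreconnected_UH_inter ⟨hbU, baseDir_mem_generic⟩
    ⟨h₀, hh₀.1, fun q hq hqb => by
      have hqb' : q.1 = baseDir := hqb
      rw [G.q1 1 (by norm_num) q ⟨hqb' ▸ ⟨hbR, hbU⟩, hq.2⟩]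
      exact hh₀.2 q ⟨hqb' ▸ hbR, hq.2⟩ hqb⟩
  have hsl : ∀ {d : ℂ} {T : Set ℂ} {h : ℂ × ℂ → K}, d ∈ T →
      FlatOn (fun γ : C(I, ℂ × ℂ) => hol ρ (chart.comp γ)) J.group {q | q ∈ Dom ∧ q.1 ∈ T} h →
      FlatOn (fun γ : C(I, ℂ × ℂ) => hol ρ (chart.comp γ)) J.group
        {q | q ∈ Dom ∧ q.1 ∈ ({d} : Set ℂ)} h := fun {d T h} hd hh γ hγ =>
    hh γ fun t => ⟨(hγ t).1, by rw [show (γ t).1 = d from (hγ t).2]; exact hd⟩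
  have agree1 : ∀ d z', (d, z') ∈ Dom → d ∈ Generic → d ∈ RH → d ∈ UH →
      r (d, z') * (u (d, z'))⁻¹ ∈ J.group := by
    intro d z' hq hg hR hU
    obtain ⟨z, hz⟩ := exists_mem_vis (D := Q1) isHeight_re (fun _ h => h.1) ⟨hR, hU⟩
    refine mul_inv_mem_of_flat hg (hsl (T := RH ∩ Generic) ⟨hR, hg⟩ hr)
      (hsl (T := UH ∩ Generic) ⟨hU, hg⟩ hu) (Vis.mem_dom hz) hq ?_
    have h1 := hr' (d, z) ⟨hR, hz.2⟩ ⟨hR, hg⟩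
    have h2 := hu' (d, z) ⟨hU, hz.2⟩ ⟨hU, hg⟩
    rw [G.q1 1 (by norm_num) _ hz] at h2
    convert mul_mem h1 (inv_mem h2) using 1
    group
  have agree4 : ∀ d z', (d, z') ∈ Dom → d ∈ Generic → d ∈ RH → -d ∈ UH →
      r (d, z') * (u (-d, z'))⁻¹ ∈ J.group := by
    intro d z' hq hg hR hU
    have h4 : d ∈ Q4 := by
      rw [mem_UH, Complex.neg_im] at hU
      exact ⟨hR, neg_pos.1 hU⟩
    obtain ⟨z, hz⟩ := exists_mem_vis (D := Q4) isHeight_re (fun _ h => h.1) h4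
    refine mul_inv_mem_of_flat (h' := fun q => u (-q.1, q.2)) hg
      (hsl (T := RH ∩ Generic) ⟨hR, hg⟩ hr)
      (hsl (T := {d | -d ∈ UH ∩ Generic}) (h := fun q => u (-q.1, q.2))
        ⟨hU, neg_mem_generic.2 hg⟩ ?_) (Vis.mem_dom hz) hq ?_
    · exact fun γ hγ => FlatOn.neg hu γ fun t => ⟨neg_mem_dom.2 (hγ t).1, (hγ t).2⟩
    have h1 := hr' (d, z) ⟨hR, hz.2⟩ ⟨hR, hg⟩
    have hz' : (-d, z) ∈ Vis UH 1 := Vis.neg (fun d hd => by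
      rw [mem_UH, Complex.neg_im]; exact neg_pos.2 hd.2) hz
    have h2 := hu' (-d, z) hz' ⟨hU, neg_mem_generic.2 hg⟩
    rw [G.q4 1 (by norm_num) _ _ hz] at h2
    convert mul_mem h1 (inv_mem (mul_mem h2 J.c_mem)) using 1
    group
  have hnU : ∀ {d : ℂ}, d ∈ UH → -d ∉ UH := fun {d} h h' => by
    rw [mem_UH] at h h'
    rw [Complex.neg_im] at h'
    linarith
  have hnR : ∀ {d : ℂ}, d ∈ RH → -d ∉ RH := fun {d} h h' => by
    rw [mem_RH] at h h'
    rw [Complex.neg_re] at h'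
    linarith
  let h : ℂ × ℂ → K := fun q => if q.1 ∈ RH then r q else if q.1 ∈ UH then u q else
    if -q.1 ∈ RH then r (-q.1, q.2) else u (-q.1, q.2)
  have eR : ∀ d z, (d, z) ∈ Dom → d ∈ Generic → d ∈ RH → h (d, z) * (r (d, z))⁻¹ ∈ J.group := by
    intro d z _ _ hR
    simp only [h, if_pos hR, mul_inv_cancel]
    exact one_mem _
  have eU : ∀ d z, (d, z) ∈ Dom → d ∈ Generic → d ∈ UH → h (d, z) * (u (d, z))⁻¹ ∈ J.group := by
    intro d z hq hg hU
    by_cases hR : d ∈ RH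
    · simp only [h, if_pos hR]
      exact agree1 d z hq hg hR hU
    · simp only [h, if_neg hR, if_pos hU, mul_inv_cancel]
      exact one_mem _
  have eR' : ∀ d z, (d, z) ∈ Dom → d ∈ Generic → -d ∈ RH → h (d, z) * (r (-d, z))⁻¹ ∈ J.group := by
    intro d z hq hg hR
    have hR' : d ∉ RH := fun h => hnR h hR
    by_cases hU : d ∈ UH
    · simp only [h, if_neg hR', if_pos hU]
      have := agree4 (-d) z (neg_mem_dom.2 hq) (neg_mem_generic.2 hg) hR (by rwa [neg_neg])
      rw [neg_neg] at this
      convert inv_mem this using 1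
      group
    · simp only [h, if_neg hR', if_neg hU, if_pos hR, mul_inv_cancel]
      exact one_mem _
  have eU' : ∀ d z, (d, z) ∈ Dom → d ∈ Generic → -d ∈ UH → h (d, z) * (u (-d, z))⁻¹ ∈ J.group := by
    intro d z hq hg hU
    have hU' : d ∉ UH := fun h => hnU h hU
    by_cases hR : d ∈ RH
    · simp only [h, if_pos hR]
      exact agree4 d z hq hg hR hU
    by_cases hR' : -d ∈ RH
    · simp only [h, if_neg hR, if_neg hU', if_pos hR']
      exact agree1 (-d) z (neg_mem_dom.2 hq) (neg_mem_generic.2 hg) hR' hU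
    · simp only [h, if_neg hR, if_neg hU', if_neg hR', mul_inv_cancel]
      exact one_mem _
  have hcov : ∀ d ∈ Generic, d ∈ RH ∨ d ∈ UH ∨ -d ∈ RH ∨ -d ∈ UH := by
    intro d hd
    by_contra! hc
    simp only [mem_RH, mem_UH, Complex.neg_re, Complex.neg_im] at hc
    have : d = 0 := Complex.ext (by simp; linarith) (by simp; linarith)
    exact hd.1 (by simp [this])
  have hloc : ∀ {D : Set ℂ} {k : ℂ × ℂ → K} {x : ℂ × ℂ}, IsOpen D → x.1 ∈ D →
      FlatOn (fun γ : C(I, ℂ × ℂ) => hol ρ (chart.comp γ)) J.group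
        {q | q ∈ Dom ∧ q.1 ∈ D ∩ Generic} k →
      (∀ d z, (d, z) ∈ Dom → d ∈ Generic → d ∈ D → h (d, z) * (k (d, z))⁻¹ ∈ J.group) →
      ∃ U ∈ 𝓝 x, ∀ γ : C(I, ℂ × ℂ), (∀ t, γ t ∈ {q : ℂ × ℂ | q ∈ Dom ∧ q.1 ∈ Generic}) →
        (∀ t, γ t ∈ U) → h (γ 0) * hol ρ (chart.comp γ) * (h (γ 1))⁻¹ ∈ J.group := by
    intro D k x hD hx hk he
    refine ⟨_, (hD.preimage continuous_fst).mem_nhds hx, fun γ hγ hγU => ?_⟩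
    have h1 : h (γ 0) * (k (γ 0))⁻¹ ∈ J.group := he _ _ (hγ 0).1 (hγ 0).2 (hγU 0)
    have h2 : h (γ 1) * (k (γ 1))⁻¹ ∈ J.group := he _ _ (hγ 1).1 (hγ 1).2 (hγU 1)
    have h3 := hk γ fun t => ⟨(hγ t).1, hγU t, (hγ t).2⟩
    beta_reduce at h3
    convert mul_mem (mul_mem h1 h3) (inv_mem h2) using 1
    group
  refine ⟨h, flatOn_of_local ρ chart (fun q hq => (chart_mem_iff q).2 hq.1) fun x hx => ?_, ?_⟩
  · have hneg : ∀ {D : Set ℂ} {k : ℂ × ℂ → K},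
        FlatOn (fun γ : C(I, ℂ × ℂ) => hol ρ (chart.comp γ)) J.group
          {q | q ∈ Dom ∧ q.1 ∈ D ∩ Generic} k →
        FlatOn (fun γ : C(I, ℂ × ℂ) => hol ρ (chart.comp γ)) J.group
          {q | q ∈ Dom ∧ q.1 ∈ {d | -d ∈ D} ∩ Generic} fun q => k (-q.1, q.2) := by
      intro D k hk γ hγ
      exact FlatOn.neg hk γ fun t =>
        ⟨neg_mem_dom.2 (hγ t).1, (hγ t).2.1, neg_mem_generic.2 (hγ t).2.2⟩
    rcases hcov _ hx.2 with h1 | h1 | h1 | h1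
    · exact hloc oR h1 hr eR
    · exact hloc oU h1 hu eU
    · exact hloc (D := {d | -d ∈ RH}) (oR.preimage continuous_neg) h1 (hneg hr) eR'
    · exact hloc (D := {d | -d ∈ UH}) (oU.preimage continuous_neg) h1 (hneg hu) eU'
  · rintro ⟨d, z⟩ hq hg
    have hq' := neg_mem_dom.2 hq
    have hg' := neg_mem_generic.2 hg
    have key : ∀ a b : K, h (d, z) * a⁻¹ ∈ J.group → h (-d, z) * b⁻¹ ∈ J.group → b = a →
        h (d, z) * (h (-d, z))⁻¹ ∈ J.group := by
      rintro a b h1 h2 rfl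
      convert mul_mem h1 (inv_mem h2) using 1
      group
    rcases hcov _ hg with h1 | h1 | h1 | h1
    · exact key _ _ (eR _ _ hq hg h1) (eR' _ _ hq' hg' (by rwa [neg_neg])) (by rw [neg_neg])
    · exact key _ _ (eU _ _ hq hg h1) (eU' _ _ hq' hg' (by rwa [neg_neg])) (by rw [neg_neg])
    · exact key _ _ (eR' _ _ hq hg h1) (eR _ _ hq' hg' h1) rfl
    · exact key _ _ (eU' _ _ hq hg h1) (eU _ _ hq' hg' h1) rfl

end FirstSextic

namespace FirstSextic

open ProjPlane Holonomy Topology unitInterval Set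

lemma chart_eq_mk {p s t d : ℂ} (ht : t ≠ 0) (hd : (d * t) ^ 2 = s ^ 2 - 4 * p * t) :
    chart (d, s / t) = Projectivization.mk ℂ (vec p s t) (vec_ne_zero (Or.inl ht)) := by
  refine (Projectivization.mk_eq_mk_iff' ..).2 ⟨t⁻¹, ?_⟩
  rw [smul_vec]
  congr 1
  · field_simp
    linear_combination hd
  · field_simp
  · field_simp

lemma eq_or_eq_neg_of_chart_eq {q q' : ℂ × ℂ} (h : chart q = chart q') :
    q = q' ∨ q = (-q'.1, q'.2) := by
  obtain ⟨a, ha⟩ := (Projectivization.mk_eq_mk_iff' ..).1 h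
  rw [smul_vec] at ha
  have h1 := congrArg tau ha
  have h2 := congrArg sig ha
  have h3 := congrArg pii ha
  simp only [tau_vec, sig_vec, pii_vec, mul_one] at h1 h2 h3
  subst h1
  rw [one_mul] at h2 h3
  have h4 : q.1 ^ 2 = q'.1 ^ 2 := by
    rw [h2] at h3
    linear_combination 4 * h3
  rcases sq_eq_sq_iff_eq_or_eq_neg.1 h4 with h | h
  · exact Or.inl (Prod.ext h h2.symm)
  · exact Or.inr (Prod.ext h h2.symm)

/-- The chart has continuous local sections away from the branch locus. -/
lemma exists_section {q₀ : ℂ × ℂ} (h₀ : q₀.1 ≠ 0) : ∃ W : Set P2, IsOpen W ∧ chart q₀ ∈ W ∧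
    ∃ l : P2 → ℂ × ℂ, ContinuousOn l W ∧ l (chart q₀) = q₀ ∧ ∀ P ∈ W, chart (l P) = P := by
  let v : (Fin 3 → ℂ) → ℂ := fun w => conic w / tau w ^ 2 / q₀.1 ^ 2
  let m : (Fin 3 → ℂ) → ℂ × ℂ := fun w => (q₀.1 * v w ^ (1 / 2 : ℂ), sig w / tau w)
  have hv : ∀ (c : ℂ) w, c ≠ 0 → v (c • w) = v w := fun c w hc => by
    simp only [v, conic_smul, tau_smul, mul_pow]
    rw [mul_div_mul_left _ _ (pow_ne_zero 2 hc)]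
  have hm : ∀ (c : ℂ) w, c ≠ 0 → m (c • w) = m w := fun c w hc => by
    simp only [m, hv c w hc, sig_smul, tau_smul, mul_div_mul_left _ _ hc]
  have hvc : ∀ w, tau w ≠ 0 → ContinuousAt v w := fun w hw =>
    (continuous_conic.continuousAt.div (continuous_tau.continuousAt.pow 2)
      (pow_ne_zero 2 hw)).div_const _
  have hq : ∀ {α : Type} (g : (Fin 3 → ℂ) → α), (∀ (c : ℂ) w, c ≠ 0 → g (c • w) = g w) →
      g (chart q₀).rep = g (vec ((q₀.2 ^ 2 - q₀.1 ^ 2) / 4) q₀.2 1) := fun g hg =>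
    apply_rep_mk hg _ _
  have hv₀ : v (vec ((q₀.2 ^ 2 - q₀.1 ^ 2) / 4) q₀.2 1) = 1 := by
    simp only [v, conic, tau_vec, sig_vec, pii_vec]
    field_simp
    ring
  let p : (Fin 3 → ℂ) → Prop := fun w => tau w ≠ 0 ∧ v w ∈ Complex.slitPlane
  have hp : ∀ (c : ℂ) w, c ≠ 0 → (p (c • w) ↔ p w) := fun c w hc => by
    simp only [p, hv c w hc, tau_smul, mul_ne_zero_iff, ne_eq, hc, not_false_iff, true_and]
  have hpo : IsOpen {w | p w} := by
    have hvo : ContinuousOn v {w | tau w ≠ 0} := fun w hw => (hvc w hw).continuousWithinAt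
    exact hvo.isOpen_inter_preimage (isOpen_ne_fun continuous_tau continuous_const)
      Complex.isOpen_slitPlane
  have hW := isOpen_rep hp hpo
  refine ⟨_, hW, ?_, fun P => m P.rep, continuousOn_rep hm hW ?_, ?_, ?_⟩
  · rw [mem_ofPred_eq, hq p fun c w hc => propext (hp c w hc)]
    refine ⟨by simp, ?_⟩
    rw [hv₀]
    exact Complex.one_mem_slitPlane
  · intro w hw hwW
    rw [mem_ofPred_eq, apply_rep_mk (g := p) fun c w hc => propext (hp c w hc)] at hwW
    exact (continuousAt_const.mul ((hvc w hwW.1).cpow continuousAt_const hwW.2)).prodMk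
      (continuous_sig.continuousAt.div continuous_tau.continuousAt hwW.1)
  · beta_reduce
    rw [hq m hm]
    simp only [m, hv₀]
    simp
  · intro P hP
    have hP' : tau P.rep ≠ 0 := hP.1
    conv_rhs => rw [← P.mk_rep]
    have e := vec_eq P.rep
    simp only [m]
    rw [chart_eq_mk (p := pii P.rep) hP']
    · simp only [e]
    · have : (v P.rep ^ (1 / 2 : ℂ)) ^ 2 = v P.rep := by
        rw [← Complex.cpow_nat_mul]
        norm_num
      rw [mul_pow, mul_pow, this]
      simp only [v]
      field_simp
      rw [conic]
      ring

end FirstSextic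

namespace FirstSextic

open ProjPlane Holonomy Topology unitInterval Set

lemma isPathConnected_ball_diff {c : ℂ} {r : ℝ} (hr : 0 < r) {C : Set ℂ} (hC : C.Countable) :
    IsPathConnected (Metric.ball c r \ C) := by
  have hinj : Function.Injective (OpenPartialHomeomorph.univBall c r) := by
    have := (OpenPartialHomeomorph.univBall c r).injOn
    rwa [OpenPartialHomeomorph.univBall_source, injOn_univ] at this
  have him : range (OpenPartialHomeomorph.univBall c r) = Metric.ball c r := by
    have := (OpenPartialHomeomorph.univBall c r).image_source_eq_target
    rwa [OpenPartialHomeomorph.univBall_source, OpenPartialHomeomorph.univBall_target _ hr,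
      image_univ] at this
  have h := ((hC.preimage hinj).isPathConnected_compl_of_one_lt_rank one_lt_rank).image
    (OpenPartialHomeomorph.continuous_univBall c r)
  convert h using 1
  rw [← preimage_compl, image_preimage_eq_inter_range, him, inter_comm, sdiff_eq]

lemma isOpen_sextic_compl : IsOpen Compl := by
  have hc : Continuous sextic := by
    have := continuous_conic
    have := continuous_sig
    have := continuous_pii
    have := continuous_tau
    unfold sextic
    fun_prop
  convert isOpen_rep (p := fun v => sextic v ≠ 0)
    (fun c v hc => by simp [sextic_smul, hc]) (isOpen_ne_fun hc continuous_const) using 1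
  ext P
  rw [mem_ofPred_eq, ← mk_mem P.rep_nonzero, P.mk_rep]

variable {x₁ : Compl} {K : Type*} [Group K] {ρ : FundamentalGroup Compl x₁ →* K}
  {A : Subgroup K} {O : Set P2} {G : P2 → K}

/-- Around a point with coordinates in which a set is the complement of finitely many slices, flat
sections over this set extend. -/
lemma exists_gauge_of_coordinates (hG : FlatOn (hol ρ) A O G) {f : C(ℂ × ℂ, P2)} {x : P2}
    (hx : x ∈ Compl) {W : Set P2} (hW : IsOpen W) (hxW : x ∈ W) {l : P2 → ℂ × ℂ}
    (hl : ContinuousOn l W) (hfl : ∀ P ∈ W, f (l P) = P) {C : Set ℂ} (hC : C.Countable)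
    (hO : ∀ᶠ z in 𝓝 (l x), f z ∈ O ↔ z.1 ∉ C) :
    x ∈ closure O ∧ ∃ U : Set P2, IsOpen U ∧ x ∈ U ∧ U ⊆ Compl ∧
      ∃ k : P2 → K, IsGauge (hol ρ) (ContinuousMap.id P2) U k ∧
      ∀ y ∈ U ∩ O, ∀ y' ∈ U ∩ O, G y * (k y)⁻¹ * k y' * (G y')⁻¹ ∈ A := by
  have hS : ∀ᶠ z in 𝓝 (l x), f z ∈ Compl := by
    refine f.continuous.continuousAt.eventually_mem ?_
    rw [hfl x hxW]
    exact isOpen_sextic_compl.mem_nhds hx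
  obtain ⟨ε, hε, hball⟩ := Metric.eventually_nhds_iff_ball.1 (hO.and hS)
  have hprod : ∀ z : ℂ × ℂ, z ∈ Metric.ball (l x) ε ↔
      z.1 ∈ Metric.ball (l x).1 ε ∧ z.2 ∈ Metric.ball (l x).2 ε := fun z => by
    rw [← Prod.mk.eta (p := l x), ← ball_prod_same, mem_prod]
  constructor
  · have h1 : l x ∈ closure {z : ℂ × ℂ | f z ∈ O} := by
      refine mem_closure_iff_nhds.2 fun N hN => ?_
      have h2 : ∀ᶠ d in 𝓝 (l x).1, (d, (l x).2) ∈ N ∩ Metric.ball (l x) ε := by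
        have : ContinuousAt (fun d : ℂ => (d, (l x).2)) (l x).1 := by fun_prop
        exact this.eventually_mem (Filter.inter_mem hN (Metric.ball_mem_nhds _ hε))
      obtain ⟨d, hd, hdC⟩ := mem_closure_iff_nhds.1 ((hC.dense_compl ℂ) (l x).1) _ h2
      exact ⟨_, hd.1, ((hball _ hd.2).1).2 hdC⟩
    rw [← hfl x hxW]
    exact closure_mono (image_subset_iff.2 fun z hz => hz)
      (image_closure_subset_closure_image f.continuous (mem_image_of_mem _ h1))
  have : ContractibleSpace (Metric.ball (l x) ε) :=
    (convex_ball _ _).contractibleSpace ⟨_, Metric.mem_ball_self hε⟩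
  obtain ⟨k, hk⟩ := exists_isGauge ρ f (Metric.ball (l x) ε) (fun _ => inferInstance)
    fun z hz => (hball z hz).2
  refine ⟨_, hl.isOpen_inter_preimage hW Metric.isOpen_ball, ⟨hxW, Metric.mem_ball_self hε⟩, ?_,
    k ∘ l, hk.of_section (hl.mono inter_subset_left) (fun P hP => hP.2) fun P hP => hfl P hP.1, ?_⟩
  · intro P hP
    have := (hball _ hP.2).2
    rwa [hfl P hP.1] at this
  · rintro y ⟨⟨hyW, hyB⟩, hyO⟩ y' ⟨⟨hyW', hyB'⟩, hyO'⟩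
    have hpc : IsPathConnected ((Metric.ball (l x).1 ε \ C) ×ˢ Metric.ball (l x).2 ε) :=
      (isPathConnected_ball_diff hε hC).prod
        ((convex_ball _ _).isPathConnected ⟨_, Metric.mem_ball_self hε⟩)
    have hmem : ∀ P ∈ W, l P ∈ Metric.ball (l x) ε → P ∈ O →
        l P ∈ (Metric.ball (l x).1 ε \ C) ×ˢ Metric.ball (l x).2 ε := fun P hPW hPB hPO => by
      have := (hprod _).1 hPB
      refine ⟨⟨this.1, ((hball _ hPB).1).1 ?_⟩, this.2⟩
      rwa [hfl P hPW]
    obtain ⟨p, hp⟩ := hpc.joinedIn _ (hmem y hyW hyB hyO) _ (hmem y' hyW' hyB' hyO')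
    have hpB : ∀ t, p t ∈ Metric.ball (l x) ε := fun t => (hprod _).2 ⟨(hp t).1.1, (hp t).2⟩
    have e := hk p.toContinuousMap hpB
    have h1 := hG (f.comp p.toContinuousMap) fun t => ((hball _ (hpB t)).1).2 (hp t).1.2
    rw [e] at h1
    simp only [ContinuousMap.comp_apply, Path.coe_toContinuousMap, Path.source, Path.target,
      hfl y hyW, hfl y' hyW'] at h1
    simpa only [Function.comp_apply, mul_assoc] using h1

end FirstSextic

namespace FirstSextic

open ProjPlane Holonomy Topology unitInterval Set

/-- Coordinates around the line at infinity of the affine chart. -/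
def chartInf : C(ℂ × ℂ, P2) where
  toFun q := Projectivization.mk ℂ (vec q.2 1 q.1) (vec_ne_zero (Or.inr one_ne_zero))
  continuous_toFun := continuous_proj.comp (Continuous.subtype_mk (continuous_vec.comp
    (f := fun q : ℂ × ℂ => (q.2, (1 : ℂ), q.1)) (by fun_prop))
    fun _ => vec_ne_zero (Or.inr one_ne_zero))

lemma exists_section_inf {x : P2} (hx : sig x.rep ≠ 0) : ∃ W : Set P2, IsOpen W ∧ x ∈ W ∧
    ∃ l : P2 → ℂ × ℂ, ContinuousOn l W ∧ (tau x.rep = 0 → (l x).1 = 0) ∧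
      ∀ P ∈ W, chartInf (l P) = P := by
  let m : (Fin 3 → ℂ) → ℂ × ℂ := fun w => (tau w / sig w, pii w / sig w)
  have hm : ∀ (c : ℂ) w, c ≠ 0 → m (c • w) = m w := fun c w hc => by
    simp only [m, sig_smul, tau_smul, pii_smul, mul_div_mul_left _ _ hc]
  have hp : ∀ (c : ℂ) w, c ≠ 0 → (sig (c • w) ≠ 0 ↔ sig w ≠ 0) := fun c w hc => by
    simp [sig_smul, hc]
  have hW := isOpen_rep hp (isOpen_ne_fun continuous_sig continuous_const)
  refine ⟨_, hW, hx, fun P => m P.rep, continuousOn_rep hm hW ?_, ?_, ?_⟩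
  · intro w hw hwW
    rw [mem_ofPred_eq, apply_rep_mk (g := fun v => sig v ≠ 0) fun c w hc => propext (hp c w hc)]
      at hwW
    exact (continuous_tau.continuousAt.div continuous_sig.continuousAt hwW).prodMk
      (continuous_pii.continuousAt.div continuous_sig.continuousAt hwW)
  · intro h
    simp only [m, h, zero_div]
  · intro P hP
    have hP' : sig P.rep ≠ 0 := hP
    conv_rhs => rw [← P.mk_rep]
    refine (Projectivization.mk_eq_mk_iff' ..).2 ⟨(sig P.rep)⁻¹, ?_⟩
    have e : (sig P.rep)⁻¹ • P.rep = vec (pii P.rep / sig P.rep) 1 (tau P.rep / sig P.rep) := by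
      rw [div_eq_inv_mul, div_eq_inv_mul, ← inv_mul_cancel₀ hP', ← smul_vec, vec_eq]
    exact e

/-- The part of the complement of the sextic over the generic points. -/
def GenericPart : Set P2 := chart '' {q | q ∈ Dom ∧ q.1 ∈ Generic}

lemma chart_mem_genericPart {q : ℂ × ℂ} : chart q ∈ GenericPart ↔ q ∈ Dom ∧ q.1 ∈ Generic := by
  refine ⟨?_, fun h => ⟨q, h, rfl⟩⟩
  rintro ⟨q', ⟨h1, h2⟩, h⟩
  rcases eq_or_eq_neg_of_chart_eq h.symm with rfl | rfl
  · exact ⟨h1, h2⟩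
  · exact ⟨neg_mem_dom.2 h1, neg_mem_generic.2 h2⟩

lemma exists_chart_eq {x : P2} (hx : tau x.rep ≠ 0) : ∃ q, chart q = x := by
  obtain ⟨w, hw⟩ := exists_sq_eq (conic x.rep)
  refine ⟨_, (chart_eq_mk (d := w / tau x.rep) (s := sig x.rep) (p := pii x.rep) hx ?_).trans ?_⟩
  · rw [div_mul_cancel₀ _ hx, hw, conic]
  · simp only [vec_eq, x.mk_rep]

lemma chartInf_mem_genericPart (p : ℂ) (hp : chartInf (0, p) ∈ Compl) :
    ∀ᶠ z in 𝓝 ((0, p) : ℂ × ℂ), chartInf z ∈ GenericPart ↔ z.1 ∉ ({0} : Set ℂ) := by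
  have hS : ∀ᶠ z in 𝓝 ((0, p) : ℂ × ℂ), chartInf z ∈ Compl :=
    chartInf.continuous.continuousAt.eventually_mem (isOpen_sextic_compl.mem_nhds hp)
  have hne : ∀ κ : ℂ, ∀ᶠ z in 𝓝 ((0, p) : ℂ × ℂ), 1 - 4 * z.2 * z.1 ≠ κ * z.1 ^ 2 := fun κ =>
    (isOpen_ne_fun (f := fun z : ℂ × ℂ => 1 - 4 * z.2 * z.1) (g := fun z => κ * z.1 ^ 2)
      (by fun_prop) (by fun_prop)).mem_nhds (by simp)
  filter_upwards [hS, hne 0, hne (16 / 9), hne 2, hne (-1)] with ⟨t, p⟩ hS h0 h1 h2 h3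
  rw [mem_singleton_iff]
  constructor
  · rintro ⟨q, -, h⟩ rfl
    obtain ⟨a, ha⟩ := (Projectivization.mk_eq_mk_iff' ..).1 h
    have := congrArg tau ha
    rw [smul_vec, tau_vec, tau_vec] at this
    simp at this
  · intro ht
    dsimp only at ht h0 h1 h2 h3
    obtain ⟨w, hw⟩ := exists_sq_eq (1 - 4 * p * t)
    have e : chart (w / t, 1 / t) = chartInf (t, p) := chart_eq_mk ht (by
      rw [div_mul_cancel₀ _ ht, hw]; ring)
    rw [← e] at hS ⊢
    refine chart_mem_genericPart.2 ⟨(chart_mem_iff _).1 hS, ?_, ?_, ?_, ?_⟩ <;>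
    · rw [div_pow, hw, ne_eq, div_eq_iff (pow_ne_zero 2 ht)]
      assumption

variable {x₁ : Compl} {K : Type*} [Group K] {ρ : FundamentalGroup Compl x₁ →* K}
  {G : GaugeSystem ρ}

lemma JumpValues.exists_flatOn_genericPart (J : JumpValues G) :
    ∃ g : P2 → K, FlatOn (hol ρ) J.group GenericPart g := by
  obtain ⟨h, hh, hn⟩ := J.exists_flatOn
  have hlift : ∀ P : P2, ∃ q, P ∈ GenericPart → (q ∈ Dom ∧ q.1 ∈ Generic) ∧ chart q = P := by
    intro P
    by_cases hP : P ∈ GenericPart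
    · obtain ⟨q, hq⟩ := hP
      exact ⟨q, fun _ => hq⟩
    · exact ⟨0, fun h => (hP h).elim⟩
  choose L hL using hlift
  have key : ∀ q, chart q ∈ GenericPart → h (L (chart q)) * (h q)⁻¹ ∈ J.group := by
    intro q hq
    obtain ⟨hq1, hq2⟩ := chart_mem_genericPart.1 hq
    rcases eq_or_eq_neg_of_chart_eq (hL _ hq).2 with h1 | h1
    · rw [h1, mul_inv_cancel]
      exact one_mem _
    · rw [h1]
      convert inv_mem (hn q hq1 hq2) using 1
      group
  refine ⟨fun P => h (L P), flatOn_of_local ρ (ContinuousMap.id P2) ?_ ?_⟩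
  · rintro _ ⟨q, hq, rfl⟩
    exact (chart_mem_iff q).2 hq.1
  rintro _ ⟨q, hq, rfl⟩
  obtain ⟨W, hW, hqW, l, hl, -, hcl⟩ := exists_section (q₀ := q) hq.1.1
  refine ⟨W, hW.mem_nhds hqW, fun γ hγ hγW => ?_⟩
  let v : C(I, ℂ × ℂ) := ⟨fun t => l (γ t), hl.comp_continuous γ.continuous hγW⟩
  have e : chart.comp v = (ContinuousMap.id P2).comp γ := by
    ext t
    exact hcl _ (hγW t)
  have hv : ∀ t, chart (v t) = γ t := fun t => hcl _ (hγW t)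
  have h0 := hh v fun t => chart_mem_genericPart.1 ((hv t).symm ▸ hγ t)
  have h1 := key (v 0) ((hv 0).symm ▸ hγ 0)
  have h2 := key (v 1) ((hv 1).symm ▸ hγ 1)
  beta_reduce at h0
  rw [e] at h0
  rw [hv] at h1 h2
  convert mul_mem (mul_mem h1 h0) (inv_mem h2) using 1
  group

lemma JumpValues.exists_flatOn_compl (J : JumpValues G) :
    ∃ g : P2 → K, FlatOn (hol ρ) J.group Compl g := by
  obtain ⟨g, hg⟩ := J.exists_flatOn_genericPart
  have key : ∀ x ∈ Compl, x ∈ closure GenericPart ∧ ∃ U : Set P2, IsOpen U ∧ x ∈ U ∧ U ⊆ Compl ∧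
      ∃ k : P2 → K, IsGauge (hol ρ) (ContinuousMap.id P2) U k ∧
      ∀ y ∈ U ∩ GenericPart, ∀ y' ∈ U ∩ GenericPart,
        g y * (k y)⁻¹ * k y' * (g y')⁻¹ ∈ J.group := by
    intro x hx
    by_cases hτ : tau x.rep = 0
    · have hσ : sig x.rep ≠ 0 := by
        intro hσ
        rw [← x.mk_rep, mk_mem] at hx
        exact hx (by simp [sextic, conic, hσ, hτ])
      obtain ⟨W, hW, hxW, l, hl, hl0, hfl⟩ := exists_section_inf hσ
      refine exists_gauge_of_coordinates hg hx hW hxW hl hfl (countable_singleton 0) ?_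
      have e : l x = (0, (l x).2) := Prod.ext (hl0 hτ) rfl
      rw [e]
      refine chartInf_mem_genericPart _ ?_
      rwa [← e, hfl x hxW]
    · obtain ⟨q, rfl⟩ := exists_chart_eq hτ
      have hq := (chart_mem_iff q).1 hx
      obtain ⟨W, hW, hxW, l, hl, hlq, hfl⟩ := exists_section hq.1
      refine exists_gauge_of_coordinates hg hx hW hxW hl hfl
        (C := Generic.compl) finite_compl_generic.countable ?_
      rw [hlq]
      filter_upwards [isOpen_dom.mem_nhds hq] with z hz
      rw [chart_mem_genericPart]
      exact ⟨fun h h' => h' h.2, fun h => ⟨hz, by_contra h⟩⟩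
  exact exists_flatOn_of_dense ρ subset_rfl (fun x hx => (key x hx).1) fun x hx => (key x hx).2

end FirstSextic

namespace FirstSextic

open ProjPlane Holonomy Topology unitInterval Set

theorem map_dihedralGroup_commute {x₁ : Compl} (ρ : FundamentalGroup Compl x₁ →* DihedralGroup 3)
    (c d : FundamentalGroup Compl x₁) : ρ c * ρ d = ρ d * ρ c := by
  obtain ⟨G⟩ := nonempty_gaugeSystem ρ
  obtain ⟨J⟩ := nonempty_jumpValues G
  obtain ⟨g, hg⟩ := J.exists_flatOn_compl
  exact Holonomy.FlatOn.commute ρ hg (J.group_commute J.commute) c d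

end FirstSextic

/-- For any basepoints x₁ ∈ ℙ² ∖ C⁽¹⁾ and x₂ ∈ ℙ² ∖ C⁽²⁾, the fundamental groups
π₁(ℙ² ∖ C⁽¹⁾, x₁) and π₁(ℙ² ∖ C⁽²⁾, x₂) are not isomorphic. -/
theorem stmt_7 (x₁ : ↥(VV (F₁ * Q₁))ᶜ) (x₂ : ↥(VV (F₂ * Q₂))ᶜ) :
    IsEmpty (FundamentalGroup (↥(VV (F₁ * Q₁))ᶜ) x₁ ≃*
      FundamentalGroup (↥(VV (F₂ * Q₂))ᶜ) x₂) := by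
  refine ⟨fun φ => ?_⟩
  obtain ⟨f, hf⟩ := SecondSextic.exists_surjective x₂
  let ρ : FundamentalGroup FirstSextic.Compl x₁ →* DihedralGroup 3 :=
    ((MulEquiv.inv' (DihedralGroup 3)).symm.toMonoidHom.comp f).comp φ.toMonoidHom
  have hρ : Function.Surjective ρ :=
    (((MulEquiv.inv' (DihedralGroup 3)).symm.surjective.comp hf).comp φ.surjective)
  obtain ⟨c, hc⟩ := hρ (.r 1)
  obtain ⟨d, hd⟩ := hρ (.sr 0)
  have h := FirstSextic.map_dihedralGroup_commute ρ c d
  rw [hc, hd] at h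
  exact absurd h (by decide)
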